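/- Let r ≥ 1 be an integer and C, A > 0 real constants, and let ε > 0. There exists K > 0, depending only on r, C, A and ε, such that for all reals M, N ≥ 1 with N ≤ M², and all complex sequences (α_m)_{m ≥ 1}, (β_n)_{n ≥ 1} with |α_m| ≤ A for all m and |β_n| ≤ A·τ_r(n)^C/n for all n: | ∑_{1 ≤ m ≤ M} ∑_{N ≤ n < 2N} α_m · β_n · (m/n) | ≤ K · (M^{1+ε}·N^{−1/2} + M^{1/2+ε}), where (m/n) is the Kronecker symbol. -/

import Mathlib

/-!
Statement 5: a variant of Heath-Brown's quadratic large sieve, range `N ≤ M²`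
(Lemma `lem:quadsieve`(a)).
-/

/-- `τ_r(n)`: the number of ordered `r`-tuples of positive integers with product `n`. -/
noncomputable def tau (r n : ℕ) : ℕ :=
  Nat.card {f : Fin r → ℕ // (∀ i, 0 < f i) ∧ ∏ i, f i = n}

/-- The Kronecker symbol `(m/n)` for a positive integer `n`:
`(m/2)^{v₂(n)} · jacobiSym m n'` where `n'` is the odd part of `n`. -/
def kroneckerSym (m : ℤ) (n : ℕ) : ℤ :=
  (if m % 2 = 0 then 0 else if m % 8 = 1 ∨ m % 8 = 7 then 1 else -1) ^ (n.factorization 2) *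
    jacobiSym m (n / 2 ^ (n.factorization 2))


section
open Complex in
lemma norm_Gamma_le {s : ℂ} (hs : 0 < s.re) : ‖Complex.Gamma s‖ ≤ Real.Gamma s.re := by
  rw [Complex.Gamma_eq_integral hs, Real.Gamma_eq_integral hs, Complex.GammaIntegral]
  refine (MeasureTheory.norm_integral_le_integral_norm _).trans (le_of_eq ?_)
  refine MeasureTheory.setIntegral_congr_fun measurableSet_Ioi fun x hx => ?_
  have hx : 0 < x := hx
  simp only [norm_mul, Complex.norm_real]
  rw [Complex.norm_cpow_eq_rpow_re_of_pos hx, Real.norm_eq_abs, abs_of_pos (Real.exp_pos _)]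
  simp

lemma gamma_decay {σ : ℝ} (hσ : 0 < σ) (τ : ℝ) :
    ‖Complex.Gamma (σ + τ * Complex.I)‖ * ‖(σ + τ * Complex.I : ℂ)‖
      ≤ Real.Gamma (σ + 3) * (1 + τ ^ 2)⁻¹ := by
  set s : ℂ := σ + τ * Complex.I with hs
  have hre : s.re = σ := by simp [hs]
  have him : s.im = τ := by simp [hs]
  have h0 : s ≠ 0 := fun h => by rw [h] at hre; simp at hre; linarith
  have h1 : s + 1 ≠ 0 := fun h => by
    have := congrArg Complex.re h; simp [hre] at this; linarith
  have h2 : s + 1 + 1 ≠ 0 := fun h => by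
    have := congrArg Complex.re h; simp [hre] at this; linarith
  have e : Complex.Gamma (s + 1 + 1 + 1) = (s + 1 + 1) * ((s + 1) * (s * Complex.Gamma s)) := by
    rw [Complex.Gamma_add_one _ h2, Complex.Gamma_add_one _ h1, Complex.Gamma_add_one _ h0]
  have hb : ‖Complex.Gamma (s + 1 + 1 + 1)‖ ≤ Real.Gamma (σ + 3) := by
    have := norm_Gamma_le (s := s + 1 + 1 + 1) (by simp [hre]; linarith)
    refine this.trans (le_of_eq ?_)
    congr 1
    simp [hre]; ring
  rw [e, norm_mul, norm_mul, norm_mul] at hb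
  have n1 : 1 + τ ^ 2 ≤ ‖s + 1 + 1‖ * ‖s + 1‖ := by
    have a1 : 1 + τ ^ 2 ≤ ‖s + 1‖ ^ 2 := by
      rw [Complex.sq_norm, Complex.normSq_apply]; simp [hre, him]; nlinarith
    have a2 : 1 + τ ^ 2 ≤ ‖s + 1 + 1‖ ^ 2 := by
      rw [Complex.sq_norm, Complex.normSq_apply]; simp [hre, him]; nlinarith
    have : (1 + τ ^ 2) ^ 2 ≤ (‖s + 1 + 1‖ * ‖s + 1‖) ^ 2 := by
      rw [mul_pow, sq (1 + τ ^ 2)]; gcongr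
    exact le_of_sq_le_sq this (by positivity)
  have hp : 0 < 1 + τ ^ 2 := by positivity
  rw [← div_eq_mul_inv, le_div_iff₀ hp]
  calc ‖Complex.Gamma s‖ * ‖s‖ * (1 + τ ^ 2)
      ≤ ‖Complex.Gamma s‖ * ‖s‖ * (‖s + 1 + 1‖ * ‖s + 1‖) := by gcongr
    _ = ‖s + 1 + 1‖ * (‖s + 1‖ * (‖s‖ * ‖Complex.Gamma s‖)) := by ring
    _ ≤ _ := hb

lemma gamma_decay' {σ : ℝ} (hσ : 0 < σ) (τ : ℝ) :
    ‖Complex.Gamma (σ + τ * Complex.I)‖ ≤ Real.Gamma (σ + 3) / σ * (1 + τ ^ 2)⁻¹ := by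
  have h := gamma_decay hσ τ
  have : σ ≤ ‖(σ + τ * Complex.I : ℂ)‖ := by
    have := Complex.re_le_norm (σ + τ * Complex.I : ℂ)
    simpa using this
  rw [div_mul_eq_mul_div, le_div_iff₀ hσ]
  exact (mul_le_mul_of_nonneg_left this (norm_nonneg _)).trans h

lemma cont_gamma_line {σ : ℝ} (hσ : 0 < σ) :
    Continuous fun τ : ℝ => Complex.Gamma (σ + τ * Complex.I) := by
  rw [continuous_iff_continuousAt]
  intro τ
  refine ContinuousAt.comp (g := Complex.Gamma) (f := fun τ : ℝ => (σ + τ * Complex.I : ℂ)) ?_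
    (by fun_prop)
  refine (Complex.differentiableAt_Gamma _ fun m h => ?_).continuousAt
  have := congrArg Complex.re h
  simp at this
  have : (0:ℝ) ≤ m := Nat.cast_nonneg m
  linarith

lemma int_gamma_line {σ : ℝ} (hσ : 0 < σ) :
    MeasureTheory.Integrable fun τ : ℝ => Complex.Gamma (σ + τ * Complex.I) := by
  refine MeasureTheory.Integrable.mono' (integrable_inv_one_add_sq.const_mul (Real.Gamma (σ + 3) / σ))
    (cont_gamma_line hσ).aestronglyMeasurable (Filter.Eventually.of_forall fun τ => gamma_decay' hσ τ)

lemma exp_neg_mellin {σ : ℝ} (hσ : 0 < σ) {y : ℝ} (hy : 0 < y) :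
    ((Real.exp (-y) : ℝ) : ℂ) = (1 / (2 * Real.pi) : ℝ) •
      ∫ τ : ℝ, Complex.exp (-(σ + τ * Complex.I) * Real.log y) * Complex.Gamma (σ + τ * Complex.I) := by
  have hm : ∀ s : ℂ, 0 < s.re → mellin (fun x : ℝ => ((Real.exp (-x) : ℝ) : ℂ)) s = Complex.Gamma s := by
    intro s hs
    rw [← Complex.GammaIntegral_eq_mellin, Complex.Gamma_eq_integral hs]
  have hl : ∀ τ : ℝ, mellin (fun x : ℝ => ((Real.exp (-x) : ℝ) : ℂ)) (σ + τ * Complex.I)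
      = Complex.Gamma (σ + τ * Complex.I) := fun τ => hm _ (by simpa using hσ)
  have h := mellinInv_mellin_eq σ (fun x : ℝ => ((Real.exp (-x) : ℝ) : ℂ)) hy ?_ ?_ (by fun_prop)
  · rw [← h, mellinInv]
    congr 1
    refine MeasureTheory.integral_congr_ae (Filter.Eventually.of_forall fun τ => ?_)
    simp only [hl, smul_eq_mul]
    rw [Complex.cpow_def_of_ne_zero (by exact_mod_cast hy.ne'), ← Complex.ofReal_log hy.le]
    congr 2; ring
  · have := Complex.GammaIntegral_convergent (s := σ) (by simpa using hσ)
    refine this.congr_fun (fun x _ => ?_) measurableSet_Ioi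
    simp [mul_comm]
  · unfold Complex.VerticalIntegrable
    simp only [hl]
    exact int_gamma_line hσ

lemma exp_diff_bound {w : ℂ} (hw : 0 < w.re) {a b : ℝ} (hab : a ≤ b) :
    ‖Complex.exp (-w * a) - Complex.exp (-w * b)‖ ≤
      ‖w‖ / w.re * (Real.exp (-w.re * a) - Real.exp (-w.re * b)) := by
  have hw0 : w ≠ 0 := fun h => by simp [h] at hw
  have h1 : Complex.exp (-w * a) - Complex.exp (-w * b) = w * ∫ t in a..b, Complex.exp (-w * t) := by
    rw [integral_exp_mul_complex (neg_ne_zero.mpr hw0)]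
    field_simp; ring
  have h2 : (∫ t in a..b, Real.exp (-w.re * t)) = (Real.exp (-w.re * a) - Real.exp (-w.re * b)) / w.re := by
    rw [intervalIntegral.integral_comp_mul_left (fun x => Real.exp x) (by linarith : -w.re ≠ 0), integral_exp, smul_eq_mul]
    field_simp; ring
  rw [h1, norm_mul]
  have h3 : ‖∫ t in a..b, Complex.exp (-w * t)‖ ≤ ∫ t in a..b, Real.exp (-w.re * t) := by
    refine (intervalIntegral.norm_integral_le_integral_norm hab).trans (le_of_eq ?_)
    refine intervalIntegral.integral_congr fun t _ => ?_
    simp [Complex.norm_exp]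
  calc _ ≤ ‖w‖ * ∫ t in a..b, Real.exp (-w.re * t) := by gcongr
    _ = _ := by rw [h2]; ring

/-- The alternating theta value. -/
noncomputable def Th (Z : ℝ) : ℝ := ∑' l : ℕ, (-1) ^ l * Real.exp (-(Real.pi * ((l : ℝ) + 1) ^ 4 * Z))

lemma th_term_le {Z : ℝ} (hZ : 0 < Z) (l : ℕ) :
    Real.exp (-(Real.pi * ((l : ℝ) + 1) ^ 4 * Z)) ≤ Real.exp (-(Real.pi * Z)) * Real.exp (-(Real.pi * Z)) ^ l := by
  rw [← pow_succ', ← Real.exp_nat_mul]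
  apply Real.exp_le_exp.mpr
  push_cast
  have h1 : (1:ℝ) ≤ (l:ℝ) + 1 := by linarith [Nat.cast_nonneg (α := ℝ) l]
  have h2 : (l:ℝ) + 1 ≤ ((l:ℝ) + 1) ^ 4 := le_self_pow₀ h1 (by norm_num)
  have := mul_le_mul_of_nonneg_right h2 (mul_pos Real.pi_pos hZ).le
  linarith

lemma th_summable {Z : ℝ} (hZ : 0 < Z) :
    Summable fun l : ℕ => Real.exp (-(Real.pi * ((l : ℝ) + 1) ^ 4 * Z)) := by
  refine Summable.of_nonneg_of_le (fun l => (Real.exp_pos _).le) (th_term_le hZ) ?_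
  refine Summable.mul_left _ (summable_geometric_of_lt_one (Real.exp_pos _).le ?_)
  rw [Real.exp_lt_one_iff]
  nlinarith [mul_pos Real.pi_pos hZ]

lemma th_summable' {Z : ℝ} (hZ : 0 < Z) :
    Summable fun l : ℕ => (-1 : ℝ) ^ l * Real.exp (-(Real.pi * ((l : ℝ) + 1) ^ 4 * Z)) := by
  refine Summable.of_norm ((th_summable hZ).congr fun l => ?_)
  simp [abs_of_pos (Real.exp_pos _)]

lemma th_tendsto {Z : ℝ} (hZ : 0 < Z) :
    Filter.Tendsto (fun J : ℕ => ∑ j ∈ Finset.range J,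
      (Real.exp (-(Real.pi * (2 * (j:ℝ) + 1) ^ 4 * Z)) - Real.exp (-(Real.pi * (2 * (j:ℝ) + 2) ^ 4 * Z))))
      Filter.atTop (nhds (Th Z)) := by
  have h := (th_summable' hZ).hasSum.tendsto_sum_nat
  have h2 := h.comp (Filter.tendsto_id.const_mul_atTop' (r := 2) (by norm_num : 0 < 2))
  refine h2.congr fun J => ?_
  simp only [Function.comp, id]
  induction J with
  | zero => simp
  | succ J ih =>
    rw [mul_add, mul_one, Finset.sum_range_succ, Finset.sum_range_succ, ih, Finset.sum_range_succ]
    have : (-1:ℝ) ^ (2 * J + 1) = -1 := Odd.neg_one_pow ⟨J, rfl⟩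
    rw [this, Even.neg_one_pow ⟨J, by ring⟩]
    push_cast
    rw [add_assoc (2 * (J:ℝ)) 1 1, one_add_one_eq_two]
    ring

lemma dirichlet_D_bound {s : ℂ} (hs : 0 < s.re) (J : ℕ) :
    ‖∑ j ∈ Finset.range J, (Complex.exp (-s * (4 * Real.log (2 * (j:ℝ) + 1) : ℝ)) -
      Complex.exp (-s * (4 * Real.log (2 * (j:ℝ) + 2) : ℝ)))‖ ≤ ‖s‖ / s.re := by
  refine (norm_sum_le _ _).trans ?_
  have key : ∀ J : ℕ, ∑ j ∈ Finset.range J, ‖Complex.exp (-s * (4 * Real.log (2 * (j:ℝ) + 1) : ℝ)) -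
      Complex.exp (-s * (4 * Real.log (2 * (j:ℝ) + 2) : ℝ))‖ ≤ ‖s‖ / s.re *
        (1 - Real.exp (-s.re * (4 * Real.log (2 * (J:ℝ) + 1)))) := by
    intro J
    induction J with
    | zero => simp
    | succ J ih =>
      rw [Finset.sum_range_succ]
      have h0 : (0:ℝ) ≤ J := Nat.cast_nonneg J
      have l1 : Real.log (2 * (J:ℝ) + 1) ≤ Real.log (2 * (J:ℝ) + 2) :=
        Real.log_le_log (by linarith) (by linarith)
      have l2 : Real.log (2 * (J:ℝ) + 2) ≤ Real.log (2 * ((J + 1 : ℕ):ℝ) + 1) :=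
        Real.log_le_log (by linarith) (by push_cast; linarith)
      have h1 := exp_diff_bound hs (by linarith : 4 * Real.log (2 * (J:ℝ) + 1) ≤ 4 * Real.log (2 * (J:ℝ) + 2))
      have h2 : Real.exp (-s.re * (4 * Real.log (2 * ((J + 1 : ℕ):ℝ) + 1))) ≤
          Real.exp (-s.re * (4 * Real.log (2 * (J:ℝ) + 2))) := by
        apply Real.exp_le_exp.mpr; nlinarith
      have h3 : 0 ≤ ‖s‖ / s.re := by positivity
      have h4 := mul_le_mul_of_nonneg_left h2 h3
      linarith
  refine (key J).trans ?_
  have h3 : 0 ≤ ‖s‖ / s.re := by positivity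
  have := (Real.exp_pos (-s.re * (4 * Real.log (2 * (J:ℝ) + 1)))).le
  nlinarith

lemma sep_aux {σ : ℝ} (hσ : 0 < σ) {ι : Type*} (I : Finset ι) (c : ι → ℂ) (Z : ι → ℝ) (B : ℝ)
    (hZ : ∀ i ∈ I, 0 < Z i)
    (hB : ∀ τ : ℝ, ‖∑ i ∈ I, c i * Complex.exp (-(σ + τ * Complex.I) * Real.log (Z i))‖ ≤ B) (J : ℕ) :
    ‖∑ i ∈ I, c i * ((∑ j ∈ Finset.range J,
      (Real.exp (-(Real.pi * (2 * (j:ℝ) + 1) ^ 4 * Z i)) - Real.exp (-(Real.pi * (2 * (j:ℝ) + 2) ^ 4 * Z i))) : ℝ) : ℂ)‖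
      ≤ (1 / (2 * Real.pi) * (Real.Gamma (σ + 3) / σ * Real.exp (-σ * Real.log Real.pi) * Real.pi)) * B := by
  have hlog : ∀ i ∈ I, ∀ x : ℝ, 0 < x → Real.log (Real.pi * x ^ 4 * Z i) =
      Real.log Real.pi + 4 * Real.log x + Real.log (Z i) := by
    intro i hi x hx
    have := hZ i hi
    rw [Real.log_mul (by positivity) (by positivity), Real.log_mul (by positivity) (by positivity), Real.log_pow]
    norm_num
  have hintg : ∀ y : ℝ, MeasureTheory.Integrable fun τ : ℝ =>
      Complex.exp (-(σ + τ * Complex.I) * Real.log y) * Complex.Gamma (σ + τ * Complex.I) := by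
    intro y
    refine MeasureTheory.Integrable.bdd_mul (c := Real.exp (-σ * Real.log y)) (int_gamma_line hσ)
      (Continuous.aestronglyMeasurable (by fun_prop)) (Filter.Eventually.of_forall fun τ => ?_)
    rw [Complex.norm_exp]; simp
  have e1 : ∑ i ∈ I, c i * ((∑ j ∈ Finset.range J,
      (Real.exp (-(Real.pi * (2 * (j:ℝ) + 1) ^ 4 * Z i)) - Real.exp (-(Real.pi * (2 * (j:ℝ) + 2) ^ 4 * Z i))) : ℝ) : ℂ)
      = (1 / (2 * Real.pi) : ℝ) • ∫ τ : ℝ, (∑ i ∈ I, c i * Complex.exp (-(σ + τ * Complex.I) * Real.log (Z i))) *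
        (∑ j ∈ Finset.range J, (Complex.exp (-(σ + τ * Complex.I) * (4 * Real.log (2 * (j:ℝ) + 1) : ℝ)) -
      Complex.exp (-(σ + τ * Complex.I) * (4 * Real.log (2 * (j:ℝ) + 2) : ℝ)))) *
        (Complex.exp (-(σ + τ * Complex.I) * Real.log Real.pi) * Complex.Gamma (σ + τ * Complex.I)) := by
    have e2 : ∀ τ : ℝ, (∑ i ∈ I, c i * Complex.exp (-(σ + τ * Complex.I) * Real.log (Z i))) *
        (∑ j ∈ Finset.range J, (Complex.exp (-(σ + τ * Complex.I) * (4 * Real.log (2 * (j:ℝ) + 1) : ℝ)) -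
      Complex.exp (-(σ + τ * Complex.I) * (4 * Real.log (2 * (j:ℝ) + 2) : ℝ)))) *
        (Complex.exp (-(σ + τ * Complex.I) * Real.log Real.pi) * Complex.Gamma (σ + τ * Complex.I))
        = ∑ i ∈ I, ∑ j ∈ Finset.range J, c i * 
          (Complex.exp (-(σ + τ * Complex.I) * Real.log (Real.pi * (2 * (j:ℝ) + 1) ^ 4 * Z i)) * Complex.Gamma (σ + τ * Complex.I)
          - Complex.exp (-(σ + τ * Complex.I) * Real.log (Real.pi * (2 * (j:ℝ) + 2) ^ 4 * Z i)) * Complex.Gamma (σ + τ * Complex.I)) := by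
      intro τ
      rw [Finset.sum_mul_sum, Finset.sum_mul]
      refine Finset.sum_congr rfl fun i hi => ?_
      rw [Finset.sum_mul]
      refine Finset.sum_congr rfl fun j hj => ?_
      rw [hlog i hi _ (by positivity), hlog i hi _ (by positivity)]
      push_cast
      simp only [mul_add, Complex.exp_add]
      ring
    simp_rw [e2]
    rw [MeasureTheory.integral_finsetSum]
    · rw [Finset.smul_sum]
      refine Finset.sum_congr rfl fun i hi => ?_
      have := hZ i hi
      rw [MeasureTheory.integral_finsetSum]
      · rw [Finset.smul_sum]
        push_cast
        rw [Finset.mul_sum]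
        refine Finset.sum_congr rfl fun j hj => ?_
        rw [MeasureTheory.integral_const_mul, MeasureTheory.integral_sub (hintg _) (hintg _),
          ← mul_smul_comm, smul_sub, ← exp_neg_mellin hσ (by positivity), ← exp_neg_mellin hσ (by positivity)]
        push_cast
        rfl
      · intro j _
        exact ((hintg _).sub (hintg _)).const_mul _
    · intro i _
      refine MeasureTheory.integrable_finsetSum _ fun j _ => ?_
      exact ((hintg _).sub (hintg _)).const_mul _
  rw [e1, norm_smul, Real.norm_eq_abs, abs_of_pos (by positivity : 0 < 1 / (2 * Real.pi)), mul_assoc]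
  refine mul_le_mul_of_nonneg_left ?_ (by positivity)
  have hB0 : 0 ≤ B := (norm_nonneg _).trans (hB 0)
  have : ∫ τ : ℝ, (Real.Gamma (σ + 3) / σ * Real.exp (-σ * Real.log Real.pi) * B) * (1 + τ ^ 2)⁻¹
      = Real.Gamma (σ + 3) / σ * Real.exp (-σ * Real.log Real.pi) * Real.pi * B := by
    rw [MeasureTheory.integral_const_mul, integral_univ_inv_one_add_sq]; ring
  rw [← this]
  refine MeasureTheory.norm_integral_le_of_norm_le (integrable_inv_one_add_sq.const_mul _)
    (Filter.Eventually.of_forall fun τ => ?_)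
  have hre : (σ + τ * Complex.I : ℂ).re = σ := by simp
  have h1 := dirichlet_D_bound (s := σ + τ * Complex.I) (by simpa using hσ) J
  rw [hre] at h1
  rw [norm_mul, norm_mul, norm_mul, Complex.norm_exp]
  have h2 : (-(σ + τ * Complex.I : ℂ) * Real.log Real.pi).re = -σ * Real.log Real.pi := by simp
  rw [h2]
  have h3 := gamma_decay hσ τ
  calc _ ≤ B * (‖(σ + τ * Complex.I : ℂ)‖ / σ) * (Real.exp (-σ * Real.log Real.pi) * ‖Complex.Gamma (σ + τ * Complex.I)‖) := by
        gcongr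
        exact hB τ
    _ = (B / σ * Real.exp (-σ * Real.log Real.pi)) * (‖Complex.Gamma (σ + τ * Complex.I)‖ * ‖(σ + τ * Complex.I : ℂ)‖) := by ring
    _ ≤ (B / σ * Real.exp (-σ * Real.log Real.pi)) * (Real.Gamma (σ + 3) * (1 + τ ^ 2)⁻¹) := by gcongr
    _ = _ := by ring

lemma sep {σ : ℝ} (hσ : 0 < σ) : ∃ C : ℝ, 0 < C ∧ ∀ {ι : Type} (I : Finset ι) (c : ι → ℂ) (Z : ι → ℝ) (B : ℝ),
    (∀ i ∈ I, 0 < Z i) →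
    (∀ τ : ℝ, ‖∑ i ∈ I, c i * Complex.exp (-(σ + τ * Complex.I) * Real.log (Z i))‖ ≤ B) →
    ‖∑ i ∈ I, c i * (Th (Z i) : ℂ)‖ ≤ C * B := by
  refine ⟨(1 / (2 * Real.pi) * (Real.Gamma (σ + 3) / σ * Real.exp (-σ * Real.log Real.pi) * Real.pi)),
    ?_, fun {ι} I c Z B hZ hB => ?_⟩
  rotate_left
  · refine le_of_tendsto (x := Filter.atTop) ?_ (Filter.Eventually.of_forall fun J => sep_aux hσ I c Z B hZ hB J)
    refine Filter.Tendsto.norm (tendsto_finsetSum _ fun i hi => Filter.Tendsto.const_mul _ ?_)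
    exact (Complex.continuous_ofReal.tendsto _).comp (th_tendsto (hZ i hi))
  · have := Real.Gamma_pos_of_pos (by linarith : 0 < σ + 3)
    have := Real.pi_pos
    positivity

lemma alt_even {φ : ℕ → ℝ} (ha : Antitone φ)
    (h8 : ∀ j, φ (j + 1) - φ (j + 2) ≤ 8 * (φ j - φ (j + 1))) (J : ℕ) :
    0 ≤ ∑ j ∈ Finset.range (2 * J), (-1) ^ j * φ j ∧ 
    φ 0 - φ (2 * J) ≤ 9 * ∑ j ∈ Finset.range (2 * J), (-1) ^ j * φ j ∧ 
    ∑ j ∈ Finset.range (2 * J), (-1) ^ j * φ j ≤ φ 0 - φ (2 * J) := by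
  induction J with
  | zero => simp
  | succ J ih =>
    rw [mul_add, mul_one, Finset.sum_range_succ, Finset.sum_range_succ]
    rw [Odd.neg_one_pow ⟨J, rfl⟩, Even.neg_one_pow ⟨J, by ring⟩]
    have h1 := ha (Nat.le_succ (2 * J))
    have h2 := ha (Nat.le_succ (2 * J + 1))
    have h3 := h8 (2 * J)
    simp only [Nat.succ_eq_add_one, add_assoc, one_add_one_eq_two] at *
    exact ⟨by linarith, by linarith, by linarith⟩

lemma alt_all {φ : ℕ → ℝ} (ha : Antitone φ) (h0 : ∀ j, 0 ≤ φ j)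
    (h8 : ∀ j, φ (j + 1) - φ (j + 2) ≤ 8 * (φ j - φ (j + 1))) (L : ℕ) :
    0 ≤ ∑ j ∈ Finset.range L, (-1) ^ j * φ j ∧ 
    φ 0 - φ L ≤ 9 * ∑ j ∈ Finset.range L, (-1) ^ j * φ j ∧ 
    ∑ j ∈ Finset.range L, (-1) ^ j * φ j ≤ φ 0 := by
  rcases Nat.even_or_odd' L with ⟨J, rfl | rfl⟩
  · obtain ⟨a, b, c⟩ := alt_even ha h8 J
    exact ⟨a, b, by linarith [h0 (2 * J)]⟩
  · obtain ⟨a, b, c⟩ := alt_even ha h8 J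
    rw [Finset.sum_range_succ, Even.neg_one_pow ⟨J, by ring⟩]
    have := h0 (2 * J)
    have := h0 (2 * J + 1)
    exact ⟨by linarith, by linarith, by linarith⟩

lemma th_seq_anti {Z : ℝ} (hZ : 0 ≤ Z) : Antitone fun l : ℕ => Real.exp (-(Real.pi * ((l : ℝ) + 1) ^ 4 * Z)) := by
  intro i j hij
  apply Real.exp_le_exp.mpr
  have := Real.pi_pos
  have : (i:ℝ) ≤ j := by exact_mod_cast hij
  gcongr

lemma th_seq_8 {Z : ℝ} (hZ : 0 ≤ Z) (j : ℕ) :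
    Real.exp (-(Real.pi * (((j + 1 : ℕ) : ℝ) + 1) ^ 4 * Z)) - Real.exp (-(Real.pi * (((j + 2 : ℕ) : ℝ) + 1) ^ 4 * Z))
     ≤ 8 * (Real.exp (-(Real.pi * ((j : ℝ) + 1) ^ 4 * Z)) - Real.exp (-(Real.pi * (((j + 1 : ℕ) : ℝ) + 1) ^ 4 * Z))) := by
  push_cast
  have hj : (0:ℝ) ≤ j := Nat.cast_nonneg j
  set c := Real.pi * Z with hc
  have hc0 : 0 ≤ c := mul_nonneg Real.pi_pos.le hZ
  set A := c * ((j:ℝ) + 1) ^ 4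
  set B := c * ((j:ℝ) + 1 + 1) ^ 4
  set D := c * ((j:ℝ) + 2 + 1) ^ 4
  have e1 : Real.pi * ((j:ℝ) + 1) ^ 4 * Z = A := by simp only [A, hc]; ring
  have e2 : Real.pi * ((j:ℝ) + 1 + 1) ^ 4 * Z = B := by simp only [B, hc]; ring
  have e3 : Real.pi * ((j:ℝ) + 2 + 1) ^ 4 * Z = D := by simp only [D, hc]; ring
  rw [e1, e2, e3]
  have h1 : D - B ≤ 8 * (B - A) := by
    have : ((j:ℝ) + 2 + 1) ^ 4 - ((j:ℝ) + 1 + 1) ^ 4 ≤ 8 * (((j:ℝ) + 1 + 1) ^ 4 - ((j:ℝ) + 1) ^ 4) := by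
      have h2 := pow_nonneg hj 2
      have h3 := pow_nonneg hj 3
      nlinarith
    have := mul_le_mul_of_nonneg_left this hc0
    simp only [A, B, D]; linarith
  have h2 : 1 - Real.exp (-(D - B)) ≤ D - B := by linarith [Real.add_one_le_exp (-(D - B))]
  have h3 : B - A ≤ Real.exp (B - A) - 1 := by linarith [Real.add_one_le_exp (B - A)]
  have h4 : Real.exp (-D) = Real.exp (-B) * Real.exp (-(D - B)) := by rw [← Real.exp_add]; ring_nf
  have h5 : Real.exp (-A) = Real.exp (-B) * Real.exp (B - A) := by rw [← Real.exp_add]; ring_nf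
  rw [h4, h5]
  have := mul_le_mul_of_nonneg_left (by linarith : 1 - Real.exp (-(D - B)) ≤ 8 * (Real.exp (B - A) - 1)) (Real.exp_pos (-B)).le
  linarith

lemma th_bounds {Z : ℝ} (hZ : 0 < Z) : 0 ≤ Th Z ∧ Th Z ≤ Real.exp (-(Real.pi * Z)) := by
  have h := (th_summable' hZ).hasSum.tendsto_sum_nat
  have h2 := fun L => alt_all (th_seq_anti hZ.le) (fun j => (Real.exp_pos _).le) (th_seq_8 hZ.le) L
  constructor
  · exact ge_of_tendsto' h fun L => (h2 L).1
  · refine le_of_tendsto' h fun L => (h2 L).2.2.trans (le_of_eq (by simp))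

/-- Truncated positivity. -/
lemma th_trunc_nonneg {M : ℝ} (k : ℕ) (L : ℕ) :
    0 ≤ ∑ j ∈ Finset.range L, (-1 : ℝ) ^ j * Real.exp (-(Real.pi * ((k * (j + 1) ^ 2 : ℕ) : ℝ) ^ 2 / M ^ 2)) := by
  have := (alt_all (th_seq_anti (Z := (k:ℝ) ^ 2 / M ^ 2) (by positivity)) (fun j => (Real.exp_pos _).le)
    (th_seq_8 (by positivity)) L).1
  refine this.trans (le_of_eq (Finset.sum_congr rfl fun j _ => ?_))
  congr 2; push_cast; ring

lemma th_trunc_pos {M : ℝ} (hM : 0 < M) (k : ℕ) (hk : (k : ℝ) ≤ M) (L : ℕ) (hL : 2 * M ≤ k * ((L : ℝ) + 1) ^ 2) :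
    (Real.exp (-Real.pi) - Real.exp (-(4 * Real.pi))) / 9 ≤ ∑ j ∈ Finset.range L, (-1 : ℝ) ^ j *
      Real.exp (-(Real.pi * ((k * (j + 1) ^ 2 : ℕ) : ℝ) ^ 2 / M ^ 2)) := by
  have h := (alt_all (th_seq_anti (Z := (k:ℝ) ^ 2 / M ^ 2) (by positivity)) (fun j => (Real.exp_pos _).le)
    (th_seq_8 (by positivity)) L).2.1
  have e : ∑ j ∈ Finset.range L, (-1 : ℝ) ^ j * Real.exp (-(Real.pi * ((k * (j + 1) ^ 2 : ℕ) : ℝ) ^ 2 / M ^ 2))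
      = ∑ j ∈ Finset.range L, (-1 : ℝ) ^ j * Real.exp (-(Real.pi * ((j:ℝ) + 1) ^ 4 * ((k:ℝ) ^ 2 / M ^ 2))) := by
    refine Finset.sum_congr rfl fun j _ => ?_
    congr 2; push_cast; ring
  rw [e]
  have h1 : Real.exp (-Real.pi) ≤ Real.exp (-(Real.pi * (((0:ℕ):ℝ) + 1) ^ 4 * ((k:ℝ) ^ 2 / M ^ 2))) := by
    apply Real.exp_le_exp.mpr
    have : (k:ℝ) ^ 2 / M ^ 2 ≤ 1 := by
      rw [div_le_one (by positivity)]; gcongr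
    have := mul_le_mul_of_nonneg_left this Real.pi_pos.le
    simp; linarith
  have h2 : Real.exp (-(Real.pi * ((L:ℝ) + 1) ^ 4 * ((k:ℝ) ^ 2 / M ^ 2))) ≤ Real.exp (-(4 * Real.pi)) := by
    apply Real.exp_le_exp.mpr
    have : 4 ≤ ((L:ℝ) + 1) ^ 4 * ((k:ℝ) ^ 2 / M ^ 2) := by
      rw [← mul_div_assoc, le_div_iff₀ (by positivity)]
      have := pow_le_pow_left₀ (by positivity) hL 2
      nlinarith
    have := mul_le_mul_of_nonneg_left this Real.pi_pos.le
    linarith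
  linarith
end

section
/-- Quadratic Gauss sum. -/
noncomputable def GS (q : ℕ) (h : ℤ) : ℂ :=
  ∑ r ∈ Finset.range q, (jacobiSym (r : ℤ) q : ℂ) * Complex.exp (2 * Real.pi * Complex.I * ((h * r : ℤ) / q : ℂ))

lemma e_period {q : ℕ} (hq : q ≠ 0) {x y : ℤ} (h : x ≡ y [ZMOD q]) :
    Complex.exp (2 * Real.pi * Complex.I * ((x : ℂ) / q)) = Complex.exp (2 * Real.pi * Complex.I * ((y : ℂ) / q)) := by
  obtain ⟨t, ht⟩ := h.dvd
  have hy : y = x + q * t := by linarith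
  have hq' : (q : ℂ) ≠ 0 := by exact_mod_cast hq
  have : 2 * Real.pi * Complex.I * ((y : ℂ) / q) = 2 * Real.pi * Complex.I * ((x : ℂ) / q) + t * (2 * Real.pi * Complex.I) := by
    rw [hy]; push_cast; field_simp
  rw [this, Complex.exp_add, Complex.exp_int_mul_two_pi_mul_I, mul_one]

lemma sum_range_crt {a b : ℕ} (ha : 0 < a) (hb : 0 < b) (hab : a.Coprime b) (f : ℤ → ℂ)
    (hf : ∀ x y : ℤ, x ≡ y [ZMOD ((a * b : ℕ) : ℤ)] → f x = f y) :
    ∑ r ∈ Finset.range (a * b), f r = ∑ u ∈ Finset.range a, ∑ v ∈ Finset.range b, f (u * b + v * a) := by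
  rw [← Finset.sum_product']
  symm
  set φ : ℕ × ℕ → ℕ := fun p => (p.1 * b + p.2 * a) % (a * b)
  have hinj : Set.InjOn φ (Finset.range a ×ˢ Finset.range b : Finset (ℕ × ℕ)) := by
    intro p hp p' hp' h
    simp only [Finset.coe_product, Set.mem_prod, Finset.coe_range, Set.mem_Iio] at hp hp'
    have h' : p.1 * b + p.2 * a ≡ p'.1 * b + p'.2 * a [MOD a * b] := h
    have h1 : p.1 * b + p.2 * a ≡ p'.1 * b + p'.2 * a [MOD a] := h'.of_mul_right b
    have h2 : p.1 * b + p.2 * a ≡ p'.1 * b + p'.2 * a [MOD b] := h'.of_mul_left a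
    have g1 : p.1 * b ≡ p'.1 * b [MOD a] := by simpa [Nat.ModEq] using h1
    have g2 : p.2 * a ≡ p'.2 * a [MOD b] := by simpa [Nat.ModEq] using h2
    have k1 : p.1 ≡ p'.1 [MOD a] := Nat.ModEq.cancel_right_of_coprime hab g1
    have k2 : p.2 ≡ p'.2 [MOD b] := Nat.ModEq.cancel_right_of_coprime hab.symm g2
    exact Prod.ext (Nat.ModEq.eq_of_lt_of_lt k1 hp.1 hp'.1) (Nat.ModEq.eq_of_lt_of_lt k2 hp.2 hp'.2)
  have himg : (Finset.range a ×ˢ Finset.range b).image φ = Finset.range (a * b) := by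
    apply Finset.eq_of_subset_of_card_le
    · intro x hx
      obtain ⟨p, _, rfl⟩ := Finset.mem_image.mp hx
      exact Finset.mem_range.mpr (Nat.mod_lt _ (by positivity))
    · rw [Finset.card_image_of_injOn hinj]; simp
  rw [← himg, Finset.sum_image hinj]
  refine Finset.sum_congr rfl fun p _ => hf _ _ ?_
  have : p.1 * b + p.2 * a ≡ φ p [MOD a * b] := (Nat.mod_modEq _ _).symm
  have := (Int.natCast_modEq_iff.mpr this)
  push_cast at this ⊢
  exact this

lemma jac_congr {q : ℕ} {x y : ℤ} (h : x ≡ y [ZMOD q]) : jacobiSym x q = jacobiSym y q := by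
  rw [jacobiSym.mod_left x, jacobiSym.mod_left y, h]

lemma GS_mul {a b : ℕ} (ha : 0 < a) (hb : 0 < b) (hab : a.Coprime b) (h : ℤ) :
    GS (a * b) h = ((jacobiSym b a : ℂ) * (jacobiSym a b : ℂ)) * (GS a h * GS b h) := by
  have : NeZero a := ⟨ha.ne'⟩
  have : NeZero b := ⟨hb.ne'⟩
  have hs := sum_range_crt ha hb hab (fun r : ℤ => (jacobiSym r (a * b) : ℂ) *
    Complex.exp (2 * Real.pi * Complex.I * ((h * r : ℤ) / (a * b : ℕ) : ℂ))) (by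
      intro x y hxy
      rw [jac_congr hxy, e_period (by positivity) (hxy.mul_left h)])
  have e1 : GS (a * b) h = ∑ r ∈ Finset.range (a * b), (fun r : ℤ => (jacobiSym r (a * b) : ℂ) *
    Complex.exp (2 * Real.pi * Complex.I * ((h * r : ℤ) / (a * b : ℕ) : ℂ))) r := rfl
  rw [e1, hs, GS, GS, Finset.sum_mul_sum, Finset.mul_sum]
  refine Finset.sum_congr rfl fun u _ => ?_
  rw [Finset.mul_sum]
  refine Finset.sum_congr rfl fun v _ => ?_
  have j1 : jacobiSym (u * b + v * a : ℤ) a = jacobiSym u a * jacobiSym b a := by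
    rw [← jacobiSym.mul_left]
    apply jac_congr
    simp [Int.ModEq]
  have j2 : jacobiSym (u * b + v * a : ℤ) b = jacobiSym v b * jacobiSym a b := by
    rw [← jacobiSym.mul_left]
    apply jac_congr
    simp [Int.ModEq]
  have ha' : (a : ℂ) ≠ 0 := by exact_mod_cast ha.ne'
  have hb' : (b : ℂ) ≠ 0 := by exact_mod_cast hb.ne'
  have j3 : (2 * Real.pi * Complex.I * ((h * (u * b + v * a) : ℤ) / (a * b : ℕ) : ℂ)) =
    2 * Real.pi * Complex.I * ((h * u : ℤ) / a : ℂ) + 2 * Real.pi * Complex.I * ((h * v : ℤ) / b : ℂ) := by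
    push_cast; field_simp
  simp only [jacobiSym.mul_right, j1, j2, j3, Complex.exp_add]
  push_cast
  ring

section prime
variable (p : ℕ) [hp : Fact p.Prime]

/-- The quadratic character with complex values. -/
noncomputable def qch : MulChar (ZMod p) ℂ := (quadraticChar (ZMod p)).ringHomComp (Int.castRingHom ℂ)

lemma qch_apply (x : ℤ) : qch p (x : ZMod p) = (jacobiSym x p : ℂ) := by
  rw [← jacobiSym.legendreSym.to_jacobiSym]
  rfl

lemma GS_prime_eq (h : ℤ) : GS p h = gaussSum (qch p) ((ZMod.stdAddChar (N := p)).mulShift (h : ZMod p)) := by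
  rw [GS, gaussSum]
  refine Finset.sum_nbij' (fun r => (r : ZMod p)) (fun x => x.val) ?_ ?_ ?_ ?_ ?_
  · simp
  · intro x _; exact Finset.mem_range.mpr (ZMod.val_lt x)
  · intro r hr; exact ZMod.val_cast_of_lt (Finset.mem_range.mp hr)
  · intro x _; simp
  · intro r _
    rw [AddChar.mulShift_apply]
    have h1 : (r : ZMod p) = ((r : ℤ) : ZMod p) := by simp
    rw [h1, qch_apply, ← Int.cast_mul, ZMod.stdAddChar_coe]
    congr 2
    ring

lemma qch_ne_one (h2 : p ≠ 2) : qch p ≠ 1 := by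
  have h := quadraticChar_ne_one (F := ZMod p) (by rwa [ZMod.ringChar_zmod_n])
  intro h1
  apply h
  ext x
  have := congrArg (fun c : MulChar (ZMod p) ℂ => c x) h1
  simp only [qch, MulChar.ringHomComp_apply] at this
  rw [MulChar.one_apply_coe] at this ⊢
  simpa using this

lemma qch_quad : (qch p).IsQuadratic := by
  exact (quadraticChar_isQuadratic (ZMod p)).comp _

lemma GS_prime (h2 : p ≠ 2) : (∀ h : ℤ, GS p h = (jacobiSym h p : ℂ) * GS p 1) ∧ ‖GS p 1‖ ^ 2 = p := by
  have e1 : GS p 1 = gaussSum (qch p) (ZMod.stdAddChar (N := p)) := by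
    rw [GS_prime_eq]; simp
  constructor
  · intro h
    by_cases h0 : (h : ZMod p) = 0
    · rw [GS_prime_eq, h0]
      have : jacobiSym h p = 0 := by
        have := qch_apply p h
        rw [h0, MulChar.map_zero] at this
        exact_mod_cast this.symm
      rw [this, AddChar.mulShift_zero]
      simp only [gaussSum, AddChar.one_apply, mul_one]
      rw [MulChar.sum_eq_zero_of_ne_one (qch_ne_one p h2)]; simp
    · have hu := gaussSum_mulShift (qch p) (ZMod.stdAddChar (N := p)) (Units.mk0 _ h0)
      rw [Units.val_mk0, qch_apply, ← GS_prime_eq, ← e1] at hu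
      rw [← hu, ← mul_assoc]
      have : (jacobiSym h p : ℂ) * jacobiSym h p = 1 := by
        rw [← qch_apply, ← sq]
        rcases qch_quad p (h : ZMod p) with h3 | h3 | h3
        · rw [h3]; exfalso
          exact (((Units.mk0 _ h0).isUnit.map (qch p)).ne_zero) (by simpa using h3)
        · rw [h3]; simp
        · rw [h3]; simp
      rw [this, one_mul]
  · have h := gaussSum_sq (qch_ne_one p h2) (qch_quad p) (ZMod.isPrimitive_stdAddChar p)
    rw [← e1] at h
    have h3 := congrArg norm h
    rw [norm_pow, norm_mul] at h3
    rw [h3]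
    have : ‖qch p (-1)‖ = 1 := by
      rcases qch_quad p (-1) with h3 | h3 | h3
      · exfalso
        exact (((-1 : (ZMod p)ˣ).isUnit.map (qch p)).ne_zero) (by simpa using h3)
      · rw [h3]; simp
      · rw [h3]; simp
    rw [this]; simp [ZMod.card]
end prime

lemma GS_sqf (q : ℕ) (hq : Squarefree q) (ho : Odd q) :
    (∀ h : ℤ, GS q h = (jacobiSym h q : ℂ) * GS q 1) ∧ ‖GS q 1‖ ^ 2 = q := by
  induction q using Nat.recOnMul with
  | zero => simp at ho
  | one => simp [GS]
  | prime p hp =>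
    have := Fact.mk hp
    exact GS_prime p (by rintro rfl; exact absurd ho (by decide))
  | mul a b iha ihb =>
    have hc : a.Coprime b := Nat.coprime_of_squarefree_mul hq
    have ha0 : 0 < a := Nat.pos_of_ne_zero (by rintro rfl; simp at ho)
    have hb0 : 0 < b := Nat.pos_of_ne_zero (by rintro rfl; simp at ho)
    obtain ⟨oa, ob⟩ := Nat.odd_mul.mp ho
    obtain ⟨a1, a2⟩ := iha hq.of_mul_left oa
    obtain ⟨b1, b2⟩ := ihb hq.of_mul_right ob
    have : NeZero a := ⟨ha0.ne'⟩
    have : NeZero b := ⟨hb0.ne'⟩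
    constructor
    · intro h
      rw [GS_mul ha0 hb0 hc, GS_mul ha0 hb0 hc, a1, b1, jacobiSym.mul_right]
      push_cast; ring
    · rw [GS_mul ha0 hb0 hc]
      have j1 : ‖(jacobiSym b a : ℂ)‖ = 1 := by
        rcases jacobiSym.eq_one_or_neg_one (a := b) (b := a) (by simpa using hc.symm) with h | h <;> simp [h]
      have j2 : ‖(jacobiSym a b : ℂ)‖ = 1 := by
        rcases jacobiSym.eq_one_or_neg_one (a := a) (b := b) (by simpa using hc) with h | h <;> simp [h]
      rw [norm_mul, norm_mul, norm_mul, j1, j2]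
      push_cast
      rw [← a2, ← b2]; ring
end

/-- Gaussian weight. -/
noncomputable def gw (X v : ℝ) : ℝ := Real.exp (-(Real.pi * v ^ 2 / X ^ 2))

lemma gw_pos (X v : ℝ) : 0 < gw X v := Real.exp_pos _

lemma gw_summable_int {X : ℝ} (hX : 0 < X) : Summable fun m : ℤ => gw X m := by
  have h := (HurwitzZeta.hasSum_int_evenKernel 0 (t := 1 / X ^ 2) (by positivity)).summable
  refine h.congr fun m => ?_
  rw [gw]; congr 1; ring

lemma gw_summable_nat {X : ℝ} (hX : 0 < X) : Summable fun m : ℕ => gw X m :=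
  (gw_summable_int hX).comp_injective (i := fun m : ℕ => (m : ℤ)) Nat.cast_injective |>.congr (fun m => by simp)

lemma norm_jac_le (x : ℤ) (q : ℕ) : ‖(jacobiSym x q : ℂ)‖ ≤ 1 := by
  rcases jacobiSym.trichotomy x q with h | h | h <;> simp [h]

/-- Full theta series. -/
noncomputable def Sz (q : ℕ) (X : ℝ) : ℂ := ∑' m : ℤ, (jacobiSym m q : ℂ) * (gw X m : ℂ)

lemma Sz_summable (q : ℕ) {X : ℝ} (hX : 0 < X) : Summable fun m : ℤ => (jacobiSym m q : ℂ) * (gw X m : ℂ) := by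
  refine Summable.of_norm_bounded (gw_summable_int hX) fun m => ?_
  rw [norm_mul, Complex.norm_real, Real.norm_eq_abs, abs_of_pos (gw_pos _ _)]
  exact mul_le_of_le_one_left (gw_pos _ _).le (norm_jac_le _ _)

lemma Sz_FE (q : ℕ) (hq : Squarefree q) (ho : Odd q) {X : ℝ} (hX : 0 < X) :
    Sz q X = (X / q : ℝ) * GS q 1 * Sz q (q / X) := by
  have hq0 : 0 < q := ho.pos
  have : NeZero q := ⟨hq0.ne'⟩
  have hqR : (0:ℝ) < q := by exact_mod_cast hq0
  set t : ℝ := (q:ℝ) ^ 2 / X ^ 2 with ht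
  have ht0 : 0 < t := by positivity
  -- decompose into classes
  have e1 : Sz q X = ∑ r ∈ Finset.range q, (jacobiSym r q : ℂ) * (HurwitzZeta.evenKernel ((r / q : ℝ)) t : ℂ) := by
    rw [Sz, ← (Int.divModEquiv q).symm.tsum_eq, ← (Equiv.prodComm _ _).tsum_eq]
    have hs : Summable fun c : Fin q × ℤ => (fun m : ℤ => (jacobiSym m q : ℂ) * (gw X m : ℂ)) ((Int.divModEquiv q).symm ((Equiv.prodComm _ _) c)) :=
      ((Int.divModEquiv q).symm.summable_iff.mpr (Sz_summable q hX)).comp_injective (Equiv.prodComm _ _).injective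
    rw [hs.tsum_prod, tsum_fintype, Finset.sum_range]
    refine Finset.sum_congr rfl fun r _ => ?_
    have h := HurwitzZeta.hasSum_int_evenKernel ((r:ℕ) / q : ℝ) ht0
    have h2 := (Complex.hasSum_ofReal.mpr h).mul_left (jacobiSym ((r:ℕ):ℤ) q : ℂ)
    rw [← h2.tsum_eq]
    refine tsum_congr fun n => ?_
    simp only [Equiv.prodComm_apply, Prod.swap_prod_mk, Int.divModEquiv_symm_apply]
    congr 2
    · rw [jac_congr]
      simp [Int.ModEq]
    · rw [gw]
      congr 1
      rw [ht]; push_cast; field_simp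
  have e2 : ∀ r : ℕ, (HurwitzZeta.evenKernel ((r / q : ℝ)) t : ℂ) = (X / q : ℝ) * 
      ∑' n : ℤ, Complex.exp (2 * Real.pi * Complex.I * ((n * r : ℤ) / q : ℂ)) * (gw (q / X) n : ℂ) := by
    intro r
    rw [HurwitzZeta.evenKernel_functional_equation]
    have h := HurwitzZeta.hasSum_int_cosKernel (r / q : ℝ) (t := 1 / t) (by positivity)
    push_cast
    rw [← h.tsum_eq]
    congr 1
    · have : t ^ (1 / 2 : ℝ) = q / X := by
        rw [ht, ← div_pow, ← Real.rpow_natCast, ← Real.rpow_mul (by positivity)]; norm_num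
      rw [this]; push_cast; field_simp
    · refine tsum_congr fun n => ?_
      congr 2
      · push_cast; ring
      · rw [gw, ht]; congr 2; field_simp
  have hs2 : ∀ r : ℕ, Summable fun n : ℤ => (jacobiSym r q : ℂ) * (Complex.exp (2 * Real.pi * Complex.I * ((n * r : ℤ) / q : ℂ)) * (gw (q / X) n : ℂ)) := by
    intro r
    refine Summable.mul_left _ ?_
    refine Summable.of_norm_bounded (gw_summable_int (X := q / X) (by positivity)) fun m => ?_
    rw [norm_mul, Complex.norm_real, Real.norm_eq_abs, abs_of_pos (gw_pos _ _)]
    refine mul_le_of_le_one_left (gw_pos _ _).le (le_of_eq ?_)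
    rw [Complex.norm_exp, Real.exp_eq_one_iff]
    have : (2 * Real.pi * Complex.I * ((m * r : ℤ) / q : ℂ)) = ((2 * Real.pi * ((m * r : ℤ) / q) : ℝ) : ℂ) * Complex.I := by
      push_cast; ring
    rw [this, Complex.re_ofReal_mul]; simp
  rw [e1]
  simp_rw [e2, mul_left_comm _ ((X / q : ℝ) : ℂ), ← tsum_mul_left (a := (jacobiSym _ q : ℂ))]
  rw [← Finset.mul_sum, ← Summable.tsum_finsetSum (fun r _ => hs2 r), mul_assoc ((X / q : ℝ) : ℂ), Sz, ← tsum_mul_left (a := GS q 1)]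
  congr 1
  refine tsum_congr fun n => ?_
  rw [← mul_assoc, mul_comm (GS q 1), ← (GS_sqf q hq ho).1 n, GS, Finset.sum_mul]
  refine Finset.sum_congr rfl fun r _ => ?_
  ring

/-- The coefficient `A(m)`. -/
def cA (m : ℕ) : ℝ := if m = 0 then 0 else if 4 ∣ m then -1 else 1

lemma norm_cA_le (m : ℕ) : |cA m| ≤ 1 := by
  unfold cA; split_ifs <;> simp

/-- Twisted series. -/
noncomputable def U (q : ℕ) (X : ℝ) : ℂ := ∑' m : ℕ, (cA m : ℂ) * (jacobiSym m q : ℂ) * (gw X m : ℂ)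

lemma U_summable (q : ℕ) {X : ℝ} (hX : 0 < X) :
    Summable fun m : ℕ => (cA m : ℂ) * (jacobiSym m q : ℂ) * (gw X m : ℂ) := by
  refine Summable.of_norm_bounded (gw_summable_nat hX) fun m => ?_
  rw [norm_mul, norm_mul, Complex.norm_real, Complex.norm_real, Real.norm_eq_abs, Real.norm_eq_abs, abs_of_pos (gw_pos _ _)]
  exact mul_le_of_le_one_left (gw_pos _ _).le (mul_le_one₀ (norm_cA_le m) (norm_nonneg _) (norm_jac_le _ _))

lemma U_eq_Sz (q : ℕ) (h1 : 1 < q) (h4 : q % 4 = 1) {X : ℝ} (hX : 0 < X) :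
    U q X = (1 / 2) * (Sz q X - 2 * Sz q (X / 4)) := by
  have ho : Odd q := Nat.odd_iff.mpr (by omega)
  have hz : jacobiSym (0:ℤ) q = 0 := jacobiSym.zero_left h1
  have hS : ∀ Y : ℝ, 0 < Y → Sz q Y = 2 * ∑' m : ℕ, (jacobiSym m q : ℂ) * (gw Y m : ℂ) := by
    intro Y hY
    have hev : (fun m : ℤ => (jacobiSym m q : ℂ) * (gw Y m : ℂ)).Even := by
      intro m
      simp only
      rw [jacobiSym.neg _ ho, ZMod.χ₄_nat_one_mod_four h4]
      simp [gw]
    rw [Sz, tsum_int_eq_zero_add_two_mul_tsum_pnat hev (Sz_summable q hY)]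
    simp only [Int.cast_zero, hz, zero_mul, zero_add, nsmul_eq_mul, Nat.cast_ofNat]
    have := tsum_pnat_eq_tsum_of_eq_zero (f := fun m : ℕ => (jacobiSym m q : ℂ) * (gw Y m : ℂ)) (by simp [hz])
    rw [← this]
    simp
  rw [hS X hX, hS (X / 4) (by positivity)]
  have hn : ∀ Y : ℝ, 0 < Y → Summable fun m : ℕ => (jacobiSym m q : ℂ) * (gw Y m : ℂ) := fun Y hY =>
    ((Sz_summable q hY).comp_injective (i := fun m : ℕ => (m : ℤ)) Nat.cast_injective).congr (fun m => by simp)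
  have h4' : ∑' m : ℕ, (jacobiSym m q : ℂ) * (gw (X / 4) m : ℂ) = 
      ∑' m : ℕ, if 4 ∣ m then (jacobiSym m q : ℂ) * (gw X m : ℂ) else 0 := by
    have hinj : Function.Injective fun m : ℕ => 4 * m := fun a b h => by simpa using h
    rw [← hinj.tsum_eq (f := fun m : ℕ => if 4 ∣ m then (jacobiSym m q : ℂ) * (gw X m : ℂ) else 0)]
    · refine tsum_congr fun m => ?_
      simp only [dvd_mul_right, if_true]
      have : jacobiSym ((4 * m : ℕ) : ℤ) q = jacobiSym m q := by
        push_cast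
        rw [jacobiSym.mul_left]
        have : jacobiSym 4 q = 1 := by
          have : (4:ℤ) = 2 ^ 2 := by norm_num
          rw [this]
          refine jacobiSym.sq_one' ?_
          exact Nat.coprime_two_left.mpr ho
        rw [this, one_mul]
      rw [this]
      congr 2
      rw [gw, gw]; congr 1; push_cast; field_simp
    · intro m hm
      simp only [Function.mem_support, ne_eq, ite_eq_right_iff, Classical.not_imp] at hm
      obtain ⟨⟨c, rfl⟩, _⟩ := hm
      exact ⟨c, rfl⟩
  rw [h4']
  have hs4 : Summable fun m : ℕ => if 4 ∣ m then (jacobiSym m q : ℂ) * (gw X m : ℂ) else 0 := by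
    refine Summable.of_norm_bounded (hn X hX).norm fun m => ?_
    split_ifs <;> simp; positivity
  rw [U]
  have : ∀ m : ℕ, (cA m : ℂ) * (jacobiSym m q : ℂ) * (gw X m : ℂ) = (jacobiSym m q : ℂ) * (gw X m : ℂ) - 2 *
      (if 4 ∣ m then (jacobiSym m q : ℂ) * (gw X m : ℂ) else 0) := by
    intro m
    by_cases h0 : m = 0
    · subst h0; simp [hz]
    · unfold cA; rw [if_neg h0]; split_ifs <;> push_cast <;> ring
  simp_rw [this]
  rw [Summable.tsum_sub (hn X hX) (hs4.mul_left 2), tsum_mul_left]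
  ring

lemma U_FE (q : ℕ) (hq : Squarefree q) (h1 : 1 < q) (h4 : q % 4 = 1) {X : ℝ} (hX : 0 < X) :
    U q X = -((X / (2 * q) : ℝ) * GS q 1) * U q (4 * q / X) := by
  have ho : Odd q := Nat.odd_iff.mpr (by omega)
  have hq0 : (0:ℝ) < q := by exact_mod_cast ho.pos
  have hq0' : (q:ℂ) ≠ 0 := by exact_mod_cast hq0.ne'
  rw [U_eq_Sz q h1 h4 hX, U_eq_Sz q h1 h4 (by positivity), Sz_FE q hq ho hX, Sz_FE q hq ho (X := X / 4) (by positivity)]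
  have e1 : (q:ℝ) / (X / 4) = 4 * q / X := by field_simp
  have e2 : 4 * (q:ℝ) / X / 4 = q / X := by field_simp
  rw [e1, e2]
  push_cast
  field_simp
  ring

lemma sqf_sq_unique {k k' l l' : ℕ} (hk : Squarefree k) (hk' : Squarefree k') (hl : 0 < l) (hl' : 0 < l')
    (h : k * l ^ 2 = k' * l' ^ 2) : k = k' ∧ l = l' := by
  have hkk : k = k' := by
    apply Nat.eq_of_factorization_eq hk.ne_zero hk'.ne_zero
    intro p
    have h1 := congrArg (fun n => n.factorization p) h
    rw [Nat.factorization_mul hk.ne_zero (by positivity), Nat.factorization_mul hk'.ne_zero (by positivity),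
      Nat.factorization_pow, Nat.factorization_pow] at h1
    simp only [Finsupp.coe_add, Finsupp.coe_smul, Pi.add_apply, Pi.smul_apply, smul_eq_mul] at h1
    have a1 := hk.natFactorization_le_one p
    have a2 := hk'.natFactorization_le_one p
    omega
  refine ⟨hkk, ?_⟩
  subst hkk
  have := Nat.eq_of_mul_eq_mul_left (Nat.pos_of_ne_zero hk.ne_zero) h
  exact Nat.pow_left_injective (by norm_num : 2 ≠ 0) this

/-- Squarefree numbers as a type. -/
abbrev SqF := {k : ℕ // Squarefree k}

lemma sqf_map_inj : Function.Injective fun p : SqF × ℕ => p.1.1 * (p.2 + 1) ^ 2 := by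
  intro p p' h
  obtain ⟨h1, h2⟩ := sqf_sq_unique p.1.2 p'.1.2 (Nat.succ_pos _) (Nat.succ_pos _) h
  exact Prod.ext (Subtype.ext h1) (by omega)

lemma coprime_moebius (a n : ℕ) (ha : a ≠ 0) :
    (∑ d ∈ a.divisors, if d ∣ n then (ArithmeticFunction.moebius d : ℂ) else 0) = if n.Coprime a then 1 else 0 := by
  rw [← Finset.sum_filter]
  have : a.divisors.filter (fun d => d ∣ n) = (n.gcd a).divisors := by
    ext d
    simp only [Finset.mem_filter, Nat.mem_divisors]
    constructor
    · rintro ⟨⟨h1, h2⟩, h3⟩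
      exact ⟨Nat.dvd_gcd h3 h1, (Nat.gcd_pos_of_pos_right _ (Nat.pos_of_ne_zero ha)).ne'⟩
    · rintro ⟨h1, h2⟩
      exact ⟨⟨h1.trans (Nat.gcd_dvd_right _ _), ha⟩, h1.trans (Nat.gcd_dvd_left _ _)⟩
  rw [this]
  have h := congrArg (fun f : ArithmeticFunction ℤ => f (n.gcd a)) ArithmeticFunction.moebius_mul_coe_zeta
  simp only [ArithmeticFunction.coe_mul_zeta_apply, ArithmeticFunction.one_apply] at h
  have h2 := congrArg (fun z : ℤ => (z : ℂ)) h
  push_cast at h2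
  rw [h2]

/-- The alternating sign with value `0` at `0`. -/
def sg (n : ℕ) : ℝ := if n = 0 then 0 else if 2 ∣ n then -1 else 1

lemma norm_sg_le (n : ℕ) : |sg n| ≤ 1 := by unfold sg; split_ifs <;> simp

lemma cA_sqf {k : ℕ} (hk : Squarefree k) (l : ℕ) : cA (k * l ^ 2) = sg l := by
  unfold cA sg
  rcases Nat.eq_zero_or_pos l with rfl | hl
  · simp
  have hne : k * l ^ 2 ≠ 0 := by have := hk.ne_zero; positivity
  rw [if_neg hne, if_neg hl.ne']
  have : 4 ∣ k * l ^ 2 ↔ 2 ∣ l := by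
    constructor
    · intro h
      by_contra h2
      have ho : Nat.Coprime 2 l := (Nat.Prime.coprime_iff_not_dvd Nat.prime_two).mpr h2
      have hc : Nat.Coprime (2 * 2) (l ^ 2) := Nat.Coprime.pow_right 2 (Nat.Coprime.mul_left ho ho)
      have h3 : 2 * 2 ∣ k := hc.dvd_of_dvd_mul_right h
      have := hk 2 h3
      simp at this
    · rintro ⟨c, rfl⟩
      exact ⟨k * c ^ 2, by ring⟩
  simp only [this]

lemma sg_mul_odd {d : ℕ} (hd : Odd d) (n : ℕ) : sg (d * n) = sg n := by
  unfold sg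
  have h0 : d ≠ 0 := by rintro rfl; simp at hd
  have : 2 ∣ d * n ↔ 2 ∣ n :=
    ⟨fun h => (Nat.coprime_two_left.mpr hd).dvd_of_dvd_mul_left h, fun h => h.mul_left d⟩
  simp [this, h0]

lemma cA_mul_odd {d : ℕ} (hd : Odd d) (n : ℕ) : cA (d * n) = cA n := by
  unfold cA
  have h0 : d ≠ 0 := by rintro rfl; simp at hd
  have : 4 ∣ d * n ↔ 4 ∣ n := by
    have hc : Nat.Coprime 4 d := by
      have := (Nat.coprime_two_left.mpr hd)
      exact Nat.Coprime.mul_left this this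
    exact ⟨fun h => hc.dvd_of_dvd_mul_left h, fun h => h.mul_left d⟩
  simp [this, h0]

lemma Th_eq_sg (Z : ℝ) : Th Z = ∑' n : ℕ, sg n * Real.exp (-(Real.pi * (n : ℝ) ^ 4 * Z)) := by
  rw [Th]
  have hinj : Function.Injective fun n : ℕ => n + 1 := fun a b h => by simpa using h
  rw [← hinj.tsum_eq (f := fun n : ℕ => sg n * Real.exp (-(Real.pi * (n : ℝ) ^ 4 * Z)))]
  · refine tsum_congr fun l => ?_
    have : sg (l + 1) = (-1) ^ l := by
      unfold sg
      rw [if_neg (by omega)]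
      rcases Nat.even_or_odd l with h | h
      · rw [h.neg_one_pow, if_neg]; obtain ⟨c, hc⟩ := h; omega
      · rw [h.neg_one_pow, if_pos]; obtain ⟨c, hc⟩ := h; omega
    rw [this]; push_cast; rfl
  · intro n hn
    rcases n with _ | n
    · simp [sg] at hn
    · exact ⟨n, rfl⟩

lemma jac_mul_sq (k l q : ℕ) (hq : q ≠ 0) :
    (jacobiSym ((k * l ^ 2 : ℕ) : ℤ) q : ℂ) = (jacobiSym k q : ℂ) * if l.Coprime q then 1 else 0 := by
  push_cast
  rw [jacobiSym.mul_left, jacobiSym.pow_left]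
  push_cast
  congr 1
  split_ifs with h
  · rcases jacobiSym.eq_one_or_neg_one (a := l) (b := q) (by simpa using h) with h | h <;> simp [h]
  · have : NeZero q := ⟨hq⟩
    rw [jacobiSym.eq_zero_iff_not_coprime.mpr (by simpa using h)]; simp

/-- Coprimality indicator. -/
def cop (n a : ℕ) : ℂ := if n.Coprime a then 1 else 0

lemma norm_cop_le (n a : ℕ) : ‖cop n a‖ ≤ 1 := by unfold cop; split_ifs <;> simp

lemma cop_mul_left (m n a : ℕ) : cop (m * n) a = cop m a * cop n a := by
  unfold cop
  simp only [Nat.coprime_mul_iff_left]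
  split_ifs <;> simp_all

lemma cop_mul_right (m a b : ℕ) : cop m (a * b) = cop m a * cop m b := by
  unfold cop
  simp only [Nat.coprime_mul_iff_right]
  split_ifs <;> simp_all

lemma cop_sq (n a : ℕ) : cop (n ^ 2) a = cop n a := by
  rw [pow_two, cop_mul_left]; unfold cop; split_ifs <;> simp

lemma norm_moeb_le (d : ℕ) : ‖(ArithmeticFunction.moebius d : ℂ)‖ ≤ 1 := by
  have := ArithmeticFunction.abs_moebius_le_one (n := d)
  rw [Complex.norm_intCast]
  exact_mod_cast this

lemma tsum_dvd (h : ℕ → ℂ) {d : ℕ} (hd : 0 < d) : (∑' n, if d ∣ n then h n else 0) = ∑' n, h (d * n) := by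
  have hinj : Function.Injective fun n : ℕ => d * n := fun a b h => Nat.eq_of_mul_eq_mul_left hd h
  rw [← hinj.tsum_eq (f := fun n : ℕ => if d ∣ n then h n else 0)]
  · refine tsum_congr fun n => ?_
    simp
  · intro n hn
    by_cases h : d ∣ n
    · obtain ⟨c, rfl⟩ := h; exact ⟨c, rfl⟩
    · simp [h] at hn

lemma tsum_cop (h : ℕ → ℂ) (hs : Summable h) {a : ℕ} (ha : a ≠ 0) :
    ∑' n, cop n a * h n = ∑ d ∈ a.divisors, (ArithmeticFunction.moebius d : ℂ) * ∑' n, h (d * n) := by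
  have h1 : ∀ n, cop n a * h n = ∑ d ∈ a.divisors, (ArithmeticFunction.moebius d : ℂ) * (if d ∣ n then h n else 0) := by
    intro n
    rw [cop, ← coprime_moebius a n ha, Finset.sum_mul]
    refine Finset.sum_congr rfl fun d _ => ?_
    split_ifs <;> simp
  simp_rw [h1]
  rw [Summable.tsum_finsetSum]
  · refine Finset.sum_congr rfl fun d hd => ?_
    rw [tsum_mul_left, tsum_dvd h (Nat.pos_of_mem_divisors hd)]
  · intro d hd
    apply Summable.mul_left
    refine Summable.of_norm_bounded hs.norm fun n => ?_
    split_ifs <;> simp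

lemma gw_scale {X d : ℝ} (hd : d ≠ 0) (v : ℝ) : gw X (d * v) = gw (X / d) v := by
  unfold gw
  congr 2
  by_cases hX : X = 0
  · simp [hX]
  field_simp

/-- the sum with coprimality condition -/
lemma cA_cop_sum (q g : ℕ) (hg : g ≠ 0) (hgo : Odd g) {X : ℝ} (hX : 0 < X) :
    ∑' m : ℕ, cop m g * ((cA m : ℂ) * (jacobiSym m q : ℂ) * (gw X m : ℂ)) =
      ∑ d ∈ g.divisors, (ArithmeticFunction.moebius d : ℂ) * ((jacobiSym d q : ℂ) * U q (X / d)) := by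
  rw [tsum_cop _ (U_summable q hX) hg]
  refine Finset.sum_congr rfl fun d hd => ?_
  congr 1
  rw [U, ← tsum_mul_left]
  refine tsum_congr fun m => ?_
  have hdo : Odd d := hgo.of_dvd_nat (Nat.dvd_of_mem_divisors hd)
  have h0 : (d : ℝ) ≠ 0 := by have := Nat.pos_of_mem_divisors hd; positivity
  rw [cA_mul_odd hdo]
  push_cast
  rw [jacobiSym.mul_left, gw_scale h0]
  push_cast
  ring

lemma hasSum_sqf (q g : ℕ) (hq : q ≠ 0) {X : ℝ} (hX : 0 < X) :
    HasSum (fun k : SqF => cop k g * (jacobiSym k q : ℂ) *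
        ∑' l : ℕ, cop l (g * q) * ((sg l : ℂ) * (gw X (k * (l : ℝ) ^ 2) : ℂ)))
      (∑' m : ℕ, cop m g * ((cA m : ℂ) * (jacobiSym m q : ℂ) * (gw X m : ℂ))) := by
  set G : ℕ → ℂ := fun m => cop m g * ((cA m : ℂ) * (jacobiSym m q : ℂ) * (gw X m : ℂ)) with hG
  have hGs : Summable G := by
    refine Summable.of_norm_bounded (U_summable q hX).norm fun n => ?_
    rw [hG]
    show ‖cop n g * _‖ ≤ _
    rw [norm_mul]
    exact mul_le_of_le_one_left (norm_nonneg _) (norm_cop_le _ _)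
  have hsup : Function.support G ⊆ Set.range fun p : SqF × ℕ => p.1.1 * (p.2 + 1) ^ 2 := by
    intro m hm
    have hm0 : m ≠ 0 := by
      rintro rfl
      apply hm
      simp [hG, cA]
    obtain ⟨a, b, hab, hs⟩ := Nat.sq_mul_squarefree m
    refine ⟨(⟨a, hs⟩, b - 1), ?_⟩
    have : b ≠ 0 := by rintro rfl; simp at hab; omega
    show a * (b - 1 + 1) ^ 2 = m
    rw [Nat.sub_add_cancel (by omega), ← hab]; ring
  have h1 : HasSum (G ∘ fun p : SqF × ℕ => p.1.1 * (p.2 + 1) ^ 2) (∑' m, G m) :=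
    (sqf_map_inj.hasSum_iff (fun x hx => by
      by_contra h; exact hx (hsup h))).mpr hGs.hasSum
  have h2 := h1.prod_fiberwise (fun k => (h1.summable.prod_factor k).hasSum)
  convert h2 using 2 with k
  have hinj : Function.Injective fun n : ℕ => n + 1 := fun a b h => by simpa using h
  rw [← hinj.tsum_eq (f := fun l : ℕ => cop l (g * q) * ((sg l : ℂ) * (gw X (k * (l : ℝ) ^ 2) : ℂ))), ← tsum_mul_left]
  · refine tsum_congr fun l => ?_
    simp only [Function.comp, hG]
    rw [jac_mul_sq _ _ _ hq, cA_sqf k.2, cop_mul_left, cop_sq, cop_mul_right]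
    rw [show (if Nat.Coprime (l+1) q then (1:ℂ) else 0) = cop (l+1) q from rfl]
    push_cast
    ring
  · intro n hn
    rcases n with _ | n
    · simp [sg] at hn
    · exact ⟨n, rfl⟩

lemma sum_sg_gw (k d : ℕ) (hd : Odd d) {X : ℝ} :
    ∑' n : ℕ, ((sg (d * n) : ℂ) * (gw X (k * ((d * n : ℕ) : ℝ) ^ 2) : ℂ)) = (Th ((k * (d : ℝ) ^ 2 / X) ^ 2) : ℂ) := by
  rw [Th_eq_sg, Complex.ofReal_tsum]
  refine tsum_congr fun n => ?_
  rw [sg_mul_odd hd, ← Complex.ofReal_mul]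
  congr 2
  unfold gw
  congr 1
  push_cast
  ring

lemma sg_gw_summable (k : ℕ) (hk : 0 < k) {X : ℝ} (hX : 0 < X) :
    Summable fun l : ℕ => ((sg l : ℂ) * (gw X (k * (l : ℝ) ^ 2) : ℂ)) := by
  have h1 := (gw_summable_nat hX)
  refine Summable.of_norm_bounded h1 fun l => ?_
  rw [norm_mul, Complex.norm_real, Complex.norm_real, Real.norm_eq_abs, Real.norm_eq_abs, abs_of_pos (gw_pos _ _)]
  refine (mul_le_of_le_one_left (gw_pos _ _).le (norm_sg_le _)).trans ?_
  unfold gw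
  apply Real.exp_le_exp.mpr
  have h2 : (l : ℝ) ≤ k * (l : ℝ) ^ 2 := by
    have : l ≤ k * l ^ 2 := by nlinarith [Nat.zero_le l, Nat.le_self_pow (two_ne_zero) l]
    exact_mod_cast this
  have h3 : (l : ℝ) ^ 2 ≤ (k * (l : ℝ) ^ 2) ^ 2 := by gcongr
  have := Real.pi_pos
  gcongr

lemma U_expand (a b : ℕ) (ha : a ≠ 0) (hb : b ≠ 0) (hao : Odd a) (hbo : Odd b) (hab : a.Coprime b) {X : ℝ} (hX : 0 < X) :
    HasSum (fun k : SqF => (jacobiSym k a : ℂ) * (jacobiSym k b : ℂ) *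
        ∑ f ∈ a.divisors, ∑ f' ∈ b.divisors, (ArithmeticFunction.moebius f : ℂ) * (ArithmeticFunction.moebius f' : ℂ) *
          (Th ((k * ((f : ℝ) ^ 2 * (f' : ℝ) ^ 2) / X) ^ 2) : ℂ)) (U (a * b) X) := by
  have h := hasSum_sqf (a * b) 1 (mul_ne_zero ha hb) hX
  have e1 : (∑' m : ℕ, cop m 1 * ((cA m : ℂ) * (jacobiSym m (a * b : ℕ) : ℂ) * (gw X m : ℂ))) = U (a * b) X := by
    rw [U]; refine tsum_congr fun m => ?_
    simp [cop]
  rw [e1] at h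
  convert h using 2 with k
  rw [one_mul, tsum_cop _ (sg_gw_summable k (Nat.pos_of_ne_zero k.2.ne_zero) hX) (mul_ne_zero ha hb)]
  have : NeZero a := ⟨ha⟩
  have : NeZero b := ⟨hb⟩
  rw [jacobiSym.mul_right]
  have : cop k 1 = 1 := by simp [cop]
  rw [this, one_mul]
  push_cast
  congr 1
  have hd := Nat.divisors_mul a b
  rw [hd, Finset.mul_def, Finset.sum_image hab.mul_injOn_divisors, Finset.sum_product]
  refine Finset.sum_congr rfl fun f hf => Finset.sum_congr rfl fun f' hf' => ?_
  have hfd := Nat.dvd_of_mem_divisors hf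
  have hfd' := Nat.dvd_of_mem_divisors hf'
  have hc : f.Coprime f' := (hab.coprime_dvd_left hfd).coprime_dvd_right hfd'
  have hm := ArithmeticFunction.isMultiplicative_moebius.map_mul_of_coprime hc
  have ho : Odd (f * f') := (hao.of_dvd_nat hfd).mul (hbo.of_dvd_nat hfd')
  have hs := sum_sg_gw k (f * f') ho (X := X)
  push_cast at hs ⊢
  rw [hs, hm]
  push_cast
  congr 4
  ring

lemma smooth_split (D : ℕ) (hD : D ≠ 0) (n : ℕ) (hn : n ≠ 0) :
    ∃ e l, n = e * l ∧ e.primeFactors ⊆ D.primeFactors ∧ l.Coprime D := by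
  induction n using Nat.strong_induction_on with
  | _ n ih =>
    by_cases hc : n.Coprime D
    · exact ⟨1, n, by simp, by simp, hc⟩
    · obtain ⟨p, hp, h1, h2⟩ := Nat.Prime.not_coprime_iff_dvd.mp hc
      obtain ⟨m, rfl⟩ := h1
      have hm : m ≠ 0 := by rintro rfl; simp at hn
      obtain ⟨e, l, h3, h4, h5⟩ := ih m (by
        have := hp.two_le; have : 0 < m := Nat.pos_of_ne_zero hm; nlinarith) hm
      refine ⟨p * e, l, by rw [h3]; ring, ?_, h5⟩
      have he : e ≠ 0 := by rintro rfl; simp at h3; exact hm h3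
      rw [Nat.primeFactors_mul hp.ne_zero he, hp.primeFactors]
      apply Finset.union_subset _ h4
      simp [hp, h2, hD]

lemma smooth_coprime {D e l : ℕ} (hD : D ≠ 0) (he : e ≠ 0) (h : e.primeFactors ⊆ D.primeFactors) (hl : l.Coprime D) :
    e.Coprime l := by
  by_contra hc
  obtain ⟨p, hp, h1, h2⟩ := Nat.Prime.not_coprime_iff_dvd.mp hc
  have : p ∈ D.primeFactors := h (by simp [hp, h1, he])
  have h3 : p ∣ D := (Nat.mem_primeFactors.mp this).2.1
  have := Nat.dvd_gcd h2 h3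
  rw [Nat.Coprime] at hl
  rw [hl] at this
  exact hp.one_lt.ne' (Nat.dvd_one.mp this)

lemma smooth_unique {D e l e' l' : ℕ} (hD : D ≠ 0) (he : e ≠ 0) (he' : e' ≠ 0) (h : e.primeFactors ⊆ D.primeFactors)
    (h' : e'.primeFactors ⊆ D.primeFactors) (hl : l.Coprime D) (hl' : l'.Coprime D) (hh : e * l = e' * l') : e = e' := by
  apply Nat.dvd_antisymm
  · exact (smooth_coprime hD he h hl').dvd_of_dvd_mul_right (hh ▸ dvd_mul_right e l)
  · exact (smooth_coprime hD he' h' hl).dvd_of_dvd_mul_right (hh ▸ dvd_mul_right e' l')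

lemma e_step (D Y : ℕ) (hD : D ≠ 0) (E : Finset ℕ) (hE : ∀ e ∈ E, e ≠ 0 ∧ e.primeFactors ⊆ D.primeFactors)
    (hE' : ∀ e, e ≠ 0 → e.primeFactors ⊆ D.primeFactors → e ≤ Y → e ∈ E) (h : ℕ → ℂ) (hs : Summable h) (h0 : h 0 = 0) :
    ‖∑' n, h n - ∑ e ∈ E, ∑' l, cop l D * h (e * l)‖ ≤ ∑' n, (if Y < n then ‖h n‖ else 0) := by
  have h1 : ∀ e ∈ E, ∑' l, cop l D * h (e * l) = ∑' n, if e ∣ n then cop (n / e) D * h n else 0 := by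
    intro e he
    have hp := Nat.pos_of_ne_zero (hE e he).1
    rw [tsum_dvd (fun n => cop (n / e) D * h n) hp]
    refine tsum_congr fun l => ?_
    rw [Nat.mul_div_cancel_left _ hp]
  have hsum : ∀ e ∈ E, Summable fun n => if e ∣ n then cop (n / e) D * h n else 0 := by
    intro e _
    refine Summable.of_norm_bounded hs.norm fun n => ?_
    split_ifs
    · rw [norm_mul]; exact mul_le_of_le_one_left (norm_nonneg _) (norm_cop_le _ _)
    · simp
  rw [Finset.sum_congr rfl h1, ← Summable.tsum_finsetSum hsum, ← hs.tsum_sub (summable_sum hsum)]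
  have key : ∀ n, ‖h n - ∑ e ∈ E, (if e ∣ n then cop (n / e) D * h n else 0)‖ ≤ if Y < n then ‖h n‖ else 0 := by
    intro n
    rcases eq_or_ne n 0 with rfl | hn
    · simp [h0]
    obtain ⟨e₀, l₀, h2, h3, h4⟩ := smooth_split D hD n hn
    have he₀ : e₀ ≠ 0 := by rintro rfl; simp at h2; exact hn h2
    have hz : ∀ e ∈ E, e ≠ e₀ → (if e ∣ n then cop (n / e) D * h n else 0) = 0 := by
      intro e he hne
      split_ifs with hd
      · have : cop (n / e) D = 0 := by
          unfold cop
          rw [if_neg]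
          intro hc
          exact hne (smooth_unique hD (hE e he).1 he₀ (hE e he).2 h3 hc h4 (by rw [Nat.mul_div_cancel' hd, h2]))
        simp [this]
      · rfl
    by_cases hm : e₀ ∈ E
    · rw [Finset.sum_eq_single_of_mem e₀ hm hz]
      have hd : e₀ ∣ n := ⟨l₀, h2⟩
      rw [if_pos hd]
      have : n / e₀ = l₀ := by rw [h2, Nat.mul_div_cancel_left _ (Nat.pos_of_ne_zero he₀)]
      rw [this, cop, if_pos h4]
      simp
      split_ifs <;> simp
    · rw [Finset.sum_eq_zero (fun e he => hz e he (by rintro rfl; exact hm he)), sub_zero, if_pos]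
      by_contra hY
      apply hm
      apply hE' e₀ he₀ h3
      have : e₀ ≤ n := Nat.le_of_dvd (Nat.pos_of_ne_zero hn) ⟨l₀, h2⟩
      omega
  have hs2 : Summable fun n => (if Y < n then ‖h n‖ else 0) := by
    refine Summable.of_norm_bounded hs.norm fun n => ?_
    split_ifs <;> simp
  exact tsum_of_norm_bounded hs2.hasSum key

/-- numbers up to `Y` composed of primes dividing `a` -/
def Ed (a Y : ℕ) : Finset ℕ := (Finset.Icc 1 Y).filter fun e => e.primeFactors ⊆ a.primeFactors

lemma mem_Ed {a Y e : ℕ} : e ∈ Ed a Y ↔ (1 ≤ e ∧ e ≤ Y) ∧ e.primeFactors ⊆ a.primeFactors := by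
  simp [Ed]

lemma smooth_odd {D e : ℕ} (he : e ≠ 0) (h : e.primeFactors ⊆ D.primeFactors) (hD : Odd D) : Odd e := by
  rw [← Nat.not_even_iff_odd, even_iff_two_dvd]
  intro h2
  have : 2 ∈ D.primeFactors := h (by simp [Nat.prime_two, h2, he])
  have h3 : 2 ∣ D := (Nat.mem_primeFactors.mp this).2.1
  exact (Nat.not_even_iff_odd.mpr hD) (even_iff_two_dvd.mpr h3)

lemma smooth_cop {a b e f : ℕ} (h : a.Coprime b) (ha : e.primeFactors ⊆ a.primeFactors)
    (hb : f.primeFactors ⊆ b.primeFactors) (he : e ≠ 0) (hf : f ≠ 0) : e.Coprime f := by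
  rw [← Nat.disjoint_primeFactors he hf]
  by_cases ha0 : a = 0
  · subst ha0
    simp at h; subst h
    simp at hb
    rcases hb with rfl | rfl <;> simp
  by_cases hb0 : b = 0
  · subst hb0
    simp at h; subst h
    simp at ha
    rcases ha with rfl | rfl <;> simp
  exact (((Nat.disjoint_primeFactors ha0 hb0).mpr h).mono_left ha).mono_right hb

/-- triple image of smooth numbers -/
def E3 (g a b Y : ℕ) : Finset ℕ := ((Ed g Y) ×ˢ (Ed a Y ×ˢ Ed b Y)).image fun t => t.1 * (t.2.1 * t.2.2)

lemma E3_sub {g a b Y : ℕ} (hg : g ≠ 0) (ha : a ≠ 0) (hb : b ≠ 0) : ∀ e ∈ E3 g a b Y,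
    e ≠ 0 ∧ e.primeFactors ⊆ (g * (a * b)).primeFactors := by
  intro e he
  simp only [E3, Finset.mem_image, Finset.mem_product, mem_Ed] at he
  obtain ⟨⟨x, y, z⟩, ⟨h1, h2, h3⟩, rfl⟩ := he
  have hx : x ≠ 0 := by have := h1.1.1; simp at this; omega
  have hy : y ≠ 0 := by have := h2.1.1; simp at this; omega
  have hz : z ≠ 0 := by have := h3.1.1; simp at this; omega
  refine ⟨by positivity, ?_⟩
  show (x * (y * z)).primeFactors ⊆ _
  rw [Nat.primeFactors_mul hx (by positivity), Nat.primeFactors_mul hy hz, Nat.primeFactors_mul hg (by positivity),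
    Nat.primeFactors_mul ha hb]
  exact Finset.union_subset_union h1.2 (Finset.union_subset_union h2.2 h3.2)

lemma smooth_of_mul {a b e : ℕ} (h : e.primeFactors ⊆ (a * b).primeFactors) (hc : e.Coprime a) :
    e.primeFactors ⊆ b.primeFactors := by
  intro p hp
  have h1 := h hp
  rw [Nat.mem_primeFactors] at h1 hp ⊢
  refine ⟨h1.1, ?_, by have := h1.2.2; intro hb; simp [hb] at this⟩
  rcases (Nat.Prime.dvd_mul h1.1).mp h1.2.1 with h2 | h2
  · exfalso
    have := Nat.dvd_gcd hp.2.1 h2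
    rw [Nat.Coprime] at hc
    rw [hc] at this
    exact h1.1.one_lt.ne' (Nat.dvd_one.mp this)
  · exact h2

lemma E3_sup {g a b Y : ℕ} (hg : g ≠ 0) (ha : a ≠ 0) : ∀ e, e ≠ 0 → e.primeFactors ⊆ (g * (a * b)).primeFactors →
    e ≤ Y → e ∈ E3 g a b Y := by
  intro e he hs hY
  obtain ⟨x, l, rfl, hx, hl⟩ := smooth_split g hg e he
  have hl0 : l ≠ 0 := by rintro rfl; simp at he
  have hx0 : x ≠ 0 := by rintro rfl; simp at he
  have hls : l.primeFactors ⊆ (a * b).primeFactors :=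
    smooth_of_mul ((Nat.primeFactors_mono (dvd_mul_left l x) he).trans hs) hl
  obtain ⟨y, z, rfl, hy, hz⟩ := smooth_split a ha l hl0
  have hz0 : z ≠ 0 := by rintro rfl; simp at hl0
  have hy0 : y ≠ 0 := by rintro rfl; simp at hl0
  have hzs : z.primeFactors ⊆ b.primeFactors :=
    smooth_of_mul ((Nat.primeFactors_mono (dvd_mul_left z y) hl0).trans hls) hz
  simp only [E3, Finset.mem_image, Finset.mem_product, mem_Ed]
  have hpos : 0 < x * (y * z) := Nat.pos_of_ne_zero he
  refine ⟨(x, y, z), ⟨⟨⟨Nat.pos_of_ne_zero hx0, ?_⟩, hx⟩, ⟨⟨Nat.pos_of_ne_zero hy0, ?_⟩, hy⟩,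
    ⟨⟨Nat.pos_of_ne_zero hz0, ?_⟩, hzs⟩⟩, rfl⟩
  · exact (Nat.le_of_dvd hpos ⟨y * z, rfl⟩).trans hY
  · exact (Nat.le_of_dvd hpos ⟨x * z, by ring⟩).trans hY
  · exact (Nat.le_of_dvd hpos ⟨x * y, by ring⟩).trans hY

lemma E3_sum {g a b Y : ℕ} (hg : g ≠ 0) (ha : a ≠ 0) (hga : g.Coprime a)
    (hgb : g.Coprime b) (hab : a.Coprime b) (F : ℕ → ℂ) :
    ∑ e ∈ E3 g a b Y, F e = ∑ x ∈ Ed g Y, ∑ y ∈ Ed a Y, ∑ z ∈ Ed b Y, F (x * (y * z)) := by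
  rw [E3, Finset.sum_image, Finset.sum_product]
  · refine Finset.sum_congr rfl fun x _ => ?_
    rw [Finset.sum_product]
  · rintro ⟨x, y, z⟩ h1 ⟨x', y', z'⟩ h2 h
    simp only [Finset.coe_product, Set.mem_prod, Finset.mem_coe, mem_Ed] at h1 h2
    have hsub : ∀ w, w.Coprime w → w = 1 := fun w hw => by simpa using hw
    obtain ⟨hx, hy, hz⟩ := h1
    obtain ⟨hx', hy', hz'⟩ := h2
    have c1 : ∀ {u v w : ℕ}, u.Coprime v → 1 ≤ w → w.primeFactors ⊆ v.primeFactors → v ≠ 0 → w.Coprime u :=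
      fun huv hw hs hv => smooth_coprime hv (by omega) hs huv
    have cop0 : ∀ {u v : ℕ} , u ≠ 0 → u.Coprime v → ∀ {w : ℕ}, 1 ≤ w → w.primeFactors ⊆ v.primeFactors → w.Coprime u := by
      intro u v hu huv w hw hs
      exact (smooth_cop huv (Finset.Subset.refl _) hs hu (by omega)).symm
    have e1 : x = x' := by
      refine smooth_unique hg (by omega) (by omega) hx.2 hx'.2 ?_ ?_ h
      · exact Nat.Coprime.mul_left (cop0 hg hga hy.1.1 hy.2) (cop0 hg hgb hz.1.1 hz.2)
      · exact Nat.Coprime.mul_left (cop0 hg hga hy'.1.1 hy'.2) (cop0 hg hgb hz'.1.1 hz'.2)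
    subst e1
    have h' : y * z = y' * z' := Nat.eq_of_mul_eq_mul_left hx.1.1 h
    have e2 : y = y' :=
      smooth_unique ha (by omega) (by omega) hy.2 hy'.2 (cop0 ha hab hz.1.1 hz.2) (cop0 ha hab hz'.1.1 hz'.2) h'
    subst e2
    have e3 := Nat.eq_of_mul_eq_mul_left hy.1.1 h'
    subst e3
    rfl

lemma jac_cop (k g : ℕ) (hg : g ≠ 0) : (jacobiSym k g : ℂ) * (jacobiSym k g : ℂ) = cop k g := by
  have h := jac_mul_sq 1 k g hg
  simp only [one_mul, Nat.cast_one, jacobiSym.one_left, Int.cast_one, Nat.cast_pow] at h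
  rw [jacobiSym.pow_left] at h
  rw [cop, ← h]; push_cast; ring

lemma exp_nat_summable : Summable fun n : ℕ => Real.exp (-(n : ℝ)) := by
  exact Real.summable_exp_neg_nat

lemma T_dec : ∃ C0 : ℝ, 0 < C0 ∧ ∀ (g a b Y : ℕ) (M : ℝ), Odd g → Odd a → Odd b → g.Coprime a → g.Coprime b →
    a.Coprime b → 1 ≤ M → M ≤ Y →
    ‖∑' k : SqF, (jacobiSym k (g * a : ℕ) : ℂ) * (jacobiSym k (g * b : ℕ) : ℂ) * (Th ((k / M) ^ 2) : ℂ) -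
      ∑ eg ∈ Ed g Y, ∑ ea ∈ Ed a Y, ∑ eb ∈ Ed b Y, ∑ d ∈ g.divisors,
        (ArithmeticFunction.moebius d : ℂ) * ((jacobiSym d a : ℂ) * (jacobiSym d b : ℂ) *
          U (a * b) (M / (d * ((eg : ℝ) ^ 2 * (ea : ℝ) ^ 2 * (eb : ℝ) ^ 2))))‖ ≤ C0 := by
  set e0 := ∑' n : ℕ, Real.exp (-(n : ℝ)) with he0
  have e0pos : 0 < e0 := exp_nat_summable.tsum_pos (fun n => (Real.exp_pos _).le) 0 (Real.exp_pos _)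
  refine ⟨e0 * e0, by positivity, ?_⟩
  intro g a b Y M hg ha hb hga hgb hab hM hMY
  have hg0 : g ≠ 0 := by rintro rfl; simp at hg
  have ha0 : a ≠ 0 := by rintro rfl; simp at ha
  have hb0 : b ≠ 0 := by rintro rfl; simp at hb
  have i1 : NeZero g := ⟨hg0⟩
  have i2 : NeZero a := ⟨ha0⟩
  have i3 : NeZero b := ⟨hb0⟩
  have hM0 : 0 < M := by linarith
  set D := g * (a * b) with hD
  have hD0 : D ≠ 0 := by positivity
  have hDo : Odd D := hg.mul (ha.mul hb)
  set h : ℕ → ℕ → ℂ := fun k n => (sg n : ℂ) * (gw M (k * (n : ℝ) ^ 2) : ℂ) with hh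
  have hTh : ∀ k : ℕ, ∑' n, h k n = (Th ((k / M) ^ 2) : ℂ) := by
    intro k
    have := sum_sg_gw k 1 odd_one (X := M)
    simpa using this
  set R : SqF → ℂ := fun k => ∑' n, h k n - ∑ e ∈ E3 g a b Y, ∑' l, cop l D * h k (e * l) with hR
  have hRb : ∀ k : SqF, ‖R k‖ ≤ Real.exp (-((k : ℕ) : ℝ)) * e0 := by
    intro k
    have hk : 0 < (k : ℕ) := Nat.pos_of_ne_zero k.2.ne_zero
    refine (e_step D Y hD0 _ (E3_sub hg0 ha0 hb0) (E3_sup hg0 ha0) (h k) (sg_gw_summable k hk hM0) (by simp [hh, sg])).trans ?_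
    rw [he0, ← tsum_mul_left]
    have hb : ∀ n : ℕ, (if Y < n then ‖h k n‖ else 0) ≤ Real.exp (-((k : ℕ) : ℝ)) * Real.exp (-(n : ℝ)) := by
      intro n
      split_ifs with hn
      · rw [hh]
        show ‖(sg n : ℂ) * (gw M (k * (n : ℝ) ^ 2) : ℂ)‖ ≤ _
        rw [norm_mul, Complex.norm_real, Complex.norm_real, Real.norm_eq_abs, Real.norm_eq_abs, abs_of_pos (gw_pos _ _)]
        refine (mul_le_of_le_one_left (gw_pos _ _).le (norm_sg_le _)).trans ?_
        unfold gw
        rw [← Real.exp_add]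
        apply Real.exp_le_exp.mpr
        have hk1 : (1 : ℝ) ≤ (k : ℕ) := by exact_mod_cast hk
        have hn1 : M ≤ n := hMY.trans (by exact_mod_cast hn.le)
        have hn2 : (1 : ℝ) ≤ n := hM.trans hn1
        have h5 : ((k : ℕ) : ℝ) ^ 2 * (n : ℝ) ^ 2 ≤ (((k : ℕ) : ℝ) * (n : ℝ) ^ 2) ^ 2 / M ^ 2 := by
          rw [le_div_iff₀ (by positivity)]
          have : M ^ 2 ≤ (n : ℝ) ^ 2 := by gcongr
          calc ((k : ℕ) : ℝ) ^ 2 * (n : ℝ) ^ 2 * M ^ 2 ≤ ((k : ℕ) : ℝ) ^ 2 * (n : ℝ) ^ 2 * (n : ℝ) ^ 2 := by gcongr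
            _ = _ := by ring
        have h6 : 2 * (((k : ℕ) : ℝ) * n) ≤ Real.pi * (((k : ℕ) : ℝ) ^ 2 * (n : ℝ) ^ 2) := by
          have h7 : ((k : ℕ) : ℝ) * n ≤ ((k : ℕ) : ℝ) ^ 2 * (n : ℝ) ^ 2 := by
            have : 1 ≤ ((k : ℕ) : ℝ) * n := by nlinarith
            nlinarith
          have := Real.pi_gt_three
          have h8 : 0 < ((k : ℕ) : ℝ) * n := by positivity
          nlinarith
        have h9 : ((k : ℕ) : ℝ) + n ≤ 2 * (((k : ℕ) : ℝ) * n) := by nlinarith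
        have h10 : Real.pi * (((k : ℕ) : ℝ) ^ 2 * (n : ℝ) ^ 2) ≤ Real.pi * (((k : ℕ) : ℝ) * (n : ℝ) ^ 2) ^ 2 / M ^ 2 := by
          rw [mul_div_assoc]
          have := Real.pi_pos
          gcongr
        linarith
      · positivity
    have hs1 : Summable fun n : ℕ => Real.exp (-((k : ℕ) : ℝ)) * Real.exp (-(n : ℝ)) := exp_nat_summable.mul_left _
    refine Summable.tsum_le_tsum hb (Summable.of_nonneg_of_le (fun n => ?_) hb hs1) hs1
    split_ifs <;> simp
  have hinj : Function.Injective (fun k : SqF => (k : ℕ)) := Subtype.val_injective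
  have hsk : Summable fun k : SqF => Real.exp (-((k : ℕ) : ℝ)) * e0 :=
    (exp_nat_summable.comp_injective hinj).mul_right _
  set r : SqF → ℂ := fun k => cop k g * (jacobiSym k (a * b : ℕ) : ℂ) * R k with hr
  have hrb : ∀ k, ‖r k‖ ≤ Real.exp (-((k : ℕ) : ℝ)) * e0 := by
    intro k
    rw [hr]
    show ‖cop k g * (jacobiSym k (a * b : ℕ) : ℂ) * R k‖ ≤ _
    rw [norm_mul, norm_mul]
    have h1 := norm_cop_le k g
    have h2 := norm_jac_le k (a * b)
    have h3 : ‖cop k g‖ * ‖(jacobiSym k (a * b : ℕ) : ℂ)‖ ≤ 1 := mul_le_one₀ h1 (norm_nonneg _) h2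
    exact (mul_le_of_le_one_left (norm_nonneg _) h3).trans (hRb k)
  have hrs : Summable r := Summable.of_norm_bounded hsk hrb
  have hrt : ‖∑' k, r k‖ ≤ e0 * e0 := by
    refine (tsum_of_norm_bounded hsk.hasSum hrb).trans ?_
    rw [tsum_mul_right]
    gcongr
    exact Summable.tsum_le_tsum_of_inj (fun k : SqF => (k : ℕ)) hinj (fun _ _ => (Real.exp_pos _).le) (fun _ => le_rfl)
      (exp_nat_summable.comp_injective hinj) exp_nat_summable
  have hV : ∀ e ∈ E3 g a b Y, HasSum (fun k : SqF => cop k g * (jacobiSym k (a * b : ℕ) : ℂ) * ∑' l, cop l D * h k (e * l))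
      (∑ d ∈ g.divisors, (ArithmeticFunction.moebius d : ℂ) * ((jacobiSym d (a * b : ℕ) : ℂ) * U (a * b) (M / (e : ℝ) ^ 2 / d))) := by
    intro e he
    obtain ⟨he0, hes⟩ := E3_sub hg0 ha0 hb0 e he
    have heo := smooth_odd he0 hes hDo
    have hep : 0 < (e : ℝ) := by have := Nat.pos_of_ne_zero he0; exact_mod_cast this
    rw [← cA_cop_sum _ g hg0 hg (by positivity)]
    convert hasSum_sqf (a * b) g (mul_ne_zero ha0 hb0) (X := M / (e : ℝ) ^ 2) (by positivity) using 5 with k l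
    rw [hh, ← hD]
    congr 1
    show (sg (e * l) : ℂ) * (gw M ((k : ℕ) * ((e * l : ℕ) : ℝ) ^ 2) : ℂ) = _
    rw [sg_mul_odd heo, ← gw_scale (by positivity)]
    push_cast
    congr 3
    ring
  have hsumV := hasSum_sum hV
  have hfin := hrs.hasSum.add hsumV
  have hT : (∑' k : SqF, (jacobiSym k (g * a : ℕ) : ℂ) * (jacobiSym k (g * b : ℕ) : ℂ) * (Th ((k / M) ^ 2) : ℂ)) = ∑' k, r k +
     ∑ e ∈ E3 g a b Y, (∑ d ∈ g.divisors, (ArithmeticFunction.moebius d : ℂ) * ((jacobiSym d (a * b : ℕ) : ℂ) * U (a * b) (M / (e : ℝ) ^ 2 / d))) := by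
    rw [← hfin.tsum_eq]
    refine tsum_congr fun k => ?_
    rw [← Finset.mul_sum, hr]
    show _ = cop k g * (jacobiSym k (a * b : ℕ) : ℂ) * R k + _
    rw [← mul_add, hR]
    show _ = cop k g * (jacobiSym k (a * b : ℕ) : ℂ) * ((∑' n, h k n - ∑ e ∈ E3 g a b Y, ∑' l, cop l D * h k (e * l)) + _)
    rw [sub_add_cancel, hTh, ← jac_cop k g hg0, jacobiSym.mul_right, jacobiSym.mul_right, jacobiSym.mul_right]
    push_cast
    ring
  rw [hT, E3_sum hg0 ha0 hga hgb hab]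
  refine le_trans (le_of_eq ?_) hrt
  congr 1
  rw [add_sub_assoc, add_eq_left, sub_eq_zero]
  refine Finset.sum_congr rfl fun x _ => Finset.sum_congr rfl fun y _ => Finset.sum_congr rfl fun z _ =>
    Finset.sum_congr rfl fun d _ => ?_
  rw [jacobiSym.mul_right]
  push_cast
  rw [div_div]
  congr 4
  ring

/-- The character sum. -/
noncomputable def Sx (A : Finset ℕ) (x : ℕ → ℂ) (k : ℕ) : ℂ := ∑ n ∈ A, x n * (jacobiSym k n : ℂ)

/-- Weighted large sieve bound. -/
def WB (X : ℝ) (A : Finset ℕ) (Λ : ℝ) : Prop :=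
  ∀ (x : ℕ → ℂ) (K : Finset ℕ), (∀ k ∈ K, Squarefree k) →
    ∑ k ∈ K, (min 1 (X / k)) ^ 12 * ‖Sx A x k‖ ^ 2 ≤ Λ * ∑ n ∈ A, ‖x n‖ ^ 2

lemma cop_sum (A : Finset ℕ) (n m : ℕ) (hn : n ∈ A) (hn0 : n ≠ 0) :
    cop n m = ∑ δ ∈ A.biUnion Nat.divisors, (ArithmeticFunction.moebius δ : ℂ) *
      ((if δ ∣ n then 1 else 0) * (if δ ∣ m then 1 else 0)) := by
  have h := coprime_moebius n m hn0
  have : cop n m = if m.Coprime n then 1 else 0 := by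
    unfold cop; simp only [Nat.coprime_comm]
  rw [this, ← h]
  have hsub : n.divisors ⊆ A.biUnion Nat.divisors := Finset.subset_biUnion_of_mem Nat.divisors hn
  rw [← Finset.sum_subset hsub]
  · refine Finset.sum_congr rfl fun d hd => ?_
    rw [if_pos (Nat.dvd_of_mem_divisors hd)]
    split_ifs <;> simp
  · intro d _ hd
    have : ¬ d ∣ n := fun h => hd (Nat.mem_divisors.mpr ⟨h, hn0⟩)
    simp [this]

/-- total mass of coefficients over a fibre -/
noncomputable def fib {ι : Type} (I : Finset ι) (n : ι → ℕ) (p : ι → ℂ) (a : ℕ) : ℝ := ∑ i ∈ I.filter (fun i => n i = a), ‖p i‖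

lemma fib_nonneg {ι : Type} (I : Finset ι) (n : ι → ℕ) (p : ι → ℂ) (a : ℕ) : 0 ≤ fib I n p a :=
  Finset.sum_nonneg fun _ _ => norm_nonneg _

lemma fib_sum {ι : Type} (A : Finset ℕ) (I : Finset ι) (n : ι → ℕ) (hn : ∀ i ∈ I, n i ∈ A) (p : ι → ℂ) (δ k : ℕ) :
    ∑ i ∈ I, (if δ ∣ n i then (1 : ℂ) else 0) * (p i * (jacobiSym k (n i) : ℂ)) =
      Sx A (fun a => (if δ ∣ a then (1 : ℂ) else 0) * ∑ i ∈ I.filter (fun i => n i = a), p i) k := by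
  rw [Sx, ← Finset.sum_fiberwise_of_maps_to hn]
  refine Finset.sum_congr rfl fun a _ => ?_
  rw [mul_assoc, Finset.sum_mul, Finset.mul_sum]
  refine Finset.sum_congr rfl fun i hi => ?_
  rw [(Finset.mem_filter.mp hi).2]

lemma fib_bound {ι : Type} {X Λ R : ℝ} (hΛ : 0 ≤ Λ) {A : Finset ℕ} (hA : WB X A Λ) (hR : ∀ n ∈ A, (n.divisors.card : ℝ) ≤ R)
    (hA0 : ∀ n ∈ A, n ≠ 0) {K : Finset ℕ} (hK : ∀ k ∈ K, Squarefree k)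
    (I : Finset ι) (n : ι → ℕ) (hn : ∀ i ∈ I, n i ∈ A) (p : ι → ℂ) (p' : ι → ℂ) (hp : ∀ i ∈ I, ‖p' i‖ ≤ ‖p i‖) :
    ∑ δ ∈ A.biUnion Nat.divisors, ∑ k ∈ K, (min 1 (X / k)) ^ 12 *
      ‖∑ i ∈ I, (if δ ∣ n i then (1 : ℂ) else 0) * (p' i * (jacobiSym k (n i) : ℂ))‖ ^ 2 ≤
      Λ * (R * ∑ a ∈ A, fib I n p a ^ 2) := by
  simp_rw [fib_sum A I n hn p']
  calc _ ≤ ∑ δ ∈ A.biUnion Nat.divisors, Λ * ∑ a ∈ A, (if δ ∣ a then 1 else 0) * fib I n p a ^ 2 := by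
        refine Finset.sum_le_sum fun δ _ => (hA _ K hK).trans ?_
        gcongr with a ha
        rw [norm_mul, mul_pow]
        have h1 : ‖∑ i ∈ I.filter (fun i => n i = a), p' i‖ ≤ fib I n p a := by
          refine (norm_sum_le _ _).trans (Finset.sum_le_sum fun i hi => hp i (Finset.mem_filter.mp hi).1)
        split_ifs
        · simp only [norm_one, one_pow, one_mul]; gcongr
        · simp
    _ = Λ * ∑ a ∈ A, (∑ δ ∈ A.biUnion Nat.divisors, (if δ ∣ a then 1 else 0)) * fib I n p a ^ 2 := by
        rw [← Finset.mul_sum, Finset.sum_comm]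
        congr 1
        refine Finset.sum_congr rfl fun a _ => ?_
        rw [Finset.sum_mul]
    _ ≤ _ := by
        rw [Finset.mul_sum (s := A) (a := R)]
        gcongr with a ha
        refine le_trans ?_ (hR a ha)
        rw [Finset.sum_boole]
        gcongr
        intro δ hδ
        rw [Nat.mem_divisors]
        exact ⟨(Finset.mem_filter.mp hδ).2, hA0 a ha⟩

lemma pl_half {σ : ℝ} (hσ : 0 < σ) : ∃ C : ℝ, 0 < C ∧ ∀ {ι : Type} (X Λ R L : ℝ), 1 ≤ X → 0 ≤ Λ → 0 ≤ L → ∀ (A : Finset ℕ), WB X A Λ →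
    (∀ n ∈ A, (n.divisors.card : ℝ) ≤ R) → (∀ n ∈ A, n ≠ 0) → ∀ (K : Finset ℕ), (∀ k ∈ K, Squarefree k) →
    (∀ k ∈ K, Real.exp (-(2 * σ) * Real.log (k / X)) ≤ L * (min 1 (X / k)) ^ 12) →
    ∀ (I J : Finset ι) (n m : ι → ℕ), (∀ i ∈ I, n i ∈ A) → (∀ j ∈ J, m j ∈ A) →
    ∀ (p q : ι → ℂ) (s s' : ι → ℝ), (∀ i ∈ I, 1 ≤ s i) → (∀ j ∈ J, 1 ≤ s' j) →
    ‖∑ k ∈ K, ∑ i ∈ I, ∑ j ∈ J, cop (n i) (m j) * (p i * q j) * ((jacobiSym k (n i) : ℂ) * (jacobiSym k (m j) : ℂ)) *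
      (Th ((k * (s i * s' j) / X) ^ 2) : ℂ)‖ ≤ C * (L * (Λ * (R * (∑ a ∈ A, fib I n p a ^ 2 + ∑ a ∈ A, fib J m q a ^ 2)))) := by
  obtain ⟨C, hC, hsep⟩ := sep hσ
  refine ⟨C, hC, ?_⟩
  intro ι X Λ R L hX hΛ hL A hA hR hA0 K hK hKL I J n m hn hm p q s s' hs hs'
  have hX0 : 0 < X := by linarith
  have h := hsep (K ×ˢ (I ×ˢ J)) (fun t => cop (n t.2.1) (m t.2.2) * (p t.2.1 * q t.2.2) *
    ((jacobiSym t.1 (n t.2.1) : ℂ) * (jacobiSym t.1 (m t.2.2) : ℂ))) (fun t => (t.1 * (s t.2.1 * s' t.2.2) / X) ^ 2)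
    (L * (Λ * (R * (∑ a ∈ A, fib I n p a ^ 2 + ∑ a ∈ A, fib J m q a ^ 2)))) ?_ ?_
  · rw [Finset.sum_product] at h
    simp_rw [Finset.sum_product] at h
    exact h
  · rintro ⟨k, i, j⟩ ht
    simp only [Finset.mem_product] at ht
    have h1 := hs i ht.2.1
    have h2 := hs' j ht.2.2
    have h3 : 0 < (k : ℝ) := by have := Nat.pos_of_ne_zero (hK k ht.1).ne_zero; exact_mod_cast this
    have h4 : 0 < s i := by linarith
    have h5 : 0 < s' j := by linarith
    show 0 < ((k : ℝ) * (s i * s' j) / X) ^ 2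
    positivity
  · intro τ
    set z : ℂ := (σ : ℂ) + τ * Complex.I with hz
    have hzre : z.re = σ := by simp [hz]
    set p' : ι → ℂ := fun i => p i * Complex.exp (-(2 * z) * Real.log (s i)) with hp'
    set q' : ι → ℂ := fun j => q j * Complex.exp (-(2 * z) * Real.log (s' j)) with hq'
    have hb : ∀ (u : ι → ℂ) (v : ι → ℝ) (i : ι), 1 ≤ v i → ‖u i * Complex.exp (-(2 * z) * Real.log (v i))‖ ≤ ‖u i‖ := by
      intro u v i hv
      rw [norm_mul]
      apply mul_le_of_le_one_right (norm_nonneg _)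
      rw [Complex.norm_exp, Complex.re_mul_ofReal, Real.exp_le_one_iff]
      have : (-(2 * z)).re = -(2 * σ) := by simp [hzre]
      rw [this]
      have := Real.log_nonneg hv
      nlinarith [mul_nonneg hσ.le this]
    have hP := fib_bound hΛ hA hR hA0 hK I n hn p p' (fun i hi => hb p s i (hs i hi))
    have hQ := fib_bound hΛ hA hR hA0 hK J m hm q q' (fun i hi => hb q s' i (hs' i hi))
    set P : ℕ → ℕ → ℂ := fun δ k => ∑ i ∈ I, (if δ ∣ n i then (1 : ℂ) else 0) * (p' i * (jacobiSym k (n i) : ℂ)) with hPd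
    set Q : ℕ → ℕ → ℂ := fun δ k => ∑ j ∈ J, (if δ ∣ m j then (1 : ℂ) else 0) * (q' j * (jacobiSym k (m j) : ℂ)) with hQd
    have heq : ∑ t ∈ K ×ˢ (I ×ˢ J), (cop (n t.2.1) (m t.2.2) * (p t.2.1 * q t.2.2) *
        ((jacobiSym t.1 (n t.2.1) : ℂ) * (jacobiSym t.1 (m t.2.2) : ℂ))) *
        Complex.exp (-z * Real.log ((t.1 * (s t.2.1 * s' t.2.2) / X) ^ 2)) =
        ∑ δ ∈ A.biUnion Nat.divisors, ∑ k ∈ K, (ArithmeticFunction.moebius δ : ℂ) *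
          Complex.exp (-(2 * z) * Real.log (k / X)) * (P δ k * Q δ k) := by
      rw [Finset.sum_product, Finset.sum_comm (t := K)]
      refine Finset.sum_congr rfl fun k hk => ?_
      rw [Finset.sum_product]
      have e1 : ∀ δ, (ArithmeticFunction.moebius δ : ℂ) * Complex.exp (-(2 * z) * Real.log (k / X)) * (P δ k * Q δ k) =
        ∑ i ∈ I, ∑ j ∈ J, (ArithmeticFunction.moebius δ : ℂ) * Complex.exp (-(2 * z) * Real.log (k / X)) *
          (((if δ ∣ n i then (1 : ℂ) else 0) * (p' i * (jacobiSym k (n i) : ℂ))) *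
           ((if δ ∣ m j then (1 : ℂ) else 0) * (q' j * (jacobiSym k (m j) : ℂ)))) := by
        intro δ
        show _ * (Finset.sum _ _ * Finset.sum _ _) = _
        rw [Finset.sum_mul_sum]
        simp only [Finset.mul_sum]
      rw [Finset.sum_congr rfl fun δ _ => e1 δ, Finset.sum_comm (s := A.biUnion Nat.divisors)]
      refine Finset.sum_congr rfl fun i hi => ?_
      rw [Finset.sum_comm (s := A.biUnion Nat.divisors)]
      refine Finset.sum_congr rfl fun j hj => ?_
      have h1 := hs i hi
      have h2 := hs' j hj
      have h3 : 0 < (k : ℝ) := by have := Nat.pos_of_ne_zero (hK k hk).ne_zero; exact_mod_cast this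
      have h4 : 0 < s i := by linarith
      have h5 : 0 < s' j := by linarith
      have hlog : Real.log (((k : ℝ) * (s i * s' j) / X) ^ 2) = 2 * Real.log (k / X) + 2 * Real.log (s i) + 2 * Real.log (s' j) := by
        rw [Real.log_pow, show (k : ℝ) * (s i * s' j) / X = (k / X) * (s i * s' j) by ring,
          Real.log_mul (by positivity) (by positivity), Real.log_mul (by positivity) (by positivity)]
        push_cast; ring
      have hexp : Complex.exp (-z * Real.log (((k : ℝ) * (s i * s' j) / X) ^ 2)) = Complex.exp (-(2 * z) * Real.log (k / X)) *
          Complex.exp (-(2 * z) * Real.log (s i)) * Complex.exp (-(2 * z) * Real.log (s' j)) := by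
        rw [hlog, ← Complex.exp_add, ← Complex.exp_add]
        congr 1
        push_cast; ring
      show (cop (n i) (m j) * (p i * q j) * ((jacobiSym k (n i) : ℂ) * (jacobiSym k (m j) : ℂ))) *
        Complex.exp (-z * Real.log (((k : ℝ) * (s i * s' j) / X) ^ 2)) = _
      rw [hexp, cop_sum A (n i) (m j) (hn i hi) (hA0 _ (hn i hi)), Finset.sum_mul, Finset.sum_mul, Finset.sum_mul]
      refine Finset.sum_congr rfl fun δ _ => ?_
      rw [hp', hq']
      ring
    rw [heq]
    calc _ ≤ ∑ δ ∈ A.biUnion Nat.divisors, ∑ k ∈ K, L * ((min 1 (X / k)) ^ 12 * ‖P δ k‖ ^ 2 + (min 1 (X / k)) ^ 12 * ‖Q δ k‖ ^ 2) := by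
          refine (norm_sum_le _ _).trans (Finset.sum_le_sum fun δ _ => (norm_sum_le _ _).trans (Finset.sum_le_sum fun k hk => ?_))
          rw [norm_mul, norm_mul, norm_mul]
          have h1 : ‖Complex.exp (-(2 * z) * Real.log (k / X))‖ ≤ L * (min 1 (X / k)) ^ 12 := by
            rw [Complex.norm_exp, Complex.re_mul_ofReal]
            have : (-(2 * z)).re = -(2 * σ) := by simp [hzre]
            rw [this]
            exact hKL k hk
          have h2 := norm_moeb_le δ
          have h3 : ‖P δ k‖ * ‖Q δ k‖ ≤ ‖P δ k‖ ^ 2 + ‖Q δ k‖ ^ 2 := by nlinarith [sq_nonneg (‖P δ k‖ - ‖Q δ k‖), sq_nonneg (‖P δ k‖ + ‖Q δ k‖)]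
          calc _ ≤ 1 * (L * (min 1 (X / k)) ^ 12) * (‖P δ k‖ ^ 2 + ‖Q δ k‖ ^ 2) := by gcongr
            _ = _ := by ring
      _ = L * (∑ δ ∈ A.biUnion Nat.divisors, ∑ k ∈ K, (min 1 (X / k)) ^ 12 * ‖P δ k‖ ^ 2 +
           ∑ δ ∈ A.biUnion Nat.divisors, ∑ k ∈ K, (min 1 (X / k)) ^ 12 * ‖Q δ k‖ ^ 2) := by
          simp only [← Finset.mul_sum, Finset.sum_add_distrib]
      _ ≤ L * (Λ * (R * ∑ a ∈ A, fib I n p a ^ 2) + Λ * (R * ∑ a ∈ A, fib J m q a ^ 2)) := by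
          gcongr
      _ = _ := by ring

lemma pl_core {ε : ℝ} (hε : 0 < ε) : ∃ C : ℝ, 0 < C ∧ ∀ {ι : Type} (X Λ R : ℝ), 1 ≤ X → 0 ≤ Λ → 0 ≤ R → ∀ (A : Finset ℕ), WB X A Λ →
    (∀ n ∈ A, (n.divisors.card : ℝ) ≤ R) → (∀ n ∈ A, n ≠ 0) → ∀ (K : Finset ℕ), (∀ k ∈ K, Squarefree k) →
    ∀ (I J : Finset ι) (n m : ι → ℕ), (∀ i ∈ I, n i ∈ A) → (∀ j ∈ J, m j ∈ A) →
    ∀ (p q : ι → ℂ) (s s' : ι → ℝ), (∀ i ∈ I, 1 ≤ s i) → (∀ j ∈ J, 1 ≤ s' j) →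
    ‖∑ k ∈ K, ∑ i ∈ I, ∑ j ∈ J, cop (n i) (m j) * (p i * q j) * ((jacobiSym k (n i) : ℂ) * (jacobiSym k (m j) : ℂ)) *
      (Th ((k * (s i * s' j) / X) ^ 2) : ℂ)‖ ≤ C * (X ^ ε * (Λ * (R * (∑ a ∈ A, fib I n p a ^ 2 + ∑ a ∈ A, fib J m q a ^ 2)))) := by
  obtain ⟨C1, hC1, h1⟩ := pl_half (show 0 < ε / 2 by linarith)
  obtain ⟨C2, hC2, h2⟩ := pl_half (show (0 : ℝ) < 6 by norm_num)
  refine ⟨C1 + C2, by positivity, ?_⟩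
  intro ι X Λ R hX hΛ hR0 A hA hR hA0 K hK I J n m hn hm p q s s' hs hs'
  have hX0 : 0 < X := by linarith
  have hXe : 1 ≤ X ^ ε := Real.one_le_rpow hX hε.le
  rw [← Finset.sum_filter_add_sum_filter_not K (fun k => (k : ℝ) ≤ X)]
  have hk0 : ∀ k ∈ K, 0 < (k : ℝ) := fun k hk => by
    have := Nat.pos_of_ne_zero (hK k hk).ne_zero; exact_mod_cast this
  have a1 := h1 X Λ R (X ^ ε) hX hΛ (by positivity) A hA hR hA0 (K.filter fun k => (k : ℝ) ≤ X)
    (fun k hk => hK k (Finset.mem_filter.mp hk).1) (by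
      intro k hk
      obtain ⟨hk1, hk2⟩ := Finset.mem_filter.mp hk
      have h3 := hk0 k hk1
      have h4 : 1 ≤ X / k := by rw [le_div_iff₀ h3]; linarith
      rw [min_eq_left h4, one_pow, mul_one, Real.rpow_def_of_pos hX0]
      apply Real.exp_le_exp.mpr
      rw [Real.log_div h3.ne' hX0.ne']
      have h5 : 0 ≤ Real.log k := Real.log_nonneg (by
        have := Nat.pos_of_ne_zero (hK k hk1).ne_zero; exact_mod_cast this)
      nlinarith [mul_nonneg hε.le h5]) I J n m hn hm p q s s' hs hs'
  have a2 := h2 X Λ R 1 hX hΛ (by positivity) A hA hR hA0 (K.filter fun k => ¬ (k : ℝ) ≤ X)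
    (fun k hk => hK k (Finset.mem_filter.mp hk).1) (by
      intro k hk
      obtain ⟨hk1, hk2⟩ := Finset.mem_filter.mp hk
      have h3 := hk0 k hk1
      have h4 : X / k ≤ 1 := by rw [div_le_one h3]; linarith
      rw [min_eq_right h4, one_mul]
      apply le_of_eq
      rw [show -(2 * (6 : ℝ)) * Real.log (k / X) = (12 : ℕ) * Real.log (X / k) by
        rw [Real.log_div h3.ne' hX0.ne', Real.log_div hX0.ne' h3.ne']; push_cast; ring]
      rw [← Real.log_pow, Real.exp_log (by positivity)]) I J n m hn hm p q s s' hs hs'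
  refine (norm_add_le _ _).trans ((add_le_add a1 a2).trans ?_)
  have hQ : 0 ≤ Λ * (R * (∑ a ∈ A, fib I n p a ^ 2 + ∑ a ∈ A, fib J m q a ^ 2)) := by positivity
  set Q := Λ * (R * (∑ a ∈ A, fib I n p a ^ 2 + ∑ a ∈ A, fib J m q a ^ 2))
  have : C2 * (1 * Q) ≤ C2 * (X ^ ε * Q) := by gcongr
  linarith

lemma fib_sigma {ι : Type} {R : ℝ} {A : Finset ℕ} (hR : ∀ n ∈ A, (n.divisors.card : ℝ) ≤ R) (I : Finset ι) (n : ι → ℕ) (p : ι → ℂ) :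
    ∑ a ∈ A, fib (I.sigma fun i => (n i).divisors) (fun t => n t.1) (fun t => p t.1 * (ArithmeticFunction.moebius t.2 : ℂ)) a ^ 2 ≤
     R ^ 2 * ∑ a ∈ A, fib I n p a ^ 2 := by
  rw [Finset.mul_sum]
  refine Finset.sum_le_sum fun a ha => ?_
  rw [← mul_pow]
  apply pow_le_pow_left₀ (fib_nonneg _ _ _ _)
  rw [fib, Finset.sum_filter, Finset.sum_sigma, fib, Finset.sum_filter, Finset.mul_sum]
  refine Finset.sum_le_sum fun i _ => ?_
  show ∑ f ∈ (n i).divisors, (if n i = a then ‖p i * (ArithmeticFunction.moebius f : ℂ)‖ else 0) ≤ _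
  split_ifs with h
  · calc _ ≤ ∑ f ∈ (n i).divisors, ‖p i‖ := by
          refine Finset.sum_le_sum fun f _ => ?_
          rw [norm_mul]
          exact mul_le_of_le_one_right (norm_nonneg _) (norm_moeb_le f)
      _ = ((n i).divisors.card : ℝ) * ‖p i‖ := by simp
      _ ≤ _ := by rw [h]; gcongr; exact hR a ha
  · simp

lemma pl_U {ε : ℝ} (hε : 0 < ε) : ∃ C : ℝ, 0 < C ∧ ∀ {ι : Type} (X Λ R : ℝ), 1 ≤ X → 0 ≤ Λ → 0 ≤ R → ∀ (A : Finset ℕ), WB X A Λ →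
    (∀ n ∈ A, (n.divisors.card : ℝ) ≤ R) → (∀ n ∈ A, Odd n) →
    ∀ (I J : Finset ι) (n m : ι → ℕ), (∀ i ∈ I, n i ∈ A) → (∀ j ∈ J, m j ∈ A) →
    ∀ (p q : ι → ℂ) (s s' : ι → ℝ), (∀ i ∈ I, 1 ≤ s i) → (∀ j ∈ J, 1 ≤ s' j) →
    ‖∑ i ∈ I, ∑ j ∈ J, cop (n i) (m j) * (p i * q j) * U (n i * m j) (X / (s i * s' j))‖ ≤
      C * (X ^ ε * (Λ * (R ^ 3 * (∑ a ∈ A, fib I n p a ^ 2 + ∑ a ∈ A, fib J m q a ^ 2)))) := by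
  obtain ⟨C, hC, h⟩ := pl_core hε
  refine ⟨C, hC, ?_⟩
  intro ι X Λ R hX hΛ hR0 A hA hR hAo I J n m hn hm p q s s' hs hs'
  have hX0 : 0 < X := by linarith
  have hA0 : ∀ n ∈ A, n ≠ 0 := fun n hn => by rintro rfl; simpa using hAo 0 hn
  have hsum : HasSum (fun k : SqF => ∑ i ∈ I, ∑ j ∈ J, cop (n i) (m j) * (p i * q j) *
      ((jacobiSym k (n i) : ℂ) * (jacobiSym k (m j) : ℂ) *
        ∑ f ∈ (n i).divisors, ∑ f' ∈ (m j).divisors, (ArithmeticFunction.moebius f : ℂ) * (ArithmeticFunction.moebius f' : ℂ) *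
          (Th ((k * ((f : ℝ) ^ 2 * (f' : ℝ) ^ 2) / (X / (s i * s' j))) ^ 2) : ℂ)))
      (∑ i ∈ I, ∑ j ∈ J, cop (n i) (m j) * (p i * q j) * U (n i * m j) (X / (s i * s' j))) := by
    refine hasSum_sum fun i hi => hasSum_sum fun j hj => ?_
    by_cases hc : (n i).Coprime (m j)
    · have h4 : 0 < s i := by linarith [hs i hi]
      have h5 : 0 < s' j := by linarith [hs' j hj]
      exact (U_expand (n i) (m j) (hA0 _ (hn i hi)) (hA0 _ (hm j hj)) (hAo _ (hn i hi)) (hAo _ (hm j hj)) hc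
        (by positivity)).mul_left _
    · simp only [cop, if_neg hc, zero_mul]
      exact hasSum_zero
  refine le_of_tendsto (hsum.norm : Filter.Tendsto _ _ _) (Filter.Eventually.of_forall fun K => ?_)
  have h1 := h X Λ R hX hΛ hR0 A hA hR hA0 (K.map (Function.Embedding.subtype _)) (fun k hk => by
      obtain ⟨k', _, rfl⟩ := Finset.mem_map.mp hk; exact k'.2)
    (I.sigma fun i => (n i).divisors) (J.sigma fun j => (m j).divisors) (fun t => n t.1) (fun t => m t.1)
    (fun t ht => hn _ (Finset.mem_sigma.mp ht).1) (fun t ht => hm _ (Finset.mem_sigma.mp ht).1)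
    (fun t => p t.1 * (ArithmeticFunction.moebius t.2 : ℂ)) (fun t => q t.1 * (ArithmeticFunction.moebius t.2 : ℂ))
    (fun t => s t.1 * (t.2 : ℝ) ^ 2) (fun t => s' t.1 * (t.2 : ℝ) ^ 2) ?_ ?_
  · have hf : ∑ a ∈ A, fib (I.sigma fun i => (n i).divisors) (fun t => n t.1) (fun t => p t.1 * (ArithmeticFunction.moebius t.2 : ℂ)) a ^ 2 +
        ∑ a ∈ A, fib (J.sigma fun i => (m i).divisors) (fun t => m t.1) (fun t => q t.1 * (ArithmeticFunction.moebius t.2 : ℂ)) a ^ 2 ≤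
        R ^ 2 * (∑ a ∈ A, fib I n p a ^ 2 + ∑ a ∈ A, fib J m q a ^ 2) := by
      rw [mul_add]
      exact add_le_add (fib_sigma hR I n p) (fib_sigma hR J m q)
    have h2 : C * (X ^ ε * (Λ * (R * (∑ a ∈ A, fib (I.sigma fun i => (n i).divisors) (fun t => n t.1) (fun t => p t.1 * (ArithmeticFunction.moebius t.2 : ℂ)) a ^ 2 +
        ∑ a ∈ A, fib (J.sigma fun i => (m i).divisors) (fun t => m t.1) (fun t => q t.1 * (ArithmeticFunction.moebius t.2 : ℂ)) a ^ 2)))) ≤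
        C * (X ^ ε * (Λ * (R * (R ^ 2 * (∑ a ∈ A, fib I n p a ^ 2 + ∑ a ∈ A, fib J m q a ^ 2))))) := by
      gcongr
    refine le_trans (le_of_eq ?_) (h1.trans (h2.trans (le_of_eq (by ring))))
    congr 1
    rw [Finset.sum_map]
    refine Finset.sum_congr rfl fun k _ => ?_
    rw [Finset.sum_sigma]
    refine Finset.sum_congr rfl fun i hi => ?_
    simp_rw [Finset.sum_sigma]
    rw [Finset.sum_comm]
    refine Finset.sum_congr rfl fun j hj => ?_
    rw [Finset.mul_sum, Finset.mul_sum]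
    refine Finset.sum_congr rfl fun f _ => ?_
    rw [Finset.mul_sum, Finset.mul_sum]
    refine Finset.sum_congr rfl fun f' _ => ?_
    have : (k : ℕ) * ((f : ℝ) ^ 2 * (f' : ℝ) ^ 2) / (X / (s i * s' j)) = (k : ℕ) * ((s i * (f : ℝ) ^ 2) * (s' j * (f' : ℝ) ^ 2)) / X := by
      have h4 : 0 < s i := by linarith [hs i hi]
      have h5 : 0 < s' j := by linarith [hs' j hj]
      field_simp
    rw [this]
    simp only [Function.Embedding.subtype_apply]
    ring
  · rintro ⟨i, f⟩ ht
    obtain ⟨hi, hf⟩ := Finset.mem_sigma.mp ht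
    have : (1 : ℝ) ≤ f := by have := Nat.pos_of_mem_divisors hf; exact_mod_cast this
    have := hs i hi
    show 1 ≤ s i * (f : ℝ) ^ 2
    nlinarith
  · rintro ⟨i, f⟩ ht
    obtain ⟨hi, hf⟩ := Finset.mem_sigma.mp ht
    have : (1 : ℝ) ≤ f := by have := Nat.pos_of_mem_divisors hf; exact_mod_cast this
    have := hs' i hi
    show 1 ≤ s' i * (f : ℝ) ^ 2
    nlinarith

/-- odd squarefree numbers up to `N` -/
noncomputable def osf (N : ℝ) : Finset ℕ := (Finset.Icc 1 ⌊N⌋₊).filter fun n => Odd n ∧ Squarefree n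

/-- squarefree numbers up to `N` -/
noncomputable def sqf (N : ℝ) : Finset ℕ := (Finset.Icc 1 ⌊N⌋₊).filter fun n => Squarefree n

lemma mem_osf {N : ℝ} {n : ℕ} : n ∈ osf N ↔ (n : ℝ) ≤ N ∧ Odd n ∧ Squarefree n := by
  simp only [osf, Finset.mem_filter, Finset.mem_Icc]
  constructor
  · rintro ⟨⟨h1, h2⟩, h3⟩
    exact ⟨(Nat.le_floor_iff' (by omega)).mp h2, h3⟩
  · rintro ⟨h1, h2, h3⟩
    have := Nat.pos_of_ne_zero h3.ne_zero
    exact ⟨⟨this, (Nat.le_floor_iff' (by omega)).mpr h1⟩, h2, h3⟩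

lemma mem_sqf {N : ℝ} {n : ℕ} : n ∈ sqf N ↔ (n : ℝ) ≤ N ∧ Squarefree n := by
  simp only [sqf, Finset.mem_filter, Finset.mem_Icc]
  constructor
  · rintro ⟨⟨h1, h2⟩, h3⟩
    exact ⟨(Nat.le_floor_iff' (by omega)).mp h2, h3⟩
  · rintro ⟨h1, h3⟩
    have := Nat.pos_of_ne_zero h3.ne_zero
    exact ⟨⟨this, (Nat.le_floor_iff' (by omega)).mpr h1⟩, h3⟩

/-- the smoothed correlation -/
noncomputable def TT (M : ℝ) (n1 n2 : ℕ) : ℂ :=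
  ∑' k : SqF, (jacobiSym k n1 : ℂ) * (jacobiSym k n2 : ℂ) * (Th ((k / M) ^ 2) : ℂ)

lemma Th_gw {M : ℝ} (hM : 0 < M) (k : SqF) : 0 ≤ Th (((k : ℕ) / M) ^ 2) ∧ Th (((k : ℕ) / M) ^ 2) ≤ gw M (k : ℕ) := by
  have hk : 0 < ((k : ℕ) : ℝ) := by have := Nat.pos_of_ne_zero k.2.ne_zero; exact_mod_cast this
  have := th_bounds (Z := ((k : ℕ) / M) ^ 2) (by positivity)
  refine ⟨this.1, this.2.trans (le_of_eq ?_)⟩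
  unfold gw
  congr 2
  rw [div_pow]; ring

lemma gw_SqF_summable {M : ℝ} (hM : 0 < M) : Summable fun k : SqF => gw M (k : ℕ) :=
  (gw_summable_nat hM).comp_injective Subtype.val_injective

lemma TT_norm_term {M : ℝ} (hM : 0 < M) (n1 n2 : ℕ) (k : SqF) :
    ‖(jacobiSym k n1 : ℂ) * (jacobiSym k n2 : ℂ) * (Th ((k / M) ^ 2) : ℂ)‖ ≤ gw M (k : ℕ) := by
  rw [norm_mul, norm_mul, Complex.norm_real, Real.norm_eq_abs, abs_of_nonneg (Th_gw hM k).1]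
  have h1 := norm_jac_le k n1
  have h2 := norm_jac_le k n2
  have h3 : ‖(jacobiSym k n1 : ℂ)‖ * ‖(jacobiSym k n2 : ℂ)‖ ≤ 1 := mul_le_one₀ h1 (norm_nonneg _) h2
  exact (mul_le_of_le_one_left (Th_gw hM k).1 h3).trans (Th_gw hM k).2

lemma TT_hasSum {M : ℝ} (hM : 0 < M) (n1 n2 : ℕ) :
    HasSum (fun k : SqF => (jacobiSym k n1 : ℂ) * (jacobiSym k n2 : ℂ) * (Th ((k / M) ^ 2) : ℂ)) (TT M n1 n2) :=
  (Summable.of_norm_bounded (gw_SqF_summable hM) (TT_norm_term hM n1 n2)).hasSum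

lemma gw_sum_le {M : ℝ} (hM : 1 ≤ M) : ∑' k : SqF, gw M (k : ℕ) ≤ 6 * M := by
  have hM0 : 0 < M := by linarith
  have h1 : ∑' k : SqF, gw M (k : ℕ) ≤ ∑' n : ℕ, gw M n :=
    Summable.tsum_le_tsum_of_inj (fun k : SqF => (k : ℕ)) Subtype.val_injective (fun _ _ => (gw_pos _ _).le) (fun _ => le_rfl)
      (gw_SqF_summable hM0) (gw_summable_nat hM0)
  refine h1.trans ?_
  set r := Real.exp (-(2 / M)) with hr
  have hr0 : 0 < r := Real.exp_pos _
  have hr1 : r < 1 := by rw [hr, Real.exp_lt_one_iff]; have : 0 < 2 / M := by positivity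
                         linarith
  have hb : ∀ n : ℕ, gw M n ≤ Real.exp 1 * r ^ n := by
    intro n
    rw [hr, ← Real.exp_nat_mul, ← Real.exp_add]
    unfold gw
    apply Real.exp_le_exp.mpr
    have h2 : ((n : ℝ) / M) ^ 2 ≤ Real.pi * (n : ℝ) ^ 2 / M ^ 2 := by
      rw [div_pow, mul_div_assoc]
      have h3 := Real.pi_gt_three
      have : 0 ≤ (n : ℝ) ^ 2 / M ^ 2 := by positivity
      nlinarith
    have h3 : (n : ℝ) * -(2 / M) = -(2 * (n / M)) := by ring
    rw [h3]
    nlinarith [sq_nonneg ((n : ℝ) / M - 1)]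
  have hs : Summable fun n : ℕ => Real.exp 1 * r ^ n := (summable_geometric_of_lt_one hr0.le hr1).mul_left _
  refine (Summable.tsum_le_tsum hb (gw_summable_nat hM0) hs).trans ?_
  rw [tsum_mul_left, tsum_geometric_of_lt_one hr0.le hr1]
  have h4 : r ≤ 1 / (1 + 2 / M) := by
    rw [hr, Real.exp_neg, ← one_div]
    apply one_div_le_one_div_of_le (by positivity)
    have := Real.add_one_le_exp (2 / M)
    linarith
  have h5 : 1 - 1 / (1 + 2 / M) = 2 / (M + 2) := by field_simp; ring
  have h6 : (1 - r)⁻¹ ≤ (M + 2) / 2 := by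
    rw [inv_le_comm₀ (by linarith) (by positivity), inv_div]
    linarith
  have h7 := Real.exp_one_lt_d9
  have h8 : 0 < Real.exp 1 := Real.exp_pos _
  calc Real.exp 1 * (1 - r)⁻¹ ≤ Real.exp 1 * ((M + 2) / 2) := by gcongr
    _ ≤ 4 * ((M + 2) / 2) := by gcongr; linarith
    _ ≤ _ := by linarith

lemma TT_diag {M : ℝ} (hM : 1 ≤ M) (n1 n2 : ℕ) : ‖TT M n1 n2‖ ≤ 6 * M :=
  (tsum_of_norm_bounded (gw_SqF_summable (by linarith)).hasSum (TT_norm_term (by linarith) n1 n2)).trans (gw_sum_le hM)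

/-- lower bound constant -/
noncomputable def cTh : ℝ := (Real.exp (-Real.pi) - Real.exp (-(4 * Real.pi))) / 9

lemma cTh_pos : 0 < cTh := by
  unfold cTh
  have : Real.exp (-(4 * Real.pi)) < Real.exp (-Real.pi) := Real.exp_lt_exp.mpr (by linarith [Real.pi_pos])
  linarith

lemma Th_lower {M : ℝ} (hM : 0 < M) (k : ℕ) (hk0 : 0 < k) (hk : (k : ℝ) ≤ M) : cTh ≤ Th ((k / M) ^ 2) := by
  have hk1 : (1 : ℝ) ≤ k := by exact_mod_cast hk0
  have hs := (th_summable' (Z := ((k : ℝ) / M) ^ 2) (by positivity)).hasSum.tendsto_sum_nat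
  refine ge_of_tendsto hs (Filter.eventually_atTop.mpr ⟨⌈2 * M⌉₊, fun L hL => ?_⟩)
  have h1 : 2 * M ≤ L := (Nat.le_ceil _).trans (by exact_mod_cast hL)
  have h2 : 2 * M ≤ k * ((L : ℝ) + 1) ^ 2 := by nlinarith
  refine (th_trunc_pos hM k hk L h2).trans (le_of_eq ?_)
  refine Finset.sum_congr rfl fun j _ => ?_
  congr 3
  push_cast
  field_simp

lemma step1 {M : ℝ} (hM : 0 < M) (A : Finset ℕ) (b : ℕ → ℂ) :
    cTh * ∑ k ∈ sqf M, ‖Sx A b k‖ ^ 2 ≤ ‖∑ n1 ∈ A, ∑ n2 ∈ A, b n1 * (starRingEnd ℂ (b n2)) * TT M n1 n2‖ := by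
  have hsum : HasSum (fun k : SqF => ∑ n1 ∈ A, ∑ n2 ∈ A, b n1 * (starRingEnd ℂ (b n2)) *
      ((jacobiSym k n1 : ℂ) * (jacobiSym k n2 : ℂ) * (Th ((k / M) ^ 2) : ℂ)))
      (∑ n1 ∈ A, ∑ n2 ∈ A, b n1 * (starRingEnd ℂ (b n2)) * TT M n1 n2) :=
    hasSum_sum fun n1 _ => hasSum_sum fun n2 _ => (TT_hasSum hM n1 n2).mul_left _
  have hterm : ∀ k : SqF, ∑ n1 ∈ A, ∑ n2 ∈ A, b n1 * (starRingEnd ℂ (b n2)) *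
      ((jacobiSym k n1 : ℂ) * (jacobiSym k n2 : ℂ) * (Th ((k / M) ^ 2) : ℂ)) = ((Th (((k : ℕ) / M) ^ 2) * ‖Sx A b k‖ ^ 2 : ℝ) : ℂ) := by
    intro k
    push_cast
    rw [← Complex.mul_conj', Sx, map_sum, Finset.sum_mul_sum, Finset.mul_sum]
    refine Finset.sum_congr rfl fun n1 _ => ?_
    rw [Finset.mul_sum]
    refine Finset.sum_congr rfl fun n2 _ => ?_
    rw [map_mul, map_intCast]
    ring
  simp_rw [hterm] at hsum
  have hre := Complex.hasSum_re hsum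
  simp only [Complex.ofReal_re] at hre
  set Z := ∑ n1 ∈ A, ∑ n2 ∈ A, b n1 * (starRingEnd ℂ (b n2)) * TT M n1 n2
  refine le_trans ?_ (Complex.re_le_norm Z)
  set K : Finset SqF := (sqf M).subtype _ with hK
  refine le_trans ?_ (sum_le_hasSum K (fun k _ => mul_nonneg (Th_gw hM k).1 (by positivity)) hre)
  have : ∑ k ∈ sqf M, ‖Sx A b k‖ ^ 2 = ∑ k ∈ K, ‖Sx A b k‖ ^ 2 := by
    rw [hK, Finset.sum_subtype_of_mem (fun k => ‖Sx A b k‖ ^ 2)]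
    intro k hk; exact (mem_sqf.mp hk).2
  rw [this, Finset.mul_sum]
  refine Finset.sum_le_sum fun k hk => ?_
  gcongr
  rw [hK, Finset.mem_subtype] at hk
  exact Th_lower hM k (Nat.pos_of_ne_zero k.2.ne_zero) (mem_sqf.mp hk).1

/-- cofactors -/
noncomputable def Ag (A : Finset ℕ) (N : ℝ) (g : ℕ) : Finset ℕ := (osf (N / g)).filter fun a => g * a ∈ A

lemma mem_Ag {A : Finset ℕ} {N : ℝ} (hA : A ⊆ osf N) {g a : ℕ} : a ∈ Ag A N g ↔ g * a ∈ A := by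
  simp only [Ag, Finset.mem_filter, mem_osf]
  constructor
  · exact fun h => h.2
  · intro h
    obtain ⟨h1, h2, h3⟩ := mem_osf.mp (hA h)
    have hg : g ≠ 0 := by rintro rfl; simp at h3
    have hgp : 0 < (g : ℝ) := by have := Nat.pos_of_ne_zero hg; exact_mod_cast this
    refine ⟨⟨?_, ?_, ?_⟩, h⟩
    · rw [le_div_iff₀ hgp]; push_cast at h1; linarith
    · exact h2.of_dvd_nat (dvd_mul_left a g)
    · exact h3.squarefree_of_dvd (dvd_mul_left a g)

lemma regroup {A : Finset ℕ} {N : ℝ} (hA : A ⊆ osf N) (F : ℕ → ℕ → ℕ → ℂ) :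
    ∑ n1 ∈ A, ∑ n2 ∈ A, F (n1.gcd n2) (n1 / n1.gcd n2) (n2 / n1.gcd n2) =
      ∑ g ∈ osf N, ∑ a ∈ Ag A N g, ∑ b ∈ Ag A N g, cop a b * F g a b := by
  rw [← Finset.sum_product']
  have hmaps : ∀ t ∈ A ×ˢ A, t.1.gcd t.2 ∈ osf N := by
    intro t ht
    obtain ⟨h1, h2⟩ := Finset.mem_product.mp ht
    obtain ⟨h3, h4, h5⟩ := mem_osf.mp (hA h1)
    rw [mem_osf]
    have hd : t.1.gcd t.2 ∣ t.1 := Nat.gcd_dvd_left _ _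
    refine ⟨le_trans ?_ h3, h4.of_dvd_nat hd, h5.squarefree_of_dvd hd⟩
    exact_mod_cast Nat.le_of_dvd (Nat.pos_of_ne_zero h5.ne_zero) hd
  rw [← Finset.sum_fiberwise_of_maps_to hmaps]
  refine Finset.sum_congr rfl fun g hg => ?_
  have hg0 : 0 < g := Nat.pos_of_ne_zero (mem_osf.mp hg).2.2.ne_zero
  rw [← Finset.sum_product']
  have : ∀ t ∈ Ag A N g ×ˢ Ag A N g, cop t.1 t.2 * F g t.1 t.2 = if t.1.Coprime t.2 then F g t.1 t.2 else 0 := by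
    intro t _
    unfold cop; split_ifs <;> simp
  rw [Finset.sum_congr rfl this, ← Finset.sum_filter]
  symm
  refine Finset.sum_nbij' (fun t => (g * t.1, g * t.2)) (fun t => (t.1 / g, t.2 / g)) ?_ ?_ ?_ ?_ ?_
  · rintro ⟨a, b⟩ h
    simp only [Finset.mem_filter, Finset.mem_product, mem_Ag hA] at h ⊢
    refine ⟨h.1, ?_⟩
    rw [Nat.gcd_mul_left, h.2]; simp
  · rintro ⟨a, b⟩ h
    simp only [Finset.mem_filter, Finset.mem_product, mem_Ag hA] at h ⊢
    have h1 : g ∣ a := h.2 ▸ Nat.gcd_dvd_left a b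
    have h2 : g ∣ b := h.2 ▸ Nat.gcd_dvd_right a b
    rw [Nat.mul_div_cancel' h1, Nat.mul_div_cancel' h2]
    refine ⟨h.1, ?_⟩
    rw [← h.2]
    exact Nat.coprime_div_gcd_div_gcd (by rw [h.2]; exact hg0)
  · rintro ⟨a, b⟩ h
    simp [hg0]
  · rintro ⟨a, b⟩ h
    simp only [Finset.mem_filter, Finset.mem_product] at h
    have h1 : g ∣ a := h.2 ▸ Nat.gcd_dvd_left a b
    have h2 : g ∣ b := h.2 ▸ Nat.gcd_dvd_right a b
    simp [Nat.mul_div_cancel' h1, Nat.mul_div_cancel' h2]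
  · rintro ⟨a, b⟩ h
    simp only [Finset.mem_filter, Finset.mem_product] at h
    have : (g * a).gcd (g * b) = g := by rw [Nat.gcd_mul_left, h.2]; simp
    simp [this, hg0]

lemma fib_I0 {R w : ℝ} (hw : 0 ≤ w) (hR0 : 0 ≤ R) {A G : Finset ℕ} (Y : ℕ) (hGA : G ⊆ A)
    (hR : ∀ a ∈ G, ((Ed a Y).card : ℝ) ≤ R) (p : ℕ → ℂ) (I : Finset (Σ _ : ℕ, ℕ)) (hI : I ⊆ G.sigma fun a => Ed a Y)
    (p' : (Σ _ : ℕ, ℕ) → ℂ) (hp : ∀ t ∈ I, ‖p' t‖ ≤ w * ‖p t.1‖) :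
    ∑ a ∈ A, fib I (fun t => t.1) p' a ^ 2 ≤ R ^ 2 * w ^ 2 * ∑ a ∈ G, ‖p a‖ ^ 2 := by
  have h0 : ∀ a ∈ A, a ∉ G → fib I (fun t => t.1) p' a ^ 2 = 0 := by
    intro a _ ha
    rw [fib, Finset.sum_eq_zero]
    · simp
    · intro t ht
      obtain ⟨h1, h2⟩ := Finset.mem_filter.mp ht
      exact absurd (h2 ▸ (Finset.mem_sigma.mp (hI h1)).1) ha
  rw [← Finset.sum_subset hGA h0, Finset.mul_sum]
  refine Finset.sum_le_sum fun a ha => ?_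
  rw [← mul_pow, ← mul_pow]
  apply pow_le_pow_left₀ (fib_nonneg _ _ _ _)
  calc fib I (fun t => t.1) p' a ≤ ∑ t ∈ I.filter (fun t => t.1 = a), w * ‖p a‖ := by
        refine Finset.sum_le_sum fun t ht => ?_
        obtain ⟨h1, h2⟩ := Finset.mem_filter.mp ht
        rw [← h2]; exact hp t h1
    _ ≤ ∑ t ∈ (G.sigma fun a => Ed a Y).filter (fun t => t.1 = a), w * ‖p a‖ := by
        refine Finset.sum_le_sum_of_subset_of_nonneg (Finset.filter_subset_filter _ hI) (fun _ _ _ => by positivity)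
    _ = ((Ed a Y).card : ℝ) * (w * ‖p a‖) := by
        rw [Finset.sum_filter, Finset.sum_sigma, Finset.sum_eq_single_of_mem a ha]
        · simp
        · intro b _ hb
          simp [hb]
    _ ≤ _ := by rw [mul_assoc]; gcongr; exact hR a ha

lemma recip_sign {a b : ℕ} (ha : Odd a) (hb : Odd b) (hab : a.Coprime b) (h4 : a % 4 = b % 4) :
    ((jacobiSym b a : ℂ) * (jacobiSym a b : ℂ)) = if a % 4 = 1 then 1 else -1 := by
  have h := jacobiSym.quadratic_reciprocity ha hb
  have hb0 : b ≠ 0 := by rintro rfl; simp at hb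
  have ha0 : a ≠ 0 := by rintro rfl; simp at ha
  have h1 : jacobiSym (b : ℤ) a * jacobiSym (b : ℤ) a = 1 := by
    rcases jacobiSym.eq_one_or_neg_one (a := (b : ℤ)) (b := a) (by simpa [Nat.coprime_comm] using hab) with h | h <;> simp [h]
  have h2 : jacobiSym (b : ℤ) a * jacobiSym (a : ℤ) b = (-1) ^ (a / 2 * (b / 2)) := by
    rw [h]; linear_combination (-1 : ℤ) ^ (a / 2 * (b / 2)) * h1
  have h3 : ((jacobiSym b a : ℂ) * (jacobiSym a b : ℂ)) = (-1) ^ (a / 2 * (b / 2)) := by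
    rw [← Int.cast_mul, h2]; push_cast; rfl
  rw [h3]
  split_ifs with hc
  · apply Even.neg_one_pow
    have : Even (a / 2) := by rw [Nat.even_iff]; omega
    exact this.mul_right _
  · apply Odd.neg_one_pow
    obtain ⟨u, hu⟩ := ha
    obtain ⟨v, hv⟩ := hb
    have h5 : Odd (a / 2) := by rw [Nat.odd_iff]; omega
    have h6 : Odd (b / 2) := by rw [Nat.odd_iff]; omega
    exact h5.mul h6

lemma U_dual {a b : ℕ} (ha : Odd a) (hb : Odd b) (has : Squarefree a) (hbs : Squarefree b) (hab : a.Coprime b)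
    (h4 : a % 4 = b % 4) (h1 : 1 < a) {X : ℝ} (hX : 0 < X) :
    U (a * b) X = -((X / (2 * (a * b)) : ℝ) : ℂ) * ((if a % 4 = 1 then 1 else -1) * (GS a 1 * GS b 1)) * U (a * b) (4 * (a * b) / X) := by
  have hb1 : 0 < b := Nat.pos_of_ne_zero hbs.ne_zero
  have hq : Squarefree (a * b) := (Nat.squarefree_mul hab).mpr ⟨has, hbs⟩
  have h41 : (a * b) % 4 = 1 := by
    obtain ⟨u, hu⟩ := ha
    obtain ⟨v, hv⟩ := hb
    rw [Nat.mul_mod, ← h4]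
    have : a % 4 = 1 ∨ a % 4 = 3 := by omega
    rcases this with h | h <;> simp [h]
  have := U_FE (a * b) hq (by nlinarith) h41 hX
  rw [this, GS_mul (by omega) hb1 hab, recip_sign ha hb hab h4]
  push_cast
  ring

lemma bil_prim {ε : ℝ} (hε : 0 < ε) : ∃ C : ℝ, 0 < C ∧ ∀ (M X R Λ P y : ℝ) (Y : ℕ) (A G : Finset ℕ) (p q : ℕ → ℂ),
    1 ≤ X → X ≤ P → 0 < M → 0 < y → 0 ≤ R → 0 ≤ Λ → WB X A Λ → (∀ n ∈ A, (n.divisors.card : ℝ) ≤ R) → (∀ n ∈ A, Odd n) →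
    G ⊆ A → (∀ a ∈ G, ((Ed a Y).card : ℝ) ≤ R) →
    ∀ (I J : Finset (Σ _ : ℕ, ℕ)), I ⊆ (G.sigma fun a => Ed a Y) → J ⊆ (G.sigma fun a => Ed a Y) →
    ((∀ t ∈ I, 1 ≤ X * y / M * (t.2 : ℝ) ^ 2) ∨ (∀ t ∈ J, 1 ≤ X * y / M * (t.2 : ℝ) ^ 2)) →
    ‖∑ i ∈ I, ∑ j ∈ J, cop i.1 j.1 * (p i.1 * q j.1) * U (i.1 * j.1) (M / (y * ((i.2 : ℝ) ^ 2 * (j.2 : ℝ) ^ 2)))‖ ≤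
      C * (P ^ ε * (Λ * (R ^ 5 * (∑ a ∈ G, ‖p a‖ ^ 2 + ∑ a ∈ G, ‖q a‖ ^ 2)))) := by
  obtain ⟨C, hC, h⟩ := pl_U hε
  refine ⟨C, hC, ?_⟩
  intro M X R Λ P y Y A G p q hX hXP hM hy hR0 hΛ hW hR hAo hGA hGR I J hI hJ hor
  have hX0 : 0 < X := by linarith
  have hfp := fib_I0 zero_le_one hR0 Y hGA hGR p I hI (fun t => p t.1) (fun t _ => by simp)
  have hfq := fib_I0 zero_le_one hR0 Y hGA hGR q J hJ (fun t => q t.1) (fun t _ => by simp)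
  have hbig : ∀ t ∈ (G.sigma fun a => Ed a Y), (1 : ℝ) ≤ (t.2 : ℝ) ^ 2 := by
    intro t ht
    have h1 := (mem_Ed.mp (Finset.mem_sigma.mp ht).2).1.1
    have : (1 : ℝ) ≤ t.2 := by exact_mod_cast h1
    nlinarith
  have hmem : ∀ t ∈ (G.sigma fun a => Ed a Y), t.1 ∈ A := fun t ht => hGA (Finset.mem_sigma.mp ht).1
  have hfin : ∀ V : ℝ, V ≤ C * (X ^ ε * (Λ * (R ^ 3 * (∑ a ∈ A, fib I (fun t => t.1) (fun t => p t.1) a ^ 2 + ∑ a ∈ A, fib J (fun t => t.1) (fun t => q t.1) a ^ 2)))) →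
      V ≤ C * (P ^ ε * (Λ * (R ^ 5 * (∑ a ∈ G, ‖p a‖ ^ 2 + ∑ a ∈ G, ‖q a‖ ^ 2)))) := by
    intro V hV
    refine hV.trans ?_
    have hP : X ^ ε ≤ P ^ ε := Real.rpow_le_rpow hX0.le hXP hε.le
    have h5 : R ^ 3 * (∑ a ∈ A, fib I (fun t => t.1) (fun t => p t.1) a ^ 2 + ∑ a ∈ A, fib J (fun t => t.1) (fun t => q t.1) a ^ 2) ≤
       R ^ 5 * (∑ a ∈ G, ‖p a‖ ^ 2 + ∑ a ∈ G, ‖q a‖ ^ 2) := by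
      calc _ ≤ R ^ 3 * (R ^ 2 * 1 ^ 2 * ∑ a ∈ G, ‖p a‖ ^ 2 + R ^ 2 * 1 ^ 2 * ∑ a ∈ G, ‖q a‖ ^ 2) := by gcongr
        _ = _ := by ring
    have hP0 : 0 ≤ P ^ ε := by have : 0 ≤ P := by linarith
                               positivity
    gcongr
  apply hfin
  rcases hor with h1 | h1
  · have := h X Λ R hX hΛ hR0 A hW hR hAo I J (fun t => t.1) (fun t => t.1) (fun t ht => hmem t (hI ht)) (fun t ht => hmem t (hJ ht))
      (fun t => p t.1) (fun t => q t.1) (fun t => X * y / M * (t.2 : ℝ) ^ 2) (fun t => (t.2 : ℝ) ^ 2) h1 (fun t ht => hbig t (hJ ht))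
    refine le_trans (le_of_eq (congrArg norm (Finset.sum_congr rfl fun i hi => Finset.sum_congr rfl fun j hj => ?_))) this
    have h2 := hbig i (hI hi)
    have h3 := hbig j (hJ hj)
    have h4 : (i.2 : ℝ) ≠ 0 := by intro h0; rw [h0] at h2; norm_num at h2
    have h5 : (j.2 : ℝ) ≠ 0 := by intro h0; rw [h0] at h3; norm_num at h3
    have e : M / (y * ((i.2 : ℝ) ^ 2 * (j.2 : ℝ) ^ 2)) = X / (X * y / M * (i.2 : ℝ) ^ 2 * (j.2 : ℝ) ^ 2) := by field_simp
    rw [e]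
  · have := h X Λ R hX hΛ hR0 A hW hR hAo I J (fun t => t.1) (fun t => t.1) (fun t ht => hmem t (hI ht)) (fun t ht => hmem t (hJ ht))
      (fun t => p t.1) (fun t => q t.1) (fun t => (t.2 : ℝ) ^ 2) (fun t => X * y / M * (t.2 : ℝ) ^ 2) (fun t ht => hbig t (hI ht)) h1
    refine le_trans (le_of_eq (congrArg norm (Finset.sum_congr rfl fun i hi => Finset.sum_congr rfl fun j hj => ?_))) this
    have h2 := hbig i (hI hi)
    have h3 := hbig j (hJ hj)
    have h4 : (i.2 : ℝ) ≠ 0 := by intro h0; rw [h0] at h2; norm_num at h2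
    have h5 : (j.2 : ℝ) ≠ 0 := by intro h0; rw [h0] at h3; norm_num at h3
    have e : M / (y * ((i.2 : ℝ) ^ 2 * (j.2 : ℝ) ^ 2)) = X / ((i.2 : ℝ) ^ 2 * (X * y / M * (j.2 : ℝ) ^ 2)) := by field_simp
    rw [e]

lemma GS_norm_div {a : ℕ} (ha : Odd a) (has : Squarefree a) {N1 : ℝ} (hN : 0 < N1) (h : N1 / 2 < a) :
    ‖GS a 1‖ / a ≤ Real.sqrt (2 / N1) := by
  have ha0 : 0 < (a : ℝ) := by have := Nat.pos_of_ne_zero has.ne_zero; exact_mod_cast this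
  apply Real.le_sqrt_of_sq_le
  rw [div_pow, (GS_sqf a has ha).2, pow_two, div_mul_cancel_left₀ ha0.ne', inv_le_comm₀ ha0 (by positivity), inv_div]
  exact h.le

lemma bil_dual {ε : ℝ} (hε : 0 < ε) : ∃ C : ℝ, 0 < C ∧ ∀ (M N1 E0 X R D P y : ℝ) (c Y : ℕ) (A G : Finset ℕ) (p q : ℕ → ℂ),
    1 ≤ X → 4 * N1 ^ 2 * E0 ^ 7 / M ≤ X → X ≤ P → 0 < M → 0 < N1 → 1 ≤ E0 → 1 ≤ y → y ≤ E0 ^ 3 → 0 ≤ R → 0 ≤ D →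
    WB X A (D * N1 / M) → (∀ n ∈ A, (n.divisors.card : ℝ) ≤ R) → (∀ n ∈ A, Odd n) →
    G ⊆ A → (∀ a ∈ G, ((Ed a Y).card : ℝ) ≤ R) → (∀ a ∈ G, Squarefree a ∧ 1 < a ∧ N1 / 2 < a ∧ (a : ℝ) ≤ N1 ∧ a % 4 = c) →
    ∀ (I J : Finset (Σ _ : ℕ, ℕ)), I ⊆ (G.sigma fun a => Ed a Y) → J ⊆ (G.sigma fun a => Ed a Y) →
    (∀ t ∈ I, (t.2 : ℝ) ≤ E0) → (∀ t ∈ J, (t.2 : ℝ) ≤ E0) →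
    ‖∑ i ∈ I, ∑ j ∈ J, cop i.1 j.1 * (p i.1 * q j.1) * U (i.1 * j.1) (M / (y * ((i.2 : ℝ) ^ 2 * (j.2 : ℝ) ^ 2)))‖ ≤
      C * (P ^ ε * (D * (R ^ 5 * (∑ a ∈ G, ‖p a‖ ^ 2 + ∑ a ∈ G, ‖q a‖ ^ 2)))) := by
  obtain ⟨C, hC, h⟩ := pl_U hε
  refine ⟨C, hC, ?_⟩
  intro M N1 E0 X R D P y c Y A G p q hX hX2 hXP hM hN1 hE0 hy hyE hR0 hD hW hR hAo hGA hGR hG I J hI hJ hIE hJE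
  have hX0 : 0 < X := by linarith
  have hE00 : 0 < E0 := by linarith
  have hy0 : 0 < y := by linarith
  have hbig : ∀ t ∈ (G.sigma fun a => Ed a Y), (1 : ℝ) ≤ t.2 := by
    intro t ht
    have h1 := (mem_Ed.mp (Finset.mem_sigma.mp ht).2).1.1
    exact_mod_cast h1
  have hmemG : ∀ t ∈ (G.sigma fun a => Ed a Y), t.1 ∈ G := fun t ht => (Finset.mem_sigma.mp ht).1
  have hmem : ∀ t ∈ (G.sigma fun a => Ed a Y), t.1 ∈ A := fun t ht => hGA (hmemG t ht)
  set w := Real.sqrt (2 / N1) with hw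
  have hw2 : w ^ 2 = 2 / N1 := Real.sq_sqrt (by positivity)
  have hap : ∀ a ∈ G, 0 < (a : ℝ) := fun a ha => by
    have := (hG a ha).2.1; exact_mod_cast (by omega : 0 < a)
  have hgs : ∀ t ∈ (G.sigma fun a => Ed a Y), ‖GS t.1 1 / ((t.1 : ℂ) * (t.2 : ℂ) ^ 2)‖ ≤ w := by
    intro t ht
    have h1 := hmemG t ht
    obtain ⟨g1, g2, g3, g4, g5⟩ := hG _ h1
    have h2 := hbig t ht
    have h3 := GS_norm_div (hAo _ (hGA h1)) g1 hN1 g3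
    rw [norm_div, norm_mul, norm_pow, Complex.norm_natCast, Complex.norm_natCast, ← div_div]
    refine le_trans (div_le_self (by positivity) (by nlinarith)) h3
  set p' : (Σ _ : ℕ, ℕ) → ℂ := fun t => p t.1 * ((if t.1 % 4 = 1 then 1 else -1) * (GS t.1 1 / ((t.1 : ℂ) * (t.2 : ℂ) ^ 2))) with hp'
  set q' : (Σ _ : ℕ, ℕ) → ℂ := fun t => q t.1 * (GS t.1 1 / ((t.1 : ℂ) * (t.2 : ℂ) ^ 2)) with hq'
  have hfp := fib_I0 (Real.sqrt_nonneg (2 / N1)) hR0 Y hGA hGR p I hI p' (fun t ht => by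
    show ‖p t.1 * ((if t.1 % 4 = 1 then 1 else -1) * (GS t.1 1 / ((t.1 : ℂ) * (t.2 : ℂ) ^ 2)))‖ ≤ _
    rw [norm_mul, norm_mul, mul_comm]
    have h1 : ‖(if t.1 % 4 = 1 then (1 : ℂ) else -1)‖ = 1 := by split_ifs <;> simp
    rw [h1, one_mul]
    gcongr
    exact hgs t (hI ht))
  have hfq := fib_I0 (Real.sqrt_nonneg (2 / N1)) hR0 Y hGA hGR q J hJ q' (fun t ht => by
    show ‖q t.1 * (GS t.1 1 / ((t.1 : ℂ) * (t.2 : ℂ) ^ 2))‖ ≤ _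
    rw [norm_mul, mul_comm]
    gcongr
    exact hgs t (hJ ht))
  rw [← hw, hw2] at hfp hfq
  have hmain := h X (D * N1 / M) R hX (by positivity) hR0 A hW hR hAo I J (fun t => t.1) (fun t => t.1)
    (fun t ht => hmem t (hI ht)) (fun t ht => hmem t (hJ ht)) p' q'
    (fun t => X * M / (4 * N1 ^ 2 * E0 ^ 7) * (E0 ^ 3 / y) * (N1 / t.1) * (E0 ^ 2 / (t.2 : ℝ) ^ 2))
    (fun t => (N1 / t.1) * (E0 ^ 2 / (t.2 : ℝ) ^ 2)) ?_ ?_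
  · have heq : ∑ i ∈ I, ∑ j ∈ J, cop i.1 j.1 * (p i.1 * q j.1) * U (i.1 * j.1) (M / (y * ((i.2 : ℝ) ^ 2 * (j.2 : ℝ) ^ 2))) =
        -((M / (2 * y) : ℝ) : ℂ) * ∑ i ∈ I, ∑ j ∈ J, cop i.1 j.1 * (p' i * q' j) * U (i.1 * j.1) (X /
          ((X * M / (4 * N1 ^ 2 * E0 ^ 7) * (E0 ^ 3 / y) * (N1 / i.1) * (E0 ^ 2 / (i.2 : ℝ) ^ 2)) *
            ((N1 / j.1) * (E0 ^ 2 / (j.2 : ℝ) ^ 2)))) := by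
      rw [Finset.mul_sum]
      refine Finset.sum_congr rfl fun i hi => ?_
      rw [Finset.mul_sum]
      refine Finset.sum_congr rfl fun j hj => ?_
      by_cases hc : i.1.Coprime j.1
      · obtain ⟨g1, g2, g3, g4, g5⟩ := hG _ (hmemG i (hI hi))
        obtain ⟨k1, k2, k3, k4, k5⟩ := hG _ (hmemG j (hJ hj))
        have i0 : 0 < (i.1 : ℝ) := hap _ (hmemG i (hI hi))
        have j0 : 0 < (j.1 : ℝ) := hap _ (hmemG j (hJ hj))
        have i2 : 0 < (i.2 : ℝ) := by linarith [hbig i (hI hi)]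
        have j2 : 0 < (j.2 : ℝ) := by linarith [hbig j (hJ hj)]
        rw [U_dual (hAo _ (hmem i (hI hi))) (hAo _ (hmem j (hJ hj))) g1 k1 hc (by rw [g5, k5]) g2 (by positivity)]
        have e1 : 4 * ((i.1 : ℝ) * j.1) / (M / (y * ((i.2 : ℝ) ^ 2 * (j.2 : ℝ) ^ 2))) = (X /
          ((X * M / (4 * N1 ^ 2 * E0 ^ 7) * (E0 ^ 3 / y) * (N1 / i.1) * (E0 ^ 2 / (i.2 : ℝ) ^ 2)) *
            ((N1 / j.1) * (E0 ^ 2 / (j.2 : ℝ) ^ 2)))) := by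
          field_simp
        rw [e1]
        set W := U (i.1 * j.1) _
        simp only [hp', hq']
        have i0' : (i.1 : ℂ) ≠ 0 := by exact_mod_cast i0.ne'
        have j0' : (j.1 : ℂ) ≠ 0 := by exact_mod_cast j0.ne'
        have i2' : (i.2 : ℂ) ≠ 0 := by exact_mod_cast i2.ne'
        have j2' : (j.2 : ℂ) ≠ 0 := by exact_mod_cast j2.ne'
        have y' : (y : ℂ) ≠ 0 := by exact_mod_cast hy0.ne'
        push_cast
        field_simp
      · simp [cop, hc]
    rw [heq, norm_mul, norm_neg, Complex.norm_real, Real.norm_eq_abs, abs_of_pos (by positivity)]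
    have hP : X ^ ε ≤ P ^ ε := Real.rpow_le_rpow hX0.le hXP hε.le
    have hP0 : 0 ≤ P ^ ε := by have : 0 ≤ P := by linarith
                               positivity
    have hyM : M / (2 * y) ≤ M / 2 := by gcongr; linarith
    calc _ ≤ M / 2 * (C * (X ^ ε * (D * N1 / M * (R ^ 3 * (∑ a ∈ A, fib I (fun t => t.1) p' a ^ 2 + ∑ a ∈ A, fib J (fun t => t.1) q' a ^ 2))))) := by
          gcongr
      _ ≤ M / 2 * (C * (P ^ ε * (D * N1 / M * (R ^ 3 * (R ^ 2 * (2 / N1) * ∑ a ∈ G, ‖p a‖ ^ 2 + R ^ 2 * (2 / N1) * ∑ a ∈ G, ‖q a‖ ^ 2))))) := by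
          gcongr
      _ = _ := by field_simp
  · intro t ht
    have h1 := hbig t (hI ht)
    have h2 := hIE t ht
    have i0 : 0 < (t.1 : ℝ) := hap _ (hmemG t (hI ht))
    have a1 : 1 ≤ X * M / (4 * N1 ^ 2 * E0 ^ 7) := by
      rw [le_div_iff₀ (by positivity), one_mul]
      rwa [div_le_iff₀ hM] at hX2
    have a2 : 1 ≤ E0 ^ 3 / y := by rwa [le_div_iff₀ hy0, one_mul]
    have a3 : 1 ≤ N1 / t.1 := by rw [le_div_iff₀ i0, one_mul]; exact (hG _ (hmemG t (hI ht))).2.2.2.1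
    have a4 : 1 ≤ E0 ^ 2 / (t.2 : ℝ) ^ 2 := by rw [le_div_iff₀ (by positivity), one_mul]; gcongr
    exact one_le_mul_of_one_le_of_one_le (one_le_mul_of_one_le_of_one_le (one_le_mul_of_one_le_of_one_le a1 a2) a3) a4
  · intro t ht
    have h1 := hbig t (hJ ht)
    have h2 := hJE t ht
    have i0 : 0 < (t.1 : ℝ) := hap _ (hmemG t (hJ ht))
    have a3 : 1 ≤ N1 / t.1 := by rw [le_div_iff₀ i0, one_mul]; exact (hG _ (hmemG t (hJ ht))).2.2.2.1
    have a4 : 1 ≤ E0 ^ 2 / (t.2 : ℝ) ^ 2 := by rw [le_div_iff₀ (by positivity), one_mul]; gcongr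
    exact one_le_mul_of_one_le_of_one_le a3 a4

lemma bil {ε : ℝ} (hε : 0 < ε) : ∃ C : ℝ, 0 < C ∧ ∀ (M N1 E0 E R Λ D P y : ℝ) (c Y : ℕ) (Ap Ad G : Finset ℕ) (p q : ℕ → ℂ),
    1 ≤ M → 0 < N1 → 1 ≤ E0 → 1 ≤ E → 0 ≤ R → 0 ≤ Λ → 0 ≤ D → M ≤ P → 4 * N1 ^ 2 * E0 ^ 7 ≤ P → 1 ≤ y → (y ≤ E → y ≤ E0) →
    WB (max 1 (M / E)) Ap Λ → WB (max 1 (4 * N1 ^ 2 * E0 ^ 7 / M)) Ad (D * N1 / M) →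
    (∀ n ∈ Ap, (n.divisors.card : ℝ) ≤ R) → (∀ n ∈ Ap, Odd n) → (∀ n ∈ Ad, (n.divisors.card : ℝ) ≤ R) → (∀ n ∈ Ad, Odd n) →
    G ⊆ Ap → G ⊆ Ad → (∀ a ∈ G, ((Ed a Y).card : ℝ) ≤ R) →
    (∀ a ∈ G, Squarefree a ∧ 1 < a ∧ N1 / 2 < a ∧ (a : ℝ) ≤ N1 ∧ a % 4 = c) →
    (∀ a ∈ G, ∀ e ∈ Ed a Y, (e : ℝ) ≤ E → (e : ℝ) ≤ E0) →
    ‖∑ i ∈ G.sigma (fun a => Ed a Y), ∑ j ∈ G.sigma (fun a => Ed a Y),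
      cop i.1 j.1 * (p i.1 * q j.1) * U (i.1 * j.1) (M / (y * ((i.2 : ℝ) ^ 2 * (j.2 : ℝ) ^ 2)))‖ ≤
      C * (P ^ ε * ((Λ + D) * (R ^ 5 * (∑ a ∈ G, ‖p a‖ ^ 2 + ∑ a ∈ G, ‖q a‖ ^ 2)))) := by
  obtain ⟨C1, hC1, h1⟩ := bil_prim hε
  obtain ⟨C2, hC2, h2⟩ := bil_dual hε
  refine ⟨2 * C1 + C2, by positivity, ?_⟩
  intro M N1 E0 E R Λ D P y c Y Ap Ad G p q hM hN1 hE0 hE hR hΛ hD hMP hNP hy hyE hWp hWd hRp hop hRd hod hGp hGd hGR hG hsm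
  set I0 := G.sigma (fun a => Ed a Y) with hI0
  set S := ∑ a ∈ G, ‖p a‖ ^ 2 + ∑ a ∈ G, ‖q a‖ ^ 2 with hS
  have hS0 : 0 ≤ S := by positivity
  have hP0 : 0 < P := by linarith
  have hPe : 0 < P ^ ε := by positivity
  have hMp : 0 < M := by linarith
  set X := max 1 (M / E) with hX
  have hX1 : 1 ≤ X := le_max_left _ _
  have hXE : 1 / E ≤ X / M := by
    rw [div_le_div_iff₀ (by linarith) hMp, one_mul]
    have : M / E ≤ X := le_max_right _ _
    rwa [div_le_iff₀ (by linarith)] at this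
  have hXP : X ≤ P := max_le (by linarith) ((div_le_self hMp.le hE).trans hMP)
  set Z := max 1 (4 * N1 ^ 2 * E0 ^ 7 / M) with hZ
  have hZP : Z ≤ P := max_le (by linarith) ((div_le_self (by positivity) hM).trans hNP)
  set f : (Σ _ : ℕ, ℕ) → (Σ _ : ℕ, ℕ) → ℂ := fun i j => cop i.1 j.1 * (p i.1 * q j.1) * U (i.1 * j.1) (M / (y * ((i.2 : ℝ) ^ 2 * (j.2 : ℝ) ^ 2))) with hf
  have hbig : ∀ t ∈ I0, (1 : ℝ) ≤ t.2 := by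
    intro t ht
    have h1 := (mem_Ed.mp (Finset.mem_sigma.mp ht).2).1.1
    exact_mod_cast h1
  have prim : ∀ I J : Finset (Σ _ : ℕ, ℕ), I ⊆ I0 → J ⊆ I0 → ((∀ t ∈ I, E ≤ y * (t.2 : ℝ) ^ 2) ∨ (∀ t ∈ J, E ≤ y * (t.2 : ℝ) ^ 2)) →
      ‖∑ i ∈ I, ∑ j ∈ J, f i j‖ ≤ C1 * (P ^ ε * (Λ * (R ^ 5 * S))) := by
    intro I J hI hJ hor
    have key : ∀ t : (Σ _ : ℕ, ℕ), E ≤ y * (t.2 : ℝ) ^ 2 → 1 ≤ X * y / M * (t.2 : ℝ) ^ 2 := by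
      intro t ht
      calc (1 : ℝ) = 1 / E * E := by field_simp
        _ ≤ X / M * (y * (t.2 : ℝ) ^ 2) := by gcongr
        _ = _ := by ring
    exact h1 M X R Λ P y Y Ap G p q hX1 hXP hMp (by linarith) hR hΛ hWp hRp hop hGp hGR I J hI hJ
      (hor.imp (fun h t ht => key t (h t ht)) (fun h t ht => key t (h t ht)))
  have hΛt : P ^ ε * (Λ * (R ^ 5 * S)) ≤ P ^ ε * ((Λ + D) * (R ^ 5 * S)) := by gcongr; linarith
  have hDt : P ^ ε * (D * (R ^ 5 * S)) ≤ P ^ ε * ((Λ + D) * (R ^ 5 * S)) := by gcongr; linarith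
  have hT0 : 0 ≤ P ^ ε * ((Λ + D) * (R ^ 5 * S)) := by positivity
  show ‖∑ i ∈ I0, ∑ j ∈ I0, f i j‖ ≤ _
  rcases lt_or_ge E y with hEy | hEy
  · refine (prim I0 I0 (le_refl _) (le_refl _) (Or.inl fun t ht => ?_)).trans ?_
    · have := hbig t ht
      nlinarith [mul_le_mul this this zero_le_one (by linarith)]
    · nlinarith
  · set B := I0.filter (fun t => E < (t.2 : ℝ)) with hB
    set L := I0.filter (fun t => ¬ (E < (t.2 : ℝ))) with hL
    have hsplit : ∑ i ∈ I0, ∑ j ∈ I0, f i j = ∑ i ∈ B, ∑ j ∈ I0, f i j + ∑ i ∈ L, ∑ j ∈ B, f i j + ∑ i ∈ L, ∑ j ∈ L, f i j := by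
      rw [add_assoc, ← Finset.sum_add_distrib]
      rw [← Finset.sum_filter_add_sum_filter_not I0 (fun t => E < (t.2 : ℝ)) (fun i => ∑ j ∈ I0, f i j)]
      congr 1
      refine Finset.sum_congr rfl fun i _ => ?_
      rw [← Finset.sum_filter_add_sum_filter_not I0 (fun t => E < (t.2 : ℝ)) (fun j => f i j)]
    have hBb : ∀ t ∈ B, E ≤ y * (t.2 : ℝ) ^ 2 := by
      intro t ht
      have := (Finset.mem_filter.mp ht).2
      nlinarith [mul_le_mul hy (by nlinarith : (t.2 : ℝ) ≤ (t.2 : ℝ) ^ 2) (by positivity) (by linarith)]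
    have hLb : ∀ t ∈ L, (t.2 : ℝ) ≤ E0 := by
      intro t ht
      obtain ⟨a1, a2⟩ := Finset.mem_filter.mp ht
      obtain ⟨b1, b2⟩ := Finset.mem_sigma.mp a1
      exact hsm _ b1 _ b2 (not_lt.mp a2)
    have hBI : B ⊆ I0 := Finset.filter_subset _ _
    have hLI : L ⊆ I0 := Finset.filter_subset _ _
    have t1 := prim B I0 hBI (le_refl _) (Or.inl hBb)
    have t2 := prim L B hLI hBI (Or.inr hBb)
    have t3 := h2 M N1 E0 Z R D P y c Y Ad G p q (le_max_left _ _) (le_max_right _ _) hZP hMp hN1 hE0 hy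
      ((hyE hEy).trans (le_self_pow₀ hE0 (by norm_num))) hR hD hWd hRd hod hGd hGR hG L L hLI hLI hLb hLb
    change ‖∑ i ∈ L, ∑ j ∈ L, f i j‖ ≤ _ at t3
    rw [hsplit]
    refine (norm_add₃_le).trans ?_
    nlinarith

/-- the main term in the decomposition of `TT` -/
noncomputable def TD (M : ℝ) (Y g a b : ℕ) : ℂ :=
  ∑ eg ∈ Ed g Y, ∑ ea ∈ Ed a Y, ∑ eb ∈ Ed b Y, ∑ d ∈ g.divisors,
        (ArithmeticFunction.moebius d : ℂ) * ((jacobiSym d a : ℂ) * (jacobiSym d b : ℂ) *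
          U (a * b) (M / (d * ((eg : ℝ) ^ 2 * (ea : ℝ) ^ 2 * (eb : ℝ) ^ 2))))

lemma osf_mono {N N' : ℝ} (h : N ≤ N') : osf N ⊆ osf N' := by
  intro n hn
  rw [mem_osf] at hn ⊢
  exact ⟨hn.1.trans h, hn.2⟩

lemma sqf_mono {N N' : ℝ} (h : N ≤ N') : sqf N ⊆ sqf N' := by
  intro n hn
  rw [mem_sqf] at hn ⊢
  exact ⟨hn.1.trans h, hn.2⟩

lemma sum_Ag_le {A : Finset ℕ} {N R : ℝ} (hA : A ⊆ osf N) (hR : ∀ n ∈ A, (n.divisors.card : ℝ) ≤ R) (f : ℕ → ℝ) (hf : ∀ n, 0 ≤ f n) :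
    ∑ g ∈ osf N, ∑ a ∈ Ag A N g, f (g * a) ≤ R * ∑ n ∈ A, f n := by
  calc ∑ g ∈ osf N, ∑ a ∈ Ag A N g, f (g * a) ≤ ∑ g ∈ osf N, ∑ n ∈ A, if g ∣ n then f n else 0 := by
        refine Finset.sum_le_sum fun g hg => ?_
        have hg0 : 0 < g := Nat.pos_of_ne_zero (mem_osf.mp hg).2.2.ne_zero
        rw [← Finset.sum_filter]
        rw [← Finset.sum_image (s := Ag A N g) (g := fun a => g * a) (f := f) (fun a _ b _ h => Nat.eq_of_mul_eq_mul_left hg0 h)]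
        refine Finset.sum_le_sum_of_subset_of_nonneg ?_ (fun _ _ _ => hf _)
        intro n hn
        obtain ⟨a, ha, rfl⟩ := Finset.mem_image.mp hn
        exact Finset.mem_filter.mpr ⟨(mem_Ag hA).mp ha, Nat.dvd_mul_right _ _⟩
    _ = ∑ n ∈ A, ((osf N).filter (fun g => g ∣ n)).card * f n := by
        rw [Finset.sum_comm]
        refine Finset.sum_congr rfl fun n _ => ?_
        rw [← Finset.sum_filter, Finset.sum_const, nsmul_eq_mul]
    _ ≤ ∑ n ∈ A, R * f n := by
        refine Finset.sum_le_sum fun n hn => ?_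
        refine mul_le_mul_of_nonneg_right (le_trans ?_ (hR n hn)) (hf n)
        have hn0 := (mem_osf.mp (hA hn)).2.2.ne_zero
        exact_mod_cast Finset.card_le_card (fun g hg => Nat.mem_divisors.mpr ⟨(Finset.mem_filter.mp hg).2, hn0⟩)
    _ = _ := by rw [Finset.mul_sum]

lemma TD_rearr (M : ℝ) (Y g : ℕ) (G : Finset ℕ) (p q : ℕ → ℂ) :
    ∑ a ∈ G, ∑ b ∈ G, cop a b * (p a * q b * TD M Y g a b) =
    ∑ eg ∈ Ed g Y, ∑ d ∈ g.divisors, (ArithmeticFunction.moebius d : ℂ) *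
      ∑ i ∈ G.sigma (fun a => Ed a Y), ∑ j ∈ G.sigma (fun a => Ed a Y),
      cop i.1 j.1 * ((p i.1 * (jacobiSym d i.1 : ℂ)) * (q j.1 * (jacobiSym d j.1 : ℂ))) *
        U (i.1 * j.1) (M / ((d * (eg : ℝ) ^ 2) * ((i.2 : ℝ) ^ 2 * (j.2 : ℝ) ^ 2))) := by
  have h1 : ∀ a b, cop a b * (p a * q b * TD M Y g a b) = ∑ eg ∈ Ed g Y, ∑ d ∈ g.divisors, ∑ ea ∈ Ed a Y, ∑ eb ∈ Ed b Y,
      (ArithmeticFunction.moebius d : ℂ) * (cop a b * ((p a * (jacobiSym d a : ℂ)) * (q b * (jacobiSym d b : ℂ))) *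
        U (a * b) (M / ((d * (eg : ℝ) ^ 2) * ((ea : ℝ) ^ 2 * (eb : ℝ) ^ 2)))) := by
    intro a b
    rw [TD, Finset.mul_sum, Finset.mul_sum]
    refine Finset.sum_congr rfl fun eg _ => ?_
    have : ∀ ea : ℕ, ∑ eb ∈ Ed b Y, ∑ d ∈ g.divisors,
        (ArithmeticFunction.moebius d : ℂ) * ((jacobiSym d a : ℂ) * (jacobiSym d b : ℂ) *
          U (a * b) (M / (d * ((eg : ℝ) ^ 2 * (ea : ℝ) ^ 2 * (eb : ℝ) ^ 2)))) = ∑ d ∈ g.divisors, ∑ eb ∈ Ed b Y,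
        (ArithmeticFunction.moebius d : ℂ) * ((jacobiSym d a : ℂ) * (jacobiSym d b : ℂ) *
          U (a * b) (M / (d * ((eg : ℝ) ^ 2 * (ea : ℝ) ^ 2 * (eb : ℝ) ^ 2)))) := fun ea => Finset.sum_comm
    rw [Finset.sum_congr rfl fun ea _ => this ea, Finset.sum_comm, Finset.mul_sum, Finset.mul_sum]
    refine Finset.sum_congr rfl fun d _ => ?_
    rw [Finset.mul_sum, Finset.mul_sum]
    refine Finset.sum_congr rfl fun ea _ => ?_
    rw [Finset.mul_sum, Finset.mul_sum]
    refine Finset.sum_congr rfl fun eb _ => ?_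
    have e : (d : ℝ) * ((eg : ℝ) ^ 2 * (ea : ℝ) ^ 2 * (eb : ℝ) ^ 2) = (d * (eg : ℝ) ^ 2) * ((ea : ℝ) ^ 2 * (eb : ℝ) ^ 2) := by ring
    rw [e]
    ring
  rw [Finset.sum_congr rfl fun a _ => Finset.sum_congr rfl fun b _ => h1 a b]
  rw [Finset.sum_congr rfl fun a _ => Finset.sum_comm (s := G)]
  rw [Finset.sum_comm]
  refine Finset.sum_congr rfl fun eg _ => ?_
  rw [Finset.sum_congr rfl fun a _ => Finset.sum_comm (s := G)]
  rw [Finset.sum_comm]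
  refine Finset.sum_congr rfl fun d _ => ?_
  rw [Finset.mul_sum, Finset.sum_sigma]
  refine Finset.sum_congr rfl fun a _ => ?_
  rw [Finset.sum_comm]
  refine Finset.sum_congr rfl fun ea _ => ?_
  rw [Finset.sum_sigma, Finset.mul_sum]
  refine Finset.sum_congr rfl fun b _ => ?_
  rw [Finset.mul_sum]

lemma cauchy_card (A : Finset ℕ) {N : ℝ} (hN : 0 ≤ N) (hA : A ⊆ osf N) (f : ℕ → ℝ) : (∑ n ∈ A, f n) ^ 2 ≤ N * ∑ n ∈ A, f n ^ 2 := by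
  have h1 := sq_sum_le_card_mul_sum_sq (s := A) (f := f)
  refine h1.trans ?_
  have h2 : (A.card : ℝ) ≤ N := by
    have h3 : A ⊆ Finset.Icc 1 ⌊N⌋₊ := fun n hn => (Finset.mem_filter.mp (hA hn)).1
    have h4 := Finset.card_le_card h3
    rw [Nat.card_Icc, Nat.add_sub_cancel] at h4
    exact (Nat.cast_le.mpr h4).trans (Nat.floor_le hN)
  have : 0 ≤ ∑ n ∈ A, f n ^ 2 := Finset.sum_nonneg fun _ _ => sq_nonneg _
  gcongr

lemma main_dy {ε : ℝ} (hε : 0 < ε) : ∃ C : ℝ, 0 < C ∧ ∀ (M N E0 E R Λ D P : ℝ) (c Y : ℕ) (A : Finset ℕ),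
    1 ≤ M → 1 ≤ N → 1 ≤ E0 → 1 ≤ E → 0 ≤ R → 0 ≤ Λ → 0 ≤ D → M ≤ P → 4 * N ^ 2 * E0 ^ 7 ≤ P → M ≤ Y → A ⊆ osf N →
    (∀ n ∈ A, N / 2 < n ∧ n % 4 = c) →
    (∀ n ∈ A, ∀ e : ℕ, 1 ≤ e → e.primeFactors ⊆ n.primeFactors → (e : ℝ) ≤ E → (e : ℝ) ≤ E0) →
    (∀ n ∈ osf N, (n.divisors.card : ℝ) ≤ R ∧ ((Ed n Y).card : ℝ) ≤ R) →
    WB (max 1 (M / E)) (osf N) Λ →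
    (∀ g : ℕ, 1 ≤ g → (g : ℝ) ≤ N → WB (max 1 (4 * (N / g) ^ 2 * E0 ^ 7 / M)) (osf (N / g)) (D * (N / g) / M)) →
    ∀ b : ℕ → ℂ, ∑ k ∈ sqf M, ‖Sx A b k‖ ^ 2 ≤ C * (M + N + P ^ ε * (R ^ 8 * (Λ + D))) * ∑ n ∈ A, ‖b n‖ ^ 2 := by
  obtain ⟨C1, hC1, h1⟩ := bil hε
  obtain ⟨C0, hC0, h0⟩ := T_dec
  refine ⟨(6 + C0 + 2 * C1) / cTh, by have := cTh_pos; positivity, ?_⟩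
  intro M N E0 E R Λ D P c Y A hM hN hE0 hE hR hΛ hD hMP hNP hMY hA hAd hsm hRR hWp hWd b
  have hs1 := step1 (by linarith : 0 < M) A b
  set B := ∑ n ∈ A, ‖b n‖ ^ 2 with hB
  have hB0 : 0 ≤ B := by positivity
  have hM0 : 0 < M := by linarith
  have hP0 : 0 < P := by linarith
  have hPe : 0 < P ^ ε := by positivity
  set Td : ℕ → ℕ → ℕ → ℂ := fun g u v => if (g : ℝ) ≤ N / 2 then TD M Y g u v else 0 with hTd
  have hpos : ∀ n ∈ A, 0 < n := fun n hn => Nat.pos_of_ne_zero (mem_osf.mp (hA hn)).2.2.ne_zero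
  have hfac : ∀ g u : ℕ, g * u ∈ A → (g * u : ℝ) ≤ N ∧ Odd g ∧ Odd u ∧ g.Coprime u ∧ Squarefree u ∧ Squarefree g ∧ N / 2 < g * u ∧ 0 < g ∧ 0 < u := by
    intro g u hgu
    have h := mem_osf.mp (hA hgu)
    have hd := (hAd _ hgu).1
    push_cast at h hd
    have ho := Nat.odd_mul.mp h.2.1
    have hc := (Nat.squarefree_mul_iff.mp h.2.2)
    exact ⟨h.1, ho.1, ho.2, hc.1, hc.2.2, hc.2.1, hd, ho.1.pos, ho.2.pos⟩
  -- error term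
  have herr : ∀ n1 ∈ A, ∀ n2 ∈ A, ‖TT M n1 n2 - Td (n1.gcd n2) (n1 / n1.gcd n2) (n2 / n1.gcd n2)‖ ≤ C0 + if n1 = n2 then 6 * M else 0 := by
    intro n1 hn1 n2 hn2
    have hg0 : 0 < n1.gcd n2 := Nat.gcd_pos_of_pos_left _ (hpos _ hn1)
    have hcop := Nat.coprime_div_gcd_div_gcd hg0
    have e1 := Nat.mul_div_cancel' (Nat.gcd_dvd_left n1 n2)
    have e2 := Nat.mul_div_cancel' (Nat.gcd_dvd_right n1 n2)
    set g := n1.gcd n2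
    set u := n1 / g
    set v := n2 / g
    have f1 := hfac g u (by rw [e1]; exact hn1)
    have f2 := hfac g v (by rw [e2]; exact hn2)
    by_cases hg : (g : ℝ) ≤ N / 2
    · simp only [hTd, hg, if_true]
      have := h0 g u v Y M f1.2.1 f1.2.2.1 f2.2.2.1 f1.2.2.2.1 f2.2.2.2.1 hcop hM hMY
      rw [e1, e2] at this
      refine le_trans this ?_
      split_ifs <;> linarith
    · simp only [hTd, hg, if_false, sub_zero]
      have hone : ∀ w : ℕ, (g * w : ℝ) ≤ N → 0 < w → w = 1 := by
        intro w hw hw0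
        by_contra h
        have : (2 : ℝ) ≤ w := by exact_mod_cast (by omega : 2 ≤ w)
        nlinarith
      have hu := hone u f1.1 f1.2.2.2.2.2.2.2.2
      have hv := hone v f2.1 f2.2.2.2.2.2.2.2.2
      have : n1 = n2 := by rw [← e1, ← e2, hu, hv]
      rw [if_pos this]
      linarith [TT_diag hM n1 n2]
  -- main term
  have hg : ∀ g ∈ osf N, ‖∑ u ∈ Ag A N g, ∑ v ∈ Ag A N g, cop u v * ((b (g * u)) * (starRingEnd ℂ (b (g * v))) * Td g u v)‖ ≤
      R * (R * (C1 * (P ^ ε * ((Λ + D) * (R ^ 5 * (2 * ∑ a ∈ Ag A N g, ‖b (g * a)‖ ^ 2)))))) := by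
    intro g hgm
    have hg1 : 1 ≤ g := Nat.pos_of_ne_zero (mem_osf.mp hgm).2.2.ne_zero
    have hgr : (1 : ℝ) ≤ g := by exact_mod_cast hg1
    by_cases hg : (g : ℝ) ≤ N / 2
    swap
    · simp only [hTd, hg, if_false, mul_zero, Finset.sum_const_zero, norm_zero]
      positivity
    simp only [hTd, hg, if_true]
    rw [TD_rearr M Y g (Ag A N g) (fun u => b (g * u)) (fun v => starRingEnd ℂ (b (g * v)))]
    refine (norm_sum_le _ _).trans ?_
    have hterm : ∀ eg ∈ Ed g Y, ∀ d ∈ g.divisors, ‖(ArithmeticFunction.moebius d : ℂ) *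
      ∑ i ∈ (Ag A N g).sigma (fun a => Ed a Y), ∑ j ∈ (Ag A N g).sigma (fun a => Ed a Y),
      cop i.1 j.1 * ((b (g * i.1) * (jacobiSym d i.1 : ℂ)) * (starRingEnd ℂ (b (g * j.1)) * (jacobiSym d j.1 : ℂ))) *
        U (i.1 * j.1) (M / ((d * (eg : ℝ) ^ 2) * ((i.2 : ℝ) ^ 2 * (j.2 : ℝ) ^ 2)))‖ ≤
        C1 * (P ^ ε * ((Λ + D) * (R ^ 5 * (2 * ∑ a ∈ Ag A N g, ‖b (g * a)‖ ^ 2)))) := by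
      intro eg heg d hd
      rcases (Ag A N g).eq_empty_or_nonempty with hemp | ⟨a0, ha0⟩
      · have he : (∅ : Finset ℕ).sigma (fun a => Ed a Y) = ∅ := rfl
        rw [hemp, he, Finset.sum_empty, Finset.sum_empty, mul_zero, norm_zero]
        simp
      have hd0 : 0 < d := Nat.pos_of_mem_divisors hd
      obtain ⟨⟨heg1, hegY⟩, hegp⟩ := mem_Ed.mp heg
      have hy1 : (1 : ℝ) ≤ (d : ℝ) * (eg : ℝ) ^ 2 := by
        exact_mod_cast (Nat.mul_pos hd0 (by positivity) : 0 < d * eg ^ 2)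
      have ha0' := (mem_Ag hA).mp ha0
      have hyE : (d : ℝ) * (eg : ℝ) ^ 2 ≤ E → (d : ℝ) * (eg : ℝ) ^ 2 ≤ E0 := by
        intro h
        have := hsm _ ha0' (d * eg ^ 2) (Nat.mul_pos hd0 (by positivity)) ?_ (by push_cast; exact h)
        · push_cast at this; exact this
        · have hz := (hpos _ ha0').ne'
          rw [Nat.primeFactors_mul hd0.ne' (by positivity), Nat.primeFactors_pow _ (by norm_num)]
          have hgp : g.primeFactors ⊆ (g * a0).primeFactors := Nat.primeFactors_mono (Nat.dvd_mul_right _ _) hz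
          refine Finset.union_subset ?_ (hegp.trans hgp)
          exact (Nat.primeFactors_mono (Nat.dvd_of_mem_divisors hd) (by omega)).trans hgp
      have hNg : N / g ≤ N := div_le_self (by linarith) hgr
      have hGd : Ag A N g ⊆ osf (N / g) := Finset.filter_subset _ _
      have hbil := h1 M (N / g) E0 E R Λ D P (d * (eg : ℝ) ^ 2) ((g * c) % 4) Y (osf N) (osf (N / g)) (Ag A N g)
        (fun u => b (g * u) * (jacobiSym d u : ℂ)) (fun v => starRingEnd ℂ (b (g * v)) * (jacobiSym d v : ℂ))
        hM (by positivity) hE0 hE hR hΛ hD hMP (le_trans (by gcongr) hNP) hy1 hyE hWp (hWd g hg1 (by linarith))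
        (fun n hn => (hRR n hn).1) (fun n hn => (mem_osf.mp hn).2.1)
        (fun n hn => (hRR n (osf_mono hNg hn)).1) (fun n hn => (mem_osf.mp hn).2.1)
        (hGd.trans (osf_mono hNg)) hGd (fun a ha => (hRR a (osf_mono hNg (hGd ha))).2) ?_ ?_
      · rw [norm_mul]
        refine (mul_le_of_le_one_left (norm_nonneg _) (norm_moeb_le d)).trans (hbil.trans ?_)
        have hx : ∀ (z : ℂ) (m : ℕ), ‖z * (jacobiSym d m : ℂ)‖ ^ 2 ≤ ‖z‖ ^ 2 := by
          intro z m
          rw [norm_mul]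
          have := norm_jac_le d m
          exact pow_le_pow_left₀ (by positivity) (mul_le_of_le_one_right (norm_nonneg _) this) 2
        have hs : ∑ a ∈ Ag A N g, ‖b (g * a) * (jacobiSym d a : ℂ)‖ ^ 2 + ∑ a ∈ Ag A N g, ‖starRingEnd ℂ (b (g * a)) * (jacobiSym d a : ℂ)‖ ^ 2 ≤
            2 * ∑ a ∈ Ag A N g, ‖b (g * a)‖ ^ 2 := by
          rw [two_mul]
          refine add_le_add (Finset.sum_le_sum fun a _ => hx _ _) (Finset.sum_le_sum fun a _ => (hx _ _).trans ?_)
          rw [RCLike.norm_conj]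
        gcongr
      · intro a ha
        have ham := (mem_Ag hA).mp ha
        have f := hfac g a ham
        have hlow : N / g / 2 < a := by
          rw [div_div, mul_comm (g : ℝ) 2, ← div_div, div_lt_iff₀ (by linarith)]
          linarith [f.2.2.2.2.2.2.1]
        have hup : (a : ℝ) ≤ N / g := by
          rw [le_div_iff₀ (by linarith)]; linarith [f.1]
        refine ⟨f.2.2.2.2.1, ?_, hlow, hup, ?_⟩
        · have : (1 : ℝ) ≤ N / g / 2 := by
            rw [le_div_iff₀ (by norm_num), le_div_iff₀ (by linarith)]; linarith
          exact_mod_cast lt_of_le_of_lt this hlow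
        · have hc := (hAd _ ham).2
          rw [← hc, Nat.mul_mod g, Nat.mod_mod, ← Nat.mul_mod, ← mul_assoc, Nat.mul_mod]
          have : (g * g) % 4 = 1 := by
            obtain ⟨s, hs⟩ := f.2.1
            have : g % 4 = 1 ∨ g % 4 = 3 := by omega
            rw [Nat.mul_mod]
            rcases this with h | h <;> simp [h]
          rw [this, one_mul, Nat.mod_mod]
      · intro a ha e he heE
        have ham := (mem_Ag hA).mp ha
        obtain ⟨⟨he1, _⟩, hep⟩ := mem_Ed.mp he
        exact hsm _ ham e he1 (hep.trans (Nat.primeFactors_mono (Nat.dvd_mul_left _ _) (hpos _ ham).ne')) heE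
    set K := C1 * (P ^ ε * ((Λ + D) * (R ^ 5 * (2 * ∑ a ∈ Ag A N g, ‖b (g * a)‖ ^ 2)))) with hK
    have hK0 : 0 ≤ K := by positivity
    calc _ ≤ ∑ eg ∈ Ed g Y, ∑ d ∈ g.divisors, K := by
          refine Finset.sum_le_sum fun eg heg => (norm_sum_le _ _).trans (Finset.sum_le_sum fun d hd => hterm eg heg d hd)
      _ = (Ed g Y).card * (g.divisors.card * K) := by simp
      _ ≤ _ := by
          have := hRR g hgm
          gcongr
          · exact this.2
          · exact this.1
  have hmainsum : ‖∑ n1 ∈ A, ∑ n2 ∈ A, b n1 * (starRingEnd ℂ (b n2)) * Td (n1.gcd n2) (n1 / n1.gcd n2) (n2 / n1.gcd n2)‖ ≤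
      2 * C1 * (P ^ ε * (R ^ 8 * (Λ + D))) * B := by
    have hre := regroup hA (fun g u v => b (g * u) * (starRingEnd ℂ (b (g * v))) * Td g u v)
    have hl : ∑ n1 ∈ A, ∑ n2 ∈ A, b n1 * (starRingEnd ℂ (b n2)) * Td (n1.gcd n2) (n1 / n1.gcd n2) (n2 / n1.gcd n2) =
      ∑ n1 ∈ A, ∑ n2 ∈ A, b (n1.gcd n2 * (n1 / n1.gcd n2)) * (starRingEnd ℂ (b (n1.gcd n2 * (n2 / n1.gcd n2)))) * Td (n1.gcd n2) (n1 / n1.gcd n2) (n2 / n1.gcd n2) := by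
      refine Finset.sum_congr rfl fun n1 _ => Finset.sum_congr rfl fun n2 _ => ?_
      rw [Nat.mul_div_cancel' (Nat.gcd_dvd_left n1 n2), Nat.mul_div_cancel' (Nat.gcd_dvd_right n1 n2)]
    rw [hl, hre]
    refine (norm_sum_le _ _).trans ((Finset.sum_le_sum hg).trans ?_)
    have h3 := sum_Ag_le hA (fun n hn => (hRR n (hA hn)).1) (fun n => ‖b n‖ ^ 2) (fun n => by positivity)
    calc ∑ g ∈ osf N, R * (R * (C1 * (P ^ ε * ((Λ + D) * (R ^ 5 * (2 * ∑ a ∈ Ag A N g, ‖b (g * a)‖ ^ 2))))))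
        = 2 * C1 * (P ^ ε * (R ^ 7 * (Λ + D))) * ∑ g ∈ osf N, ∑ a ∈ Ag A N g, ‖b (g * a)‖ ^ 2 := by
          rw [Finset.mul_sum]
          refine Finset.sum_congr rfl fun g _ => by ring
      _ ≤ 2 * C1 * (P ^ ε * (R ^ 7 * (Λ + D))) * (R * B) := by gcongr
      _ = _ := by ring
  have herrsum : ‖∑ n1 ∈ A, ∑ n2 ∈ A, b n1 * (starRingEnd ℂ (b n2)) * (TT M n1 n2 - Td (n1.gcd n2) (n1 / n1.gcd n2) (n2 / n1.gcd n2))‖ ≤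
      (C0 * N + 6 * M) * B := by
    calc _ ≤ ∑ n1 ∈ A, ∑ n2 ∈ A, ‖b n1‖ * ‖b n2‖ * (C0 + if n1 = n2 then 6 * M else 0) := by
          refine (norm_sum_le _ _).trans (Finset.sum_le_sum fun n1 h1 => (norm_sum_le _ _).trans (Finset.sum_le_sum fun n2 h2 => ?_))
          rw [norm_mul, norm_mul, RCLike.norm_conj]
          gcongr
          exact herr n1 h1 n2 h2
      _ = C0 * (∑ n ∈ A, ‖b n‖) ^ 2 + 6 * M * B := by
          rw [pow_two, Finset.sum_mul_sum, Finset.mul_sum, hB, Finset.mul_sum, ← Finset.sum_add_distrib]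
          refine Finset.sum_congr rfl fun n1 h1 => ?_
          have : ∑ n2 ∈ A, ‖b n1‖ * ‖b n2‖ * (if n1 = n2 then 6 * M else 0) = 6 * M * ‖b n1‖ ^ 2 := by
            rw [Finset.sum_eq_single_of_mem n1 h1]
            · simp; ring
            · intro n _ hn
              simp [Ne.symm hn]
          rw [← this, Finset.mul_sum, ← Finset.sum_add_distrib]
          refine Finset.sum_congr rfl fun n2 _ => by ring
      _ ≤ C0 * (N * B) + 6 * M * B := by
          gcongr
          exact cauchy_card A (by linarith) hA _
      _ = _ := by ring
  have htot : ‖∑ n1 ∈ A, ∑ n2 ∈ A, b n1 * (starRingEnd ℂ (b n2)) * TT M n1 n2‖ ≤ (6 + C0 + 2 * C1) * (M + N + P ^ ε * (R ^ 8 * (Λ + D))) * B := by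
    have hsplit : ∑ n1 ∈ A, ∑ n2 ∈ A, b n1 * (starRingEnd ℂ (b n2)) * TT M n1 n2 =
       ∑ n1 ∈ A, ∑ n2 ∈ A, b n1 * (starRingEnd ℂ (b n2)) * Td (n1.gcd n2) (n1 / n1.gcd n2) (n2 / n1.gcd n2) +
       ∑ n1 ∈ A, ∑ n2 ∈ A, b n1 * (starRingEnd ℂ (b n2)) * (TT M n1 n2 - Td (n1.gcd n2) (n1 / n1.gcd n2) (n2 / n1.gcd n2)) := by
      rw [← Finset.sum_add_distrib]
      refine Finset.sum_congr rfl fun n1 _ => ?_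
      rw [← Finset.sum_add_distrib]
      refine Finset.sum_congr rfl fun n2 _ => by ring
    rw [hsplit]
    refine (norm_add_le _ _).trans ((add_le_add hmainsum herrsum).trans ?_)
    rw [← add_mul]
    gcongr
    have hQ : 0 ≤ P ^ ε * (R ^ 8 * (Λ + D)) := by positivity
    nlinarith [mul_nonneg hC0.le hM0.le, mul_nonneg hC1.le hM0.le, mul_nonneg hC1.le (by linarith : 0 ≤ N), mul_nonneg hC0.le hQ, mul_nonneg hC1.le hQ]
  have hc := cTh_pos
  rw [div_mul_eq_mul_div, div_mul_eq_mul_div, le_div_iff₀ hc, mul_comm]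
  exact hs1.trans htot

lemma pow_omega_le {c ε : ℝ} (hc : 1 ≤ c) (hε : 0 < ε) : ∃ C : ℝ, 1 ≤ C ∧ ∀ n : ℕ, n ≠ 0 → c ^ n.primeFactors.card ≤ C * (n : ℝ) ^ ε := by
  obtain ⟨P0, hP0⟩ := exists_nat_gt (c ^ (1 / ε))
  refine ⟨c ^ P0, one_le_pow₀ hc, ?_⟩
  intro n hn
  have h1 : ∀ p ∈ n.primeFactors, c ≤ (if p < P0 then c else 1) * (p : ℝ) ^ ε := by
    intro p hp
    have hp1 : (1 : ℝ) ≤ p := by exact_mod_cast (Nat.prime_of_mem_primeFactors hp).one_lt.le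
    split_ifs with h
    · exact le_mul_of_one_le_right (by linarith) (Real.one_le_rpow hp1 hε.le)
    · rw [one_mul]
      have h2 : c ^ (1 / ε) ≤ p := hP0.le.trans (by exact_mod_cast not_lt.mp h)
      calc c = (c ^ (1 / ε)) ^ ε := by
            rw [← Real.rpow_mul (by linarith), one_div_mul_cancel hε.ne', Real.rpow_one]
        _ ≤ _ := Real.rpow_le_rpow (by positivity) h2 hε.le
  calc c ^ n.primeFactors.card = ∏ p ∈ n.primeFactors, c := by simp
    _ ≤ ∏ p ∈ n.primeFactors, ((if p < P0 then c else 1) * (p : ℝ) ^ ε) :=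
        Finset.prod_le_prod (fun _ _ => by linarith) h1
    _ = (∏ p ∈ n.primeFactors, (if p < P0 then c else 1)) * (∏ p ∈ n.primeFactors, (p : ℝ)) ^ ε := by
        rw [Finset.prod_mul_distrib, ← Real.finsetProd_rpow _ _ (fun _ _ => by positivity)]
    _ ≤ c ^ P0 * (n : ℝ) ^ ε := by
        gcongr
        · rw [← Finset.prod_filter, Finset.prod_const]
          apply pow_le_pow_right₀ hc
          have : n.primeFactors.filter (fun p => p < P0) ⊆ Finset.range P0 := fun p hp => Finset.mem_range.mpr (Finset.mem_filter.mp hp).2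
          simpa using Finset.card_le_card this
        · have := Nat.le_of_dvd (Nat.pos_of_ne_zero hn) (Nat.prod_primeFactors_dvd n)
          calc ∏ p ∈ n.primeFactors, (p : ℝ) = ((∏ p ∈ n.primeFactors, p : ℕ) : ℝ) := by push_cast; rfl
            _ ≤ n := Nat.cast_le.mpr this

lemma Ed_rankin {ε : ℝ} (hε : 0 < ε) (n Y : ℕ) : ((Ed n Y).card : ℝ) ≤ (Y : ℝ) ^ ε * ((1 - (2 : ℝ) ^ (-ε))⁻¹) ^ n.primeFactors.card := by
  let f : ℕ →* ℝ :=
    { toFun := fun m => (m : ℝ) ^ (-ε)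
      map_one' := by simp
      map_mul' := fun x y => by push_cast; exact Real.mul_rpow (by positivity) (by positivity) }
  have hf : ∀ m, f m = (m : ℝ) ^ (-ε) := fun m => rfl
  have hp2 : ∀ {p : ℕ}, p.Prime → f p ≤ (2 : ℝ) ^ (-ε) := by
    intro p hp
    rw [hf, Real.rpow_neg (by positivity), Real.rpow_neg (by norm_num)]
    have : (2 : ℝ) ≤ p := by exact_mod_cast hp.two_le
    gcongr
  have h21 : (2 : ℝ) ^ (-ε) < 1 := Real.rpow_lt_one_of_one_lt_of_neg (by norm_num) (by linarith)
  have hnn : ∀ m, 0 ≤ f m := fun m => by rw [hf]; positivity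
  obtain ⟨hs1, hs2⟩ := EulerProduct.summable_and_hasSum_factoredNumbers_prod_filter_prime_geometric (f := f)
    (fun {p} hp => by rw [Real.norm_of_nonneg (hnn p)]; exact (hp2 hp).trans_lt h21) n.primeFactors
  have hprod : ∏ p ∈ n.primeFactors with p.Prime, (1 - f p)⁻¹ ≤ ((1 - (2 : ℝ) ^ (-ε))⁻¹) ^ n.primeFactors.card := by
    rw [Finset.filter_true_of_mem (fun p hp => Nat.prime_of_mem_primeFactors hp), ← Finset.prod_const]
    refine Finset.prod_le_prod (fun p hp => ?_) (fun p hp => ?_)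
    · have := hp2 (Nat.prime_of_mem_primeFactors hp)
      exact inv_nonneg.mpr (by linarith)
    · have := hp2 (Nat.prime_of_mem_primeFactors hp)
      exact inv_anti₀ (by linarith) (by linarith)
  have hmem : ∀ e ∈ Ed n Y, e ∈ Nat.factoredNumbers n.primeFactors := by
    intro e he
    obtain ⟨⟨h1, _⟩, h2⟩ := mem_Ed.mp he
    rw [Nat.factoredNumbers, Set.mem_ofPred_eq]
    exact ⟨by omega, fun p hp => h2 (by rwa [← Nat.mem_primeFactors_iff_mem_primeFactorsList] at hp)⟩
  have hsum : ∑ e ∈ Ed n Y, f e ≤ ∏ p ∈ n.primeFactors with p.Prime, (1 - f p)⁻¹ := by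
    rw [← Finset.sum_attach]
    let emb : {x // x ∈ Ed n Y} ↪ Nat.factoredNumbers n.primeFactors :=
      ⟨fun e => ⟨e.1, hmem e.1 e.2⟩, fun a b h => Subtype.ext (congrArg (fun z : Nat.factoredNumbers n.primeFactors => z.1) h)⟩
    have : ∑ e ∈ (Ed n Y).attach, f e = ∑ m ∈ (Ed n Y).attach.map emb, f m := by
      rw [Finset.sum_map]; rfl
    rw [this]
    exact sum_le_hasSum _ (fun m _ => hnn _) hs2
  calc ((Ed n Y).card : ℝ) = ∑ e ∈ Ed n Y, 1 := by simp
    _ ≤ ∑ e ∈ Ed n Y, (Y : ℝ) ^ ε * f e := by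
        refine Finset.sum_le_sum fun e he => ?_
        obtain ⟨⟨h1, h2⟩, _⟩ := mem_Ed.mp he
        have he0 : 0 < (e : ℝ) := by exact_mod_cast h1
        rw [hf, Real.rpow_neg he0.le, ← div_eq_mul_inv, one_le_div (by positivity)]
        exact Real.rpow_le_rpow he0.le (by exact_mod_cast h2) hε.le
    _ = (Y : ℝ) ^ ε * ∑ e ∈ Ed n Y, f e := by rw [Finset.mul_sum]
    _ ≤ _ := by gcongr; exact hsum.trans hprod

lemma Ed_card_le {ε : ℝ} (hε : 0 < ε) : ∃ C : ℝ, 1 ≤ C ∧ ∀ n Y : ℕ, n ≠ 0 → ((Ed n Y).card : ℝ) ≤ C * ((Y : ℝ) * n) ^ ε := by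
  have h21 : (2 : ℝ) ^ (-ε) < 1 := Real.rpow_lt_one_of_one_lt_of_neg (by norm_num) (by linarith)
  have h20 : 0 < (2 : ℝ) ^ (-ε) := by positivity
  obtain ⟨C, hC, h⟩ := pow_omega_le (c := (1 - (2 : ℝ) ^ (-ε))⁻¹) (ε := ε) ((one_le_inv₀ (by linarith)).mpr (by linarith)) hε
  refine ⟨C, hC, fun n Y hn => (Ed_rankin hε n Y).trans ?_⟩
  rw [Real.mul_rpow (by positivity) (by positivity)]
  have := h n hn
  have hY : 0 ≤ (Y : ℝ) ^ ε := by positivity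
  nlinarith [mul_le_mul_of_nonneg_left this hY]

lemma div_card_le {ε : ℝ} (hε : 0 < ε) : ∃ C : ℝ, 1 ≤ C ∧ ∀ n : ℕ, n ≠ 0 → (n.divisors.card : ℝ) ≤ C * (n : ℝ) ^ ε := by
  obtain ⟨C, hC, h⟩ := Ed_card_le (half_pos hε)
  refine ⟨C, hC, fun n hn => ?_⟩
  have h1 : n.divisors ⊆ Ed n n := by
    intro d hd
    have hd0 := Nat.pos_of_mem_divisors hd
    exact mem_Ed.mpr ⟨⟨hd0, Nat.divisor_le hd⟩, Nat.primeFactors_mono (Nat.dvd_of_mem_divisors hd) hn⟩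
  have h2 : (n.divisors.card : ℝ) ≤ (Ed n n).card := by exact_mod_cast Finset.card_le_card h1
  refine h2.trans ((h n n hn).trans (le_of_eq ?_))
  rw [Real.mul_rpow (by positivity) (by positivity), ← Real.rpow_add (by positivity)]
  norm_num

/-- the large sieve inequality with constant `Λ` -/
def SB (X : ℝ) (A : Finset ℕ) (Λ : ℝ) : Prop :=
  ∀ x : ℕ → ℂ, ∑ k ∈ sqf X, ‖Sx A x k‖ ^ 2 ≤ Λ * ∑ n ∈ A, ‖x n‖ ^ 2

lemma SB.mono {X X' Λ Λ' : ℝ} {A A' : Finset ℕ} (h : SB X A Λ) (hX : X' ≤ X) (hA : A' ⊆ A) (hΛ : Λ ≤ Λ') : SB X' A' Λ' := by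
  intro x
  have h1 := h (fun n => if n ∈ A' then x n else 0)
  have h2 : ∀ k, Sx A (fun n => if n ∈ A' then x n else 0) k = Sx A' x k := by
    intro k
    unfold Sx
    rw [← Finset.sum_subset hA]
    · exact Finset.sum_congr rfl fun n hn => by simp [hn]
    · intro n _ hn; simp [hn]
  have h3 : ∑ n ∈ A, ‖(if n ∈ A' then x n else 0 : ℂ)‖ ^ 2 = ∑ n ∈ A', ‖x n‖ ^ 2 := by
    rw [← Finset.sum_subset hA]
    · exact Finset.sum_congr rfl fun n hn => by rw [if_pos hn]
    · intro n _ hn; rw [if_neg hn]; simp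
  simp only [h2] at h1
  rw [h3] at h1
  refine le_trans (Finset.sum_le_sum_of_subset_of_nonneg (sqf_mono hX) (fun _ _ _ => by positivity)) (h1.trans ?_)
  gcongr

lemma WB.mono {X Λ Λ' : ℝ} {A A' : Finset ℕ} (h : WB X A Λ) (hA : A' ⊆ A) (hΛ : Λ ≤ Λ') : WB X A' Λ' := by
  intro x K hK
  have h1 := h (fun n => if n ∈ A' then x n else 0) K hK
  have h2 : ∀ k, Sx A (fun n => if n ∈ A' then x n else 0) k = Sx A' x k := by
    intro k
    unfold Sx
    rw [← Finset.sum_subset hA]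
    · exact Finset.sum_congr rfl fun n hn => by simp [hn]
    · intro n _ hn; simp [hn]
  have h3 : ∑ n ∈ A, ‖(if n ∈ A' then x n else 0 : ℂ)‖ ^ 2 = ∑ n ∈ A', ‖x n‖ ^ 2 := by
    rw [← Finset.sum_subset hA]
    · exact Finset.sum_congr rfl fun n hn => by rw [if_pos hn]
    · intro n _ hn; rw [if_neg hn]; simp
  simp only [h2] at h1
  rw [h3] at h1
  refine h1.trans ?_
  gcongr

lemma SB_split {ι : Type} [DecidableEq ι] {X Λ L : ℝ} {A : Finset ℕ} (f : ℕ → ι) (I : Finset ι) (hI : ∀ n ∈ A, f n ∈ I)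
    (hL : (I.card : ℝ) ≤ L) (h : ∀ i ∈ I, SB X (A.filter fun n => f n = i) Λ) : SB X A (L * Λ) := by
  intro x
  have h1 : ∀ k, ‖Sx A x k‖ ^ 2 ≤ L * ∑ i ∈ I, ‖Sx (A.filter fun n => f n = i) x k‖ ^ 2 := by
    intro k
    have : Sx A x k = ∑ i ∈ I, Sx (A.filter fun n => f n = i) x k := by
      unfold Sx
      exact (Finset.sum_fiberwise_of_maps_to hI _).symm
    rw [this]
    calc _ ≤ (∑ i ∈ I, ‖Sx (A.filter fun n => f n = i) x k‖) ^ 2 := by gcongr; exact norm_sum_le _ _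
      _ ≤ I.card * ∑ i ∈ I, ‖Sx (A.filter fun n => f n = i) x k‖ ^ 2 := sq_sum_le_card_mul_sum_sq
      _ ≤ _ := by gcongr
  have hL0 : 0 ≤ L := le_trans (by positivity) hL
  calc _ ≤ ∑ k ∈ sqf X, L * ∑ i ∈ I, ‖Sx (A.filter fun n => f n = i) x k‖ ^ 2 := Finset.sum_le_sum fun k _ => h1 k
    _ = L * ∑ i ∈ I, ∑ k ∈ sqf X, ‖Sx (A.filter fun n => f n = i) x k‖ ^ 2 := by rw [← Finset.mul_sum, Finset.sum_comm]
    _ ≤ L * ∑ i ∈ I, Λ * ∑ n ∈ A.filter fun n => f n = i, ‖x n‖ ^ 2 := by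
        gcongr with i hi
        exact h i hi x
    _ = L * Λ * ∑ n ∈ A, ‖x n‖ ^ 2 := by
        rw [← Finset.mul_sum, Finset.sum_fiberwise_of_maps_to hI, mul_assoc]

lemma WB_of {X Λ : ℝ} {A : Finset ℕ} (hX : 1 ≤ X) (hΛ : 0 ≤ Λ) (h : ∀ i : ℕ, SB (2 ^ i * X) A (Λ * 2 ^ (11 * i))) : WB X A (2 ^ 13 * Λ) := by
  intro x K hK
  have hX0 : 0 < X := by linarith
  have hex : ∀ k : ℕ, ∃ i : ℕ, (k : ℝ) ≤ 2 ^ i * X := by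
    intro k
    refine ⟨k, ?_⟩
    have : (k : ℝ) ≤ 2 ^ k := by exact_mod_cast Nat.lt_two_pow_self.le
    nlinarith [this, pow_pos (two_pos : (0 : ℝ) < 2) k]
  classical
  set idx : ℕ → ℕ := fun k => Nat.find (hex k) with hidx
  have hw : ∀ k ∈ K, (min 1 (X / k)) ^ 12 ≤ (2 : ℝ) ^ 12 * ((1 / 2) ^ (12 * idx k)) := by
    intro k hk
    have hk0 : 0 < (k : ℝ) := by have := Nat.pos_of_ne_zero (hK k hk).ne_zero; exact_mod_cast this
    have hm0 : 0 ≤ min 1 (X / (k : ℝ)) := le_min zero_le_one (by positivity)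
    rcases Nat.eq_zero_or_pos (idx k) with h0 | h0
    · rw [h0]
      calc (min 1 (X / (k : ℝ))) ^ 12 ≤ 1 := pow_le_one₀ hm0 (min_le_left _ _)
        _ ≤ _ := by norm_num
    · have hlt := Nat.find_min (hex k) (m := idx k - 1) (by have : idx k = Nat.find (hex k) := rfl; omega)
      rw [not_le] at hlt
      have h1 : X / k ≤ 2 * (1 / 2) ^ idx k := by
        rw [div_le_iff₀ hk0]
        obtain ⟨j, hj⟩ : ∃ j, idx k = j + 1 := ⟨idx k - 1, by omega⟩
        rw [hj, Nat.add_sub_cancel] at hlt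
        rw [hj, pow_succ]
        have h2 : (1 / 2 : ℝ) ^ j * 2 ^ j = 1 := by rw [← mul_pow]; norm_num
        calc X = (1 / 2 : ℝ) ^ j * (2 ^ j * X) := by rw [← mul_assoc, h2, one_mul]
          _ ≤ (1 / 2 : ℝ) ^ j * k := by gcongr
          _ = _ := by ring
      calc (min 1 (X / (k : ℝ))) ^ 12 ≤ (2 * (1 / 2) ^ idx k) ^ 12 := pow_le_pow_left₀ hm0 ((min_le_right _ _).trans h1) 12
        _ = _ := by rw [mul_pow, ← pow_mul, mul_comm 12]
  set J := (K.image idx) with hJ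
  set S := ∑ n ∈ A, ‖x n‖ ^ 2 with hS
  have hS0 : 0 ≤ S := by positivity
  calc ∑ k ∈ K, (min 1 (X / k)) ^ 12 * ‖Sx A x k‖ ^ 2 ≤ ∑ k ∈ K, (2 : ℝ) ^ 12 * ((1 / 2) ^ (12 * idx k)) * ‖Sx A x k‖ ^ 2 := by
        refine Finset.sum_le_sum fun k hk => ?_
        gcongr
        exact hw k hk
    _ = ∑ i ∈ J, ∑ k ∈ K.filter (fun k => idx k = i), (2 : ℝ) ^ 12 * ((1 / 2) ^ (12 * idx k)) * ‖Sx A x k‖ ^ 2 :=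
        (Finset.sum_fiberwise_of_maps_to (fun k hk => Finset.mem_image_of_mem _ hk) _).symm
    _ ≤ ∑ i ∈ J, (2 : ℝ) ^ 12 * ((1 / 2) ^ (12 * i)) * (Λ * 2 ^ (11 * i) * S) := by
        refine Finset.sum_le_sum fun i _ => ?_
        have e : ∑ k ∈ K.filter (fun k => idx k = i), (2 : ℝ) ^ 12 * ((1 / 2) ^ (12 * idx k)) * ‖Sx A x k‖ ^ 2 =
           (2 : ℝ) ^ 12 * ((1 / 2) ^ (12 * i)) * ∑ k ∈ K.filter (fun k => idx k = i), ‖Sx A x k‖ ^ 2 := by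
          rw [Finset.mul_sum]
          refine Finset.sum_congr rfl fun k hk => ?_
          rw [(Finset.mem_filter.mp hk).2]
        rw [e]
        gcongr
        refine le_trans ?_ (h i x)
        refine Finset.sum_le_sum_of_subset_of_nonneg ?_ (fun _ _ _ => by positivity)
        intro k hk
        obtain ⟨h1, h2⟩ := Finset.mem_filter.mp hk
        refine mem_sqf.mpr ⟨?_, hK k h1⟩
        have := Nat.find_spec (hex k)
        rw [← h2]; exact this
    _ = 2 ^ 12 * Λ * S * ∑ i ∈ J, (1 / 2 : ℝ) ^ i := by
        rw [Finset.mul_sum]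
        refine Finset.sum_congr rfl fun i _ => ?_
        have e1 : (1 / 2 : ℝ) ^ (12 * i) * 2 ^ (11 * i) = (1 / 2) ^ i := by
          rw [show 12 * i = i + 11 * i by ring, pow_add, mul_assoc, ← mul_pow]; norm_num
        rw [← e1]; ring
    _ ≤ 2 ^ 12 * Λ * S * 2 := by
        gcongr
        exact (summable_geometric_two.sum_le_tsum _ (fun _ _ => by positivity)).trans tsum_geometric_two.le
    _ = _ := by ring

lemma log_card_le {ε : ℝ} (hε : 0 < ε) : ∃ C : ℝ, 1 ≤ C ∧ ∀ N : ℝ, 1 ≤ N → (Nat.log 2 ⌊N⌋₊ : ℝ) + 1 ≤ C * N ^ ε := by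
  refine ⟨1 / (ε * Real.log 2) + 1, by have := Real.log_pos (by norm_num : (1 : ℝ) < 2); linarith [show 0 < 1 / (ε * Real.log 2) by positivity], ?_⟩
  intro N hN
  have hl2 := Real.log_pos (by norm_num : (1 : ℝ) < 2)
  have h1 : (Nat.log 2 ⌊N⌋₊ : ℝ) * Real.log 2 ≤ Real.log N := by
    rw [← Real.log_pow]
    apply Real.log_le_log (by positivity)
    have : 2 ^ Nat.log 2 ⌊N⌋₊ ≤ ⌊N⌋₊ := Nat.pow_log_le_self 2 (Nat.pos_iff_ne_zero.mp (Nat.floor_pos.mpr hN))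
    calc (2 : ℝ) ^ Nat.log 2 ⌊N⌋₊ ≤ ⌊N⌋₊ := by exact_mod_cast this
      _ ≤ N := Nat.floor_le (by linarith)
  have h2 := Real.log_le_rpow_div (by linarith : 0 ≤ N) hε
  have h3 : 1 ≤ N ^ ε := Real.one_le_rpow hN hε.le
  have h4 : (Nat.log 2 ⌊N⌋₊ : ℝ) ≤ 1 / (ε * Real.log 2) * N ^ ε := by
    rw [one_div, inv_mul_eq_div, le_div_iff₀ (by positivity)]
    have := h1.trans h2
    rw [le_div_iff₀ hε] at this
    linarith
  linarith

lemma main_gen {ε : ℝ} (hε : 0 < ε) : ∃ C : ℝ, 0 < C ∧ ∀ (M N E0 E Λ D : ℝ) (A : Finset ℕ),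
    1 ≤ M → 1 ≤ N → 1 ≤ E0 → 1 ≤ E → 0 ≤ Λ → 0 ≤ D → A ⊆ osf N →
    (∀ n ∈ A, ∀ e : ℕ, 1 ≤ e → e.primeFactors ⊆ n.primeFactors → (e : ℝ) ≤ E → (e : ℝ) ≤ E0) →
    WB (max 1 (M / E)) (osf N) Λ →
    (∀ Nq : ℝ, 1 ≤ Nq → Nq ≤ N → WB (max 1 (4 * Nq ^ 2 * E0 ^ 7 / M)) (osf Nq) (D * Nq / M)) →
    SB M A (C * (M * N * E0) ^ ε * (M + N + Λ + D)) := by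
  set ε1 := ε / 16 with hε1
  have h1 : 0 < ε1 := by positivity
  obtain ⟨C1, hC1, hm⟩ := main_dy h1
  obtain ⟨C2, hC2, hEd⟩ := Ed_card_le h1
  obtain ⟨C3, hC3, hdv⟩ := div_card_le h1
  obtain ⟨C4, hC4, hlg⟩ := log_card_le h1
  refine ⟨(4 * C4) * (C1 * ((4 : ℝ) ^ ε1 * ((C2 + C3) * 2 ^ ε1) ^ 8)), by positivity, ?_⟩
  intro M N E0 E Λ D A hM hN hE0 hE hΛ hD hA hsm hWp hWd
  set Q := M * N * E0 with hQ
  have hMN : 1 ≤ M * N := one_le_mul_of_one_le_of_one_le hM hN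
  have hQ1 : 1 ≤ Q := one_le_mul_of_one_le_of_one_le hMN hE0
  set q := Q ^ ε1 with hq
  have hq1 : 1 ≤ q := Real.one_le_rpow hQ1 h1.le
  have hQMN : M * N ≤ Q := le_mul_of_one_le_right (by positivity) hE0
  set R := (C2 + C3) * (2 ^ ε1 * q) with hR
  set Y := ⌈M⌉₊ with hY
  have hY2 : (Y : ℝ) ≤ 2 * M := by have := Nat.ceil_lt_add_one (by linarith : 0 ≤ M); linarith
  have h2e : 1 ≤ (2 : ℝ) ^ ε1 := Real.one_le_rpow (by norm_num) h1.le
  have hRR : ∀ n ∈ osf N, (n.divisors.card : ℝ) ≤ R ∧ ((Ed n Y).card : ℝ) ≤ R := by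
    intro n hn
    obtain ⟨hnN, _, hns⟩ := mem_osf.mp hn
    constructor
    · refine (hdv n hns.ne_zero).trans ?_
      have : (n : ℝ) ^ ε1 ≤ q := Real.rpow_le_rpow (by positivity) (hnN.trans ((le_mul_of_one_le_left (by linarith) hM).trans hQMN)) h1.le
      calc C3 * (n : ℝ) ^ ε1 ≤ (C2 + C3) * (1 * q) := by rw [one_mul]; gcongr; linarith
        _ ≤ _ := by rw [hR]; gcongr
    · refine (hEd n Y hns.ne_zero).trans ?_
      have : ((Y : ℝ) * n) ^ ε1 ≤ 2 ^ ε1 * q := by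
        rw [hq, ← Real.mul_rpow (by norm_num) (by linarith)]
        refine Real.rpow_le_rpow (by positivity) ?_ h1.le
        calc (Y : ℝ) * n ≤ (2 * M) * N := by gcongr
          _ ≤ 2 * Q := by linarith
      rw [hR]
      gcongr
      linarith
  set P := 4 * Q ^ 7 with hP
  have hPM : M ≤ P := by
    have : Q ≤ Q ^ 7 := le_self_pow₀ hQ1 (by norm_num)
    have : M ≤ M * N := le_mul_of_one_le_right (by linarith) hN
    linarith
  have hPN : 4 * N ^ 2 * E0 ^ 7 ≤ P := by
    rw [hP, hQ]
    have : N ^ 2 * E0 ^ 7 ≤ (M * N * E0) ^ 7 := by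
      rw [mul_pow]
      gcongr
      calc N ^ 2 ≤ N ^ 7 := pow_le_pow_right₀ hN (by norm_num)
        _ ≤ _ := by gcongr; exact le_mul_of_one_le_left (by linarith) hM
    linarith
  have hPe : P ^ ε1 = 4 ^ ε1 * q ^ 7 := by
    rw [hP, Real.mul_rpow (by norm_num) (by positivity), hq, ← Real.rpow_natCast, ← Real.rpow_natCast, ← Real.rpow_mul (by positivity), ← Real.rpow_mul (by positivity)]
    congr 2
    ring
  have hMY : M ≤ Y := Nat.le_ceil M
  have hN0 : 0 < N := by linarith
  have hR0 : 0 ≤ R := by positivity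
  set K0 := C1 * (M + N + P ^ ε1 * (R ^ 8 * (Λ + D))) with hK0
  have hfin : SB M A ((4 * (C4 * N ^ ε1)) * K0) := by
    refine SB_split (fun n => (Nat.log 2 ⌊N / n⌋₊, n % 4)) (Finset.range (Nat.log 2 ⌊N⌋₊ + 1) ×ˢ Finset.range 4) ?_ ?_ ?_
    · intro n hn
      have hn0 : 1 ≤ n := Nat.pos_of_ne_zero (mem_osf.mp (hA hn)).2.2.ne_zero
      have hn1 : (1 : ℝ) ≤ n := by exact_mod_cast hn0
      refine Finset.mem_product.mpr ⟨Finset.mem_range.mpr ?_, Finset.mem_range.mpr (Nat.mod_lt _ (by norm_num))⟩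
      show Nat.log 2 ⌊N / n⌋₊ < _
      exact Nat.lt_succ_of_le (Nat.log_mono_right (Nat.floor_mono (div_le_self hN0.le hn1)))
    · rw [Finset.card_product, Finset.card_range, Finset.card_range]
      push_cast
      linarith [hlg N hN]
    · rintro ⟨j, c⟩ hjc
      by_cases hemp : (A.filter fun n : ℕ => (Nat.log 2 ⌊N / n⌋₊, n % 4) = (j, c)) = ∅
      · rw [hemp]; intro x; simp [Sx]
      obtain ⟨n0, hn0⟩ := Finset.nonempty_iff_ne_empty.mpr hemp
      have key : ∀ n ∈ A.filter (fun n : ℕ => (Nat.log 2 ⌊N / n⌋₊, n % 4) = (j, c)), (n : ℝ) ≤ N / 2 ^ j ∧ N / 2 ^ j / 2 < n ∧ n % 4 = c ∧ n ∈ A ∧ 1 ≤ n := by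
        intro n hn
        obtain ⟨a1, a2⟩ := Finset.mem_filter.mp hn
        obtain ⟨a3, a4⟩ := Prod.mk.inj a2
        have hn1 : 1 ≤ n := Nat.pos_of_ne_zero (mem_osf.mp (hA a1)).2.2.ne_zero
        have hn0 : (0 : ℝ) < n := by exact_mod_cast hn1
        have hone : 1 ≤ N / n := by rw [le_div_iff₀ hn0, one_mul]; exact (mem_osf.mp (hA a1)).1
        have hf0 : ⌊N / n⌋₊ ≠ 0 := Nat.pos_iff_ne_zero.mp (Nat.floor_pos.mpr hone)
        have b1 : 2 ^ j ≤ ⌊N / (n : ℝ)⌋₊ := by rw [← a3]; exact Nat.pow_log_le_self 2 hf0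
        have b2 : ⌊N / (n : ℝ)⌋₊ < 2 ^ (j + 1) := by rw [← a3]; exact Nat.lt_pow_succ_log_self (by norm_num) _
        have c1 : (2 : ℝ) ^ j ≤ N / n := by
          refine le_trans ?_ (Nat.floor_le (by positivity))
          exact_mod_cast b1
        have c2 : N / n < 2 ^ (j + 1) := by
          refine (Nat.lt_floor_add_one _).trans_le ?_
          exact_mod_cast b2
        refine ⟨?_, ?_, a4, a1, hn1⟩
        · rw [le_div_iff₀ (by positivity)]
          rw [le_div_iff₀ hn0] at c1
          linarith
        · rw [div_div, ← pow_succ, div_lt_iff₀ (by positivity)]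
          rw [div_lt_iff₀ hn0] at c2
          linarith
      set Nj := N / 2 ^ j with hNj
      have hj1 : (1 : ℝ) ≤ 2 ^ j := one_le_pow₀ (by norm_num)
      have hNjN : Nj ≤ N := div_le_self hN0.le hj1
      have hNj1 : 1 ≤ Nj := by
        have := key n0 hn0
        exact le_trans (by exact_mod_cast this.2.2.2.2) this.1
      intro x
      have hmm := hm M Nj E0 E R Λ D P c Y (A.filter fun n : ℕ => (Nat.log 2 ⌊N / n⌋₊, n % 4) = (j, c)) hM hNj1 hE0 hE hR0 hΛ hD hPM
        (le_trans (by gcongr) hPN) hMY ?_ (fun n hn => ⟨(key n hn).2.1, (key n hn).2.2.1⟩) (fun n hn => hsm n (key n hn).2.2.2.1)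
        (fun n hn => hRR n (osf_mono hNjN hn)) (hWp.mono (osf_mono hNjN) le_rfl) ?_ x
      · refine hmm.trans ?_
        rw [hK0]
        gcongr
      · intro n hn
        obtain ⟨a1, a2, a3, a4, a5⟩ := key n hn
        exact mem_osf.mpr ⟨a1, (mem_osf.mp (hA a4)).2⟩
      · intro g hg1 hgN
        have hg0 : (1 : ℝ) ≤ g := by exact_mod_cast hg1
        exact hWd (Nj / g) (by rw [le_div_iff₀ (by linarith)]; linarith) ((div_le_self (by linarith) hg0).trans hNjN)
  refine hfin.mono le_rfl (le_refl _) ?_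
  have hNq : N ^ ε1 ≤ q := Real.rpow_le_rpow hN0.le ((le_mul_of_one_le_left (by linarith) hM).trans hQMN) h1.le
  have hq16 : Q ^ ε = q * q ^ 15 := by
    rw [← pow_succ', hq, ← Real.rpow_natCast, ← Real.rpow_mul (by linarith), hε1]
    congr 1
    push_cast
    ring
  have hKb : K0 ≤ C1 * ((4 : ℝ) ^ ε1 * ((C2 + C3) * 2 ^ ε1) ^ 8) * q ^ 15 * (M + N + Λ + D) := by
    have e : P ^ ε1 * (R ^ 8 * (Λ + D)) = ((4 : ℝ) ^ ε1 * ((C2 + C3) * 2 ^ ε1) ^ 8) * q ^ 15 * (Λ + D) := by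
      rw [hPe, hR]; ring
    have hone : 1 ≤ ((4 : ℝ) ^ ε1 * ((C2 + C3) * 2 ^ ε1) ^ 8) * q ^ 15 := by
      refine one_le_mul_of_one_le_of_one_le (one_le_mul_of_one_le_of_one_le (Real.one_le_rpow (by norm_num) h1.le) (one_le_pow₀ ?_)) (one_le_pow₀ hq1)
      exact one_le_mul_of_one_le_of_one_le (by linarith) h2e
    rw [hK0, e]
    set T := ((4 : ℝ) ^ ε1 * ((C2 + C3) * 2 ^ ε1) ^ 8) * q ^ 15
    have : M + N + T * (Λ + D) ≤ T * (M + N + Λ + D) := by nlinarith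
    calc _ ≤ C1 * (T * (M + N + Λ + D)) := by gcongr
      _ = _ := by ring
  have hq0 : 0 ≤ q := by linarith
  calc 4 * (C4 * N ^ ε1) * K0 ≤ 4 * (C4 * q) * (C1 * ((4 : ℝ) ^ ε1 * ((C2 + C3) * 2 ^ ε1) ^ 8) * q ^ 15 * (M + N + Λ + D)) := by
        have : 0 ≤ K0 := by positivity
        gcongr
    _ = _ := by rw [hq16]; ring

lemma card_sqf_le {X : ℝ} (hX : 0 ≤ X) : ((sqf X).card : ℝ) ≤ X := by
  have h3 : sqf X ⊆ Finset.Icc 1 ⌊X⌋₊ := Finset.filter_subset _ _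
  have h4 := Finset.card_le_card h3
  rw [Nat.card_Icc, Nat.add_sub_cancel] at h4
  exact (Nat.cast_le.mpr h4).trans (Nat.floor_le hX)

lemma SB_triv {X N : ℝ} (hX : 0 ≤ X) (hN : 0 ≤ N) : SB X (osf N) (X * N) := by
  intro x
  have h1 : ∀ k ∈ sqf X, ‖Sx (osf N) x k‖ ^ 2 ≤ N * ∑ n ∈ osf N, ‖x n‖ ^ 2 := by
    intro k _
    refine le_trans ?_ (cauchy_card (osf N) hN (le_refl _) (fun n => ‖x n‖))
    gcongr
    refine (norm_sum_le _ _).trans (Finset.sum_le_sum fun n _ => ?_)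
    rw [norm_mul]
    exact mul_le_of_le_one_right (norm_nonneg _) (norm_jac_le _ _)
  refine (Finset.sum_le_sum h1).trans ?_
  rw [Finset.sum_const, nsmul_eq_mul, mul_assoc]
  have := card_sqf_le hX
  gcongr

lemma mat_dual {K A : Finset ℕ} {Λ : ℝ} (hΛ : 0 ≤ Λ) (a : ℕ → ℕ → ℂ)
    (h : ∀ y : ℕ → ℂ, ∑ n ∈ A, ‖∑ k ∈ K, y k * a k n‖ ^ 2 ≤ Λ * ∑ k ∈ K, ‖y k‖ ^ 2) (x : ℕ → ℂ) :
    ∑ k ∈ K, ‖∑ n ∈ A, x n * a k n‖ ^ 2 ≤ Λ * ∑ n ∈ A, ‖x n‖ ^ 2 := by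
  set T : ℕ → ℂ := fun k => ∑ n ∈ A, x n * a k n with hT
  set S := ∑ k ∈ K, ‖T k‖ ^ 2 with hS
  set B := ∑ n ∈ A, ‖x n‖ ^ 2 with hB
  have hB0 : 0 ≤ B := by positivity
  have hS0 : 0 ≤ S := by positivity
  have h1 := h (fun k => starRingEnd ℂ (T k))
  have h2 : ∑ k ∈ K, ‖starRingEnd ℂ (T k)‖ ^ 2 = S := Finset.sum_congr rfl fun k _ => by rw [RCLike.norm_conj]
  rw [h2] at h1
  have e : (S : ℂ) = ∑ n ∈ A, x n * ∑ k ∈ K, starRingEnd ℂ (T k) * a k n := by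
    have : ∀ k, ((‖T k‖ ^ 2 : ℝ) : ℂ) = starRingEnd ℂ (T k) * T k := by
      intro k
      rw [Complex.conj_mul']; push_cast; rfl
    rw [hS, Complex.ofReal_sum, Finset.sum_congr rfl fun k _ => this k]
    simp only [Finset.mul_sum]
    rw [Finset.sum_comm]
    refine Finset.sum_congr rfl fun k _ => ?_
    conv_lhs => rw [hT]
    rw [Finset.mul_sum]
    refine Finset.sum_congr rfl fun n _ => by ring
  have h3 : S ≤ ∑ n ∈ A, ‖x n‖ * ‖∑ k ∈ K, starRingEnd ℂ (T k) * a k n‖ := by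
    have : S = ‖(S : ℂ)‖ := by rw [Complex.norm_real, Real.norm_of_nonneg hS0]
    rw [this, e]
    refine (norm_sum_le _ _).trans (Finset.sum_le_sum fun n _ => by rw [norm_mul])
  have h4 : S ^ 2 ≤ B * (Λ * S) := by
    calc S ^ 2 ≤ (∑ n ∈ A, ‖x n‖ * ‖∑ k ∈ K, starRingEnd ℂ (T k) * a k n‖) ^ 2 := by gcongr
      _ ≤ B * ∑ n ∈ A, ‖∑ k ∈ K, starRingEnd ℂ (T k) * a k n‖ ^ 2 := Finset.sum_mul_sq_le_sq_mul_sq _ _ _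
      _ ≤ _ := by gcongr
  change S ≤ Λ * B
  rcases hS0.eq_or_lt with h0 | h0
  · rw [← h0]; positivity
  · nlinarith

lemma dual_odd {X N Λ : ℝ} (hΛ : 0 ≤ Λ) (h : SB N (osf X) Λ) (x : ℕ → ℂ) :
    ∑ k ∈ osf X, ‖Sx (osf N) x k‖ ^ 2 ≤ 4 * Λ * ∑ n ∈ osf N, ‖x n‖ ^ 2 := by
  have hd : ∀ w : ℕ → ℂ, ∑ k ∈ osf X, ‖∑ n ∈ osf N, w n * (jacobiSym n k : ℂ)‖ ^ 2 ≤ Λ * ∑ n ∈ osf N, ‖w n‖ ^ 2 := by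
    apply mat_dual hΛ (fun k n => (jacobiSym n k : ℂ))
    intro y
    refine le_trans ?_ (h y)
    refine Finset.sum_le_sum_of_subset_of_nonneg ?_ (fun _ _ _ => by positivity)
    intro n hn
    exact mem_sqf.mpr ⟨(mem_osf.mp hn).1, (mem_osf.mp hn).2.2⟩
  set w1 : ℕ → ℂ := fun n => if n % 4 = 1 then x n else 0 with hw1
  set w3 : ℕ → ℂ := fun n => if n % 4 = 1 then 0 else x n with hw3
  have key : ∀ k ∈ osf X, ‖Sx (osf N) x k‖ ^ 2 ≤ 2 * ‖∑ n ∈ osf N, w1 n * (jacobiSym n k : ℂ)‖ ^ 2 + 2 * ‖∑ n ∈ osf N, w3 n * (jacobiSym n k : ℂ)‖ ^ 2 := by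
    intro k hk
    have hko := (mem_osf.mp hk).2.1
    set s : ℂ := if k % 4 = 1 then 1 else -1 with hs
    have hsn : ‖s‖ = 1 := by rw [hs]; split_ifs <;> simp
    have e : Sx (osf N) x k = ∑ n ∈ osf N, w1 n * (jacobiSym n k : ℂ) + s * ∑ n ∈ osf N, w3 n * (jacobiSym n k : ℂ) := by
      rw [Finset.mul_sum, ← Finset.sum_add_distrib, Sx]
      refine Finset.sum_congr rfl fun n hn => ?_
      have hno := (mem_osf.mp hn).2.1
      by_cases hc : n % 4 = 1
      · have := jacobiSym.quadratic_reciprocity_one_mod_four hc hko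
        simp only [hw1, hw3, hc, if_true, zero_mul, mul_zero, add_zero, this]
      · simp only [hw1, hw3, hc, if_false, zero_mul, zero_add]
        have hn3 : n % 4 = 3 := by obtain ⟨t, ht⟩ := hno; omega
        by_cases hk1 : k % 4 = 1
        · have := jacobiSym.quadratic_reciprocity_one_mod_four hk1 hno
          simp only [hs, hk1, if_true, one_mul, this]
        · have hk3 : k % 4 = 3 := by obtain ⟨t, ht⟩ := hko; omega
          have := jacobiSym.quadratic_reciprocity_three_mod_four hk3 hn3
          simp only [hs, hk1, if_false, this]
          push_cast; ring
    rw [e]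
    have h1 := norm_add_le (∑ n ∈ osf N, w1 n * (jacobiSym n k : ℂ)) (s * ∑ n ∈ osf N, w3 n * (jacobiSym n k : ℂ))
    rw [norm_mul, hsn, one_mul] at h1
    refine (pow_le_pow_left₀ (norm_nonneg _) h1 2).trans ?_
    nlinarith [sq_nonneg (‖∑ n ∈ osf N, w1 n * (jacobiSym n k : ℂ)‖ - ‖∑ n ∈ osf N, w3 n * (jacobiSym n k : ℂ)‖)]
  have b1 : ∑ n ∈ osf N, ‖w1 n‖ ^ 2 ≤ ∑ n ∈ osf N, ‖x n‖ ^ 2 := by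
    refine Finset.sum_le_sum fun n _ => ?_
    simp only [hw1]; split_ifs <;> simp
  have b3 : ∑ n ∈ osf N, ‖w3 n‖ ^ 2 ≤ ∑ n ∈ osf N, ‖x n‖ ^ 2 := by
    refine Finset.sum_le_sum fun n _ => ?_
    simp only [hw3]; split_ifs <;> simp
  refine (Finset.sum_le_sum key).trans ?_
  rw [Finset.sum_add_distrib, ← Finset.mul_sum, ← Finset.mul_sum]
  have c1 := (hd w1).trans (mul_le_mul_of_nonneg_left b1 hΛ)
  have c3 := (hd w3).trans (mul_le_mul_of_nonneg_left b3 hΛ)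
  linarith

lemma SB_dual {X N Λ : ℝ} (hX : 0 ≤ X) (hΛ : 0 ≤ Λ) (h : SB N (osf X) Λ) : SB X (osf N) (8 * Λ) := by
  intro x
  set B := ∑ n ∈ osf N, ‖x n‖ ^ 2 with hB
  have h1 := dual_odd hΛ h x
  have h2 := dual_odd hΛ h (fun n => x n * (jacobiSym 2 n : ℂ))
  have hsub : sqf X ⊆ osf X ∪ (osf X).image (fun k => 2 * k) := by
    intro k hk
    obtain ⟨a1, a2⟩ := mem_sqf.mp hk
    rcases Nat.even_or_odd k with he | ho
    · obtain ⟨j, hj⟩ := he.two_dvd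
      refine Finset.mem_union_right _ (Finset.mem_image.mpr ⟨j, mem_osf.mpr ⟨?_, ?_, ?_⟩, hj.symm⟩)
      · rw [hj] at a1; push_cast at a1
        have : (0 : ℝ) ≤ j := by positivity
        linarith
      · by_contra hne
        rw [Nat.not_odd_iff_even] at hne
        obtain ⟨i, hi⟩ := hne.two_dvd
        have := a2 2 ⟨i, by rw [hj, hi]; ring⟩
        simp at this
      · exact a2.squarefree_of_dvd ⟨2, by rw [hj]; ring⟩
    · exact Finset.mem_union_left _ (mem_osf.mpr ⟨a1, ho, a2⟩)
  have h3 : ∑ k ∈ sqf X, ‖Sx (osf N) x k‖ ^ 2 ≤ ∑ k ∈ osf X, ‖Sx (osf N) x k‖ ^ 2 + ∑ k ∈ osf X, ‖Sx (osf N) x (2 * k)‖ ^ 2 := by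
    refine (Finset.sum_le_sum_of_subset_of_nonneg hsub (fun _ _ _ => by positivity)).trans ?_
    have hu := Finset.sum_union_inter (s₁ := osf X) (s₂ := (osf X).image (fun k => 2 * k)) (f := fun k => ‖Sx (osf N) x k‖ ^ 2)
    rw [Finset.sum_image (fun a _ b _ h => by simpa using h)] at hu
    rw [← hu]
    have : 0 ≤ ∑ k ∈ osf X ∩ (osf X).image (fun k => 2 * k), ‖Sx (osf N) x k‖ ^ 2 := by positivity
    linarith
  have h4 : ∀ k, Sx (osf N) x (2 * k) = Sx (osf N) (fun n => x n * (jacobiSym 2 n : ℂ)) k := by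
    intro k
    refine Finset.sum_congr rfl fun n _ => ?_
    push_cast
    rw [jacobiSym.mul_left]
    push_cast; ring
  have h5 : ∑ n ∈ osf N, ‖x n * (jacobiSym 2 n : ℂ)‖ ^ 2 ≤ B := by
    refine Finset.sum_le_sum fun n _ => ?_
    rw [norm_mul]
    have := norm_jac_le 2 n
    exact pow_le_pow_left₀ (by positivity) (mul_le_of_le_one_right (norm_nonneg _) this) 2
  simp only [h4] at h3
  have h6 : 4 * Λ * ∑ n ∈ osf N, ‖x n * (jacobiSym 2 n : ℂ)‖ ^ 2 ≤ 4 * Λ * B := by gcongr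
  have := h3.trans (add_le_add h1 (h2.trans h6))
  rw [hB]
  linarith

/-- the bound with exponent `α` -/
def PB (α : ℝ) : Prop := ∀ ε : ℝ, 0 < ε → ∃ C : ℝ, 0 < C ∧ ∀ M N : ℝ, 1 ≤ M → 1 ≤ N → SB M (osf N) (C * (M * N) ^ ε * (M + N ^ α))

lemma PB.dual {α : ℝ} (h : PB α) {ε : ℝ} (hε : 0 < ε) : ∃ C : ℝ, 0 < C ∧ ∀ X N : ℝ, 1 ≤ X → 1 ≤ N →
    SB X (osf N) (C * (X * N) ^ ε * (N + X ^ α)) := by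
  obtain ⟨C, hC, h⟩ := h ε hε
  refine ⟨8 * C, by positivity, fun X N hX hN => ?_⟩
  have h1 := SB_dual (by linarith) (by positivity) (h N X hN hX)
  refine h1.mono le_rfl subset_rfl (le_of_eq ?_)
  rw [mul_comm N X]; ring

lemma PB.wdual {α : ℝ} (h : PB α) (hα0 : 0 ≤ α) (hα : α ≤ 9) {ε : ℝ} (hε : 0 < ε) : ∃ C : ℝ, 0 < C ∧ ∀ X N : ℝ, 1 ≤ X → 1 ≤ N →
    WB X (osf N) (C * (X * N) ^ ε * (N + X ^ α)) := by
  set ε' := min ε 1 with hε'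
  have hε'0 : 0 < ε' := lt_min hε one_pos
  obtain ⟨C, hC, h⟩ := h.dual hε'0
  refine ⟨2 ^ 13 * C, by positivity, fun X N hX hN => ?_⟩
  have hXN : 1 ≤ X * N := by nlinarith
  have h1 : WB X (osf N) (2 ^ 13 * (C * (X * N) ^ ε' * (N + X ^ α))) := by
    refine WB_of hX (by positivity) fun i => ?_
    have h2i : (1 : ℝ) ≤ 2 ^ i := one_le_pow₀ (by norm_num)
    refine (h (2 ^ i * X) N (by nlinarith) hN).mono le_rfl subset_rfl ?_
    have e1 : (2 ^ i * X * N) ^ ε' ≤ 2 ^ i * (X * N) ^ ε' := by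
      rw [mul_assoc, Real.mul_rpow (by positivity) (by positivity)]
      gcongr
      calc ((2 : ℝ) ^ i) ^ ε' ≤ ((2 : ℝ) ^ i) ^ (1 : ℝ) := Real.rpow_le_rpow_of_exponent_le h2i (min_le_right _ _)
        _ = _ := Real.rpow_one _
    have e2 : N + (2 ^ i * X) ^ α ≤ 2 ^ (9 * i) * (N + X ^ α) := by
      rw [Real.mul_rpow (by positivity) (by positivity)]
      have e3 : ((2 : ℝ) ^ i) ^ α ≤ 2 ^ (9 * i) := by
        calc ((2 : ℝ) ^ i) ^ α ≤ ((2 : ℝ) ^ i) ^ (9 : ℝ) := Real.rpow_le_rpow_of_exponent_le h2i hα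
          _ = _ := by rw [show (9:ℝ) = ((9:ℕ):ℝ) by norm_num, Real.rpow_natCast, mul_comm 9 i, pow_mul]
      have e4 : (1 : ℝ) ≤ 2 ^ (9 * i) := one_le_pow₀ (by norm_num)
      have : 0 ≤ X ^ α := by positivity
      nlinarith
    calc C * (2 ^ i * X * N) ^ ε' * (N + (2 ^ i * X) ^ α) ≤ C * (2 ^ i * (X * N) ^ ε') * (2 ^ (9 * i) * (N + X ^ α)) := by gcongr
      _ = C * (X * N) ^ ε' * (N + X ^ α) * (2 ^ (i + 9 * i)) := by rw [pow_add]; ring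
      _ ≤ _ := by
        gcongr
        · norm_num
        · omega
  refine h1.mono subset_rfl ?_
  have : (X * N) ^ ε' ≤ (X * N) ^ ε := Real.rpow_le_rpow_of_exponent_le hXN (min_le_left _ _)
  calc _ ≤ 2 ^ 13 * (C * (X * N) ^ ε * (N + X ^ α)) := by gcongr
    _ = _ := by ring

lemma PB.main {α : ℝ} (h : PB α) (hα1 : 1 ≤ α) (hα : α ≤ 9) {ε : ℝ} (hε : 0 < ε) : ∃ C : ℝ, 0 < C ∧
    ∀ (M N E0 E Λ : ℝ) (A : Finset ℕ), 1 ≤ M → 1 ≤ N → 1 ≤ E0 → 1 ≤ E → 0 ≤ Λ → A ⊆ osf N →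
    (∀ n ∈ A, ∀ e : ℕ, 1 ≤ e → e.primeFactors ⊆ n.primeFactors → (e : ℝ) ≤ E → (e : ℝ) ≤ E0) →
    WB (max 1 (M / E)) (osf N) Λ →
    SB M A (C * (M * N * E0) ^ ε * (M + N + Λ + N ^ (2 * α - 1) * E0 ^ (7 * α) * M ^ (1 - α))) := by
  obtain ⟨C0, hC0, h0⟩ := main_gen (ε := ε / 2) (by positivity)
  obtain ⟨C1, hC1, h1⟩ := h.wdual (by linarith) hα (ε := ε / 14) (by positivity)
  set C2 := C1 * 4 ^ (ε / 14) * 4 ^ α * 2 with hC2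
  have hC20 : 0 < C2 := by positivity
  refine ⟨C0 * (1 + C2), by positivity, ?_⟩
  intro M N E0 E Λ A hM hN hE0 hE hΛ hA hsm hW
  have hM0 : 0 < M := by linarith
  have hN0 : 0 < N := by linarith
  have hE00 : 0 < E0 := by linarith
  have hMN : 1 ≤ M * N := by nlinarith
  have hY : 1 ≤ M * N * E0 := by nlinarith
  set Y := M * N * E0 with hYd
  set T := N ^ (2 * α - 1) * E0 ^ (7 * α) * M ^ (1 - α) with hT
  have hT0 : 0 < T := by positivity
  set D := C2 * Y ^ (ε / 2) * (M + T) with hD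
  have hres := h0 M N E0 E Λ D A hM hN hE0 hE hΛ (by positivity) hA hsm hW ?_
  · refine hres.mono le_rfl subset_rfl ?_
    have e1 : 1 ≤ Y ^ (ε / 2) := Real.one_le_rpow hY (by positivity)
    have e2 : Y ^ ε = Y ^ (ε / 2) * Y ^ (ε / 2) := by rw [← Real.rpow_add (by linarith)]; congr 1; ring
    rw [e2]
    set W := Y ^ (ε / 2) with hW
    have e3 : M + N + Λ + D ≤ (1 + C2) * W * (M + N + Λ + T) := by
      have : M + N + Λ + D ≤ (M + N + Λ + T) * W + C2 * W * (M + N + Λ + T) := by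
        apply add_le_add
        · have : 0 ≤ M + N + Λ + T := by positivity
          nlinarith
        · rw [hD]; gcongr; linarith
      linarith
    calc C0 * W * (M + N + Λ + D) ≤ C0 * W * ((1 + C2) * W * (M + N + Λ + T)) := by gcongr
      _ = _ := by ring
  · intro Nq hq1 hqN
    set Xs := max 1 (4 * Nq ^ 2 * E0 ^ 7 / M) with hXs
    have hXs1 : 1 ≤ Xs := le_max_left _ _
    have hNq0 : 0 < Nq := by linarith
    refine (h1 Xs Nq hXs1 hq1).mono subset_rfl ?_
    have e1 : (Xs * Nq) ^ (ε / 14) ≤ 4 ^ (ε / 14) * Y ^ (ε / 2) := by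
      have : Xs * Nq ≤ 4 * Y ^ 7 := by
        have hE7 : 1 ≤ E0 ^ 7 := one_le_pow₀ hE0
        have hX : Xs ≤ 4 * N ^ 2 * E0 ^ 7 := by
          apply max_le
          · have : 1 ≤ N ^ 2 := one_le_pow₀ hN
            nlinarith
          · apply (div_le_self (by positivity) hM).trans
            gcongr
        calc Xs * Nq ≤ (4 * N ^ 2 * E0 ^ 7) * N := by gcongr
          _ = 4 * (1 * N ^ 3 * E0 ^ 7) := by ring
          _ ≤ 4 * (M ^ 7 * N ^ 7 * E0 ^ 7) := by
            gcongr
            · exact one_le_pow₀ hM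
            · norm_num
          _ = _ := by rw [hYd]; ring
      calc (Xs * Nq) ^ (ε / 14) ≤ (4 * Y ^ 7) ^ (ε / 14) := Real.rpow_le_rpow (by positivity) this (by positivity)
        _ = _ := by
          rw [Real.mul_rpow (by norm_num) (by positivity), ← Real.rpow_natCast Y 7, ← Real.rpow_mul (by linarith)]
          congr 2; push_cast; ring
    have e2 : Nq + Xs ^ α ≤ 4 ^ α * 2 * (M + T) * (Nq / M) := by
      have h4 : (1 : ℝ) ≤ 4 ^ α := Real.one_le_rpow (by norm_num) (by linarith)
      have a1 : Xs ^ α ≤ 1 + (4 * Nq ^ 2 * E0 ^ 7 / M) ^ α := by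
        rcases le_total (4 * Nq ^ 2 * E0 ^ 7 / M) 1 with hh | hh
        · rw [hXs, max_eq_left hh, Real.one_rpow]
          have : 0 ≤ (4 * Nq ^ 2 * E0 ^ 7 / M) ^ α := by positivity
          linarith
        · rw [hXs, max_eq_right hh]; linarith
      have a2 : (4 * Nq ^ 2 * E0 ^ 7 / M) ^ α ≤ 4 ^ α * T * (Nq / M) := by
        have b1 : (4 * Nq ^ 2 * E0 ^ 7 / M) ^ α = 4 ^ α * (Nq ^ (2 * α - 1) * E0 ^ (7 * α) * M ^ (1 - α)) * (Nq / M) := by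
          rw [Real.div_rpow (by positivity) (by positivity), Real.mul_rpow (by positivity) (by positivity), Real.mul_rpow (by positivity) (by positivity),
            ← Real.rpow_natCast Nq 2, ← Real.rpow_natCast E0 7, ← Real.rpow_mul (by positivity), ← Real.rpow_mul (by positivity),
            Real.rpow_sub hNq0, Real.rpow_sub hM0, Real.rpow_one, Real.rpow_one]
          push_cast
          field_simp
        rw [b1, hT]
        gcongr
        linarith
      have a3 : Nq + 1 ≤ 2 * M * (Nq / M) := by
        rw [show 2 * M * (Nq / M) = 2 * Nq by field_simp]; linarith
      have a4 : 2 * M * (Nq / M) ≤ 4 ^ α * (2 * M * (Nq / M)) := le_mul_of_one_le_left (by positivity) h4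
      have a5 : 0 ≤ 4 ^ α * T * (Nq / M) := by positivity
      calc Nq + Xs ^ α ≤ 4 ^ α * (2 * M * (Nq / M)) + 4 ^ α * T * (Nq / M) + 4 ^ α * T * (Nq / M) := by linarith
        _ = _ := by ring
    calc C1 * (Xs * Nq) ^ (ε / 14) * (Nq + Xs ^ α) ≤ C1 * (4 ^ (ε / 14) * Y ^ (ε / 2)) * (4 ^ α * 2 * (M + T) * (Nq / M)) := by gcongr
      _ = _ := by rw [hD, hC2]; ring

lemma WB_triv {X N : ℝ} (hX : 1 ≤ X) (hN : 1 ≤ N) : WB X (osf N) (2 ^ 13 * (X * N)) := by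
  refine WB_of hX (by positivity) fun i => ?_
  refine (SB_triv (X := 2 ^ i * X) (N := N) (by positivity) (by linarith)).mono le_rfl subset_rfl ?_
  have : (2 : ℝ) ^ i ≤ 2 ^ (11 * i) := pow_le_pow_right₀ (by norm_num) (by omega)
  calc 2 ^ i * X * N = X * N * 2 ^ i := by ring
    _ ≤ _ := by gcongr

lemma PB_nine : PB 9 := by
  intro ε hε
  obtain ⟨C0, hC0, h0⟩ := main_gen (ε := ε / 2) (by positivity)
  refine ⟨C0 * 2 ^ 18, by positivity, fun M N hM hN => ?_⟩
  have hM0 : 0 < M := by linarith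
  have hN0 : 0 < N := by linarith
  have hres := h0 M N N N (2 ^ 13 * (M + N)) (2 ^ 13 * (M + 4 * N ^ 2 * N ^ 7)) (osf N) hM hN hN hN (by positivity) (by positivity) subset_rfl
    (fun _ _ _ _ _ h => h) ?_ ?_
  · refine hres.mono le_rfl subset_rfl ?_
    have e0 : N ^ (9 : ℝ) = N ^ 9 := by exact_mod_cast Real.rpow_natCast N 9
    rw [e0]
    have e1 : N ≤ N ^ 9 := le_self_pow₀ hN (by norm_num)
    have e2 : (M * N * N) ^ (ε / 2) ≤ (M * N) ^ ε := by
      calc (M * N * N) ^ (ε / 2) ≤ ((M * N) ^ 2) ^ (ε / 2) := by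
            apply Real.rpow_le_rpow (by positivity) _ (by positivity)
            calc M * N * N = 1 * (M * N ^ 2) := by ring
              _ ≤ M * (M * N ^ 2) := by gcongr
              _ = _ := by ring
        _ = _ := by rw [← Real.rpow_natCast, ← Real.rpow_mul (by positivity)]; congr 1; push_cast; ring
    calc _ ≤ C0 * (M * N) ^ ε * (2 ^ 18 * (M + N ^ 9)) := by
          gcongr
          have : 4 * N ^ 2 * N ^ 7 = 4 * N ^ 9 := by ring
          rw [this]
          nlinarith
      _ = _ := by ring
  · refine (WB_triv (le_max_left _ _) hN).mono subset_rfl ?_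
    have : max 1 (M / N) ≤ 1 + M / N := max_le (by linarith [show 0 < M / N by positivity]) (by linarith)
    calc _ ≤ 2 ^ 13 * ((1 + M / N) * N) := by gcongr
      _ = _ := by field_simp; ring
  · intro Nq h1 h2
    refine (WB_triv (le_max_left _ _) h1).mono subset_rfl ?_
    have hq0 : 0 < Nq := by linarith
    have : max 1 (4 * Nq ^ 2 * N ^ 7 / M) ≤ 1 + 4 * N ^ 2 * N ^ 7 / M := by
      apply max_le
      · linarith [show 0 < 4 * N ^ 2 * N ^ 7 / M by positivity]
      · have : 4 * Nq ^ 2 * N ^ 7 / M ≤ 4 * N ^ 2 * N ^ 7 / M := by gcongr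
        linarith
    calc _ ≤ 2 ^ 13 * ((1 + 4 * N ^ 2 * N ^ 7 / M) * Nq) := by gcongr
      _ = _ := by field_simp

lemma harm_le {ε : ℝ} (hε : 0 < ε) : ∃ C : ℝ, 0 < C ∧ ∀ N : ℝ, 1 ≤ N → ∑ u ∈ Finset.Icc 1 ⌊N⌋₊, (1 / (u : ℝ)) ≤ C * N ^ ε := by
  refine ⟨1 + 1 / ε, by positivity, fun N hN => ?_⟩
  have h1 := harmonic_floor_le_one_add_log N hN
  rw [harmonic_eq_sum_Icc] at h1
  push_cast at h1
  simp only [one_div]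
  refine h1.trans ?_
  have h2 := Real.log_le_rpow_div (by linarith : 0 ≤ N) hε
  have h3 := Real.one_le_rpow hN hε.le
  calc 1 + Real.log N ≤ N ^ ε + N ^ ε / ε := by linarith
    _ = _ := by ring

lemma SB_weighted {X B L : ℝ} {A : Finset ℕ} (f : ℕ → ℕ) (I : Finset ℕ) (hI : ∀ n ∈ A, f n ∈ I) (hpos : ∀ u ∈ I, 1 ≤ u)
    (hL : ∑ u ∈ I, (1 / (u : ℝ)) ≤ L) (h : ∀ u ∈ I, SB X (A.filter fun n => f n = u) (B / u)) : SB X A (L * B) := by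
  intro x
  have hL0 : 0 ≤ L := le_trans (Finset.sum_nonneg fun u _ => by positivity) hL
  have h1 : ∀ k, ‖Sx A x k‖ ^ 2 ≤ L * ∑ u ∈ I, (u : ℝ) * ‖Sx (A.filter fun n => f n = u) x k‖ ^ 2 := by
    intro k
    have : Sx A x k = ∑ u ∈ I, Sx (A.filter fun n => f n = u) x k := by
      unfold Sx
      exact (Finset.sum_fiberwise_of_maps_to hI _).symm
    rw [this]
    calc _ ≤ (∑ u ∈ I, ‖Sx (A.filter fun n => f n = u) x k‖) ^ 2 := by gcongr; exact norm_sum_le _ _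
      _ ≤ (∑ u ∈ I, (1 / (u : ℝ))) * ∑ u ∈ I, (u : ℝ) * ‖Sx (A.filter fun n => f n = u) x k‖ ^ 2 := by
        apply Finset.sum_sq_le_sum_mul_sum_of_sq_le_mul
        · intro u _; positivity
        · intro u _; positivity
        · intro u hu
          have : (u : ℝ) ≠ 0 := by have := hpos u hu; positivity
          apply le_of_eq; field_simp
      _ ≤ _ := by gcongr
  calc _ ≤ ∑ k ∈ sqf X, L * ∑ u ∈ I, (u : ℝ) * ‖Sx (A.filter fun n => f n = u) x k‖ ^ 2 := Finset.sum_le_sum fun k _ => h1 k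
    _ = L * ∑ u ∈ I, (u : ℝ) * ∑ k ∈ sqf X, ‖Sx (A.filter fun n => f n = u) x k‖ ^ 2 := by
        rw [← Finset.mul_sum, Finset.sum_comm]; simp only [Finset.mul_sum]
    _ ≤ L * ∑ u ∈ I, (u : ℝ) * (B / u * ∑ n ∈ A.filter fun n => f n = u, ‖x n‖ ^ 2) := by
        gcongr with u hu
        exact h u hu x
    _ = L * ∑ u ∈ I, B * ∑ n ∈ A.filter fun n => f n = u, ‖x n‖ ^ 2 := by
        congr 1
        refine Finset.sum_congr rfl fun u hu => ?_
        have : (u : ℝ) ≠ 0 := by have := hpos u hu; positivity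
        field_simp
    _ = L * B * ∑ n ∈ A, ‖x n‖ ^ 2 := by
        rw [← Finset.mul_sum, Finset.sum_fiberwise_of_maps_to hI, mul_assoc]

lemma SB_div {X Λ : ℝ} {A : Finset ℕ} {u : ℕ} (hu : 1 ≤ u) (hA : ∀ n ∈ A, u ∣ n) (hA0 : ∀ n ∈ A, n ≠ 0)
    (h : SB X (A.image fun n => n / u) Λ) : SB X A Λ := by
  intro x
  have hinj : Set.InjOn (fun n => n / u) (A : Set ℕ) := by
    intro a ha b hb hab
    obtain ⟨a', rfl⟩ := hA a ha
    obtain ⟨b', rfl⟩ := hA b hb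
    simp only [Nat.mul_div_cancel_left _ hu] at hab
    rw [hab]
  have h1 := h (fun n => x (u * n))
  rw [Finset.sum_image hinj] at h1
  have e1 : ∑ n ∈ A, ‖x (u * (n / u))‖ ^ 2 = ∑ n ∈ A, ‖x n‖ ^ 2 :=
    Finset.sum_congr rfl fun n hn => by rw [Nat.mul_div_cancel' (hA n hn)]
  rw [e1] at h1
  refine le_trans (Finset.sum_le_sum fun k _ => ?_) h1
  have e2 : Sx A x k = (jacobiSym k u : ℂ) * Sx (A.image fun n => n / u) (fun n => x (u * n)) k := by
    unfold Sx
    rw [Finset.sum_image hinj, Finset.mul_sum]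
    by_cases hu0 : u = 0
    · omega
    refine Finset.sum_congr rfl fun n hn => ?_
    obtain ⟨a, rfl⟩ := hA n hn
    have ha : a ≠ 0 := fun h => hA0 _ hn (by rw [h, mul_zero])
    have : NeZero u := ⟨hu0⟩
    have : NeZero a := ⟨ha⟩
    simp only [Nat.mul_div_cancel_left _ hu]
    rw [jacobiSym.mul_right]
    push_cast; ring
  rw [e2, norm_mul]
  exact pow_le_pow_left₀ (by positivity) (mul_le_of_le_one_left (norm_nonneg _) (norm_jac_le _ _)) 2

lemma choose_u {n : ℕ} {U z : ℝ} (hn : n ≠ 0) (hU : 1 ≤ U) :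
    ∃ u : ℕ, u ∣ n ∧ 1 ≤ u ∧ (((u : ℝ) ≤ U ∧ ∀ p : ℕ, p.Prime → p ∣ n / u → z < p) ∨ (U < u ∧ (u : ℝ) ≤ U * z)) := by
  classical
  set S := n.divisors.filter (fun u : ℕ => (u : ℝ) ≤ U) with hS
  have hne : S.Nonempty := ⟨1, by simp [hS, hn, hU]⟩
  obtain ⟨u, hu, hmax⟩ := S.exists_max_image id hne
  have hu' := Finset.mem_filter.mp hu
  have hud : u ∣ n := Nat.dvd_of_mem_divisors hu'.1
  have hu1 : 1 ≤ u := Nat.pos_of_dvd_of_pos hud (Nat.pos_of_ne_zero hn)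
  by_cases h : ∀ p : ℕ, p.Prime → p ∣ n / u → z < p
  · exact ⟨u, hud, hu1, Or.inl ⟨hu'.2, h⟩⟩
  · push Not at h
    obtain ⟨p, hp, hpd, hpz⟩ := h
    have hd : u * p ∣ n := Nat.mul_dvd_of_dvd_div hud hpd
    refine ⟨u * p, hd, Nat.mul_pos hu1 hp.pos, Or.inr ⟨?_, ?_⟩⟩
    · by_contra hc
      rw [not_lt] at hc
      have : u * p ≤ u := hmax (u * p) (Finset.mem_filter.mpr ⟨Nat.mem_divisors.mpr ⟨hd, hn⟩, hc⟩)
      have := hp.two_le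
      nlinarith
    · push_cast
      have := hu'.2
      gcongr

set_option maxHeartbeats 1000000 in
lemma step_one {α : ℝ} (h : PB α) (hα1 : 1 < α) (hα : α ≤ 9) {ε : ℝ} (hε : 0 < ε) : ∃ C : ℝ, 0 < C ∧ ∀ N : ℝ, 1 ≤ N →
    SB (N ^ (1 + (α - 1) / 16)) (osf N) (C * N ^ ε * N ^ (α - (α - 1) ^ 2 / 32)) := by
  set η := (α - 1) / 16 with hη
  have hη0 : 0 < η := by rw [hη]; linarith
  have hη1 : η ≤ 1 / 2 := by rw [hη]; linarith
  have hαη : α = 1 + 16 * η := by rw [hη]; ring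
  have hc1 : (α - 1) ^ 2 / 32 = 8 * η ^ 2 := by rw [hη]; ring
  rw [hc1]
  obtain ⟨C3, hC3, h3⟩ := harm_le (ε := ε / 2) (by positivity)
  obtain ⟨C1, hC1, h1⟩ := h (ε / 12) (by positivity)
  obtain ⟨C2, hC2, h2⟩ := h.main hα1.le hα (ε := ε / 12) (by positivity)
  obtain ⟨C4, hC4, h4⟩ := h.wdual (by linarith) hα (ε := ε / 12) (by positivity)
  refine ⟨C3 * (2 * C1 + C2 * (3 + 2 * C4)), by positivity, fun N hN => ?_⟩
  have hN0 : 0 < N := by linarith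
  set M := N ^ (1 + η) with hM
  set G := N ^ (α - 8 * η ^ 2) with hG
  set U := N ^ (η * α / 2) with hU
  set z := N ^ (2 * η) with hz
  have hM1 : 1 ≤ M := Real.one_le_rpow hN (by positivity)
  have hU1 : 1 ≤ U := Real.one_le_rpow hN (by positivity)
  have hz1 : 1 ≤ z := Real.one_le_rpow hN (by positivity)
  have key : ∀ a : ℝ, a ≤ α - 8 * η ^ 2 → N ^ a ≤ G := fun a ha => Real.rpow_le_rpow_of_exponent_le hN ha
  have k1 : U * z * M ≤ G := by
    rw [hU, hz, hM, ← Real.rpow_add hN0, ← Real.rpow_add hN0]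
    apply key; nlinarith
  have k1' : U * M ≤ G := le_trans (by nlinarith [mul_pos (zero_lt_one.trans_le hU1) (zero_lt_one.trans_le hM1)]) k1
  have k2 : N ^ α * U ^ (1 - α) ≤ G := by
    rw [hU, ← Real.rpow_mul hN0.le, ← Real.rpow_add hN0]
    apply key; nlinarith
  have k3 : N ≤ G := by
    have := key 1 (by nlinarith)
    rwa [Real.rpow_one] at this
  have k4 : U * (N ^ (1 - η)) ^ α ≤ G := by
    rw [hU, ← Real.rpow_mul hN0.le, ← Real.rpow_add hN0]
    apply key; nlinarith
  have k5 : N ^ (2 * α - 1) * M ^ (1 - α) ≤ G := by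
    rw [hM, ← Real.rpow_mul hN0.le, ← Real.rpow_add hN0]
    apply key; nlinarith
  have hG0 : 0 < G := by positivity
  choose! f hf using fun (n : ℕ) (hn : n ∈ osf N) => choose_u (n := n) (U := U) (z := z) (mem_osf.mp hn).2.2.ne_zero hU1
  have hle : ∀ n ∈ osf N, (f n : ℝ) ≤ N := by
    intro n hn
    have := Nat.le_of_dvd (Nat.pos_of_ne_zero (mem_osf.mp hn).2.2.ne_zero) (hf n hn).1
    exact le_trans (by exact_mod_cast this) (mem_osf.mp hn).1
  have hres := SB_weighted (X := M) (B := (2 * C1 + C2 * (3 + 2 * C4)) * N ^ (ε / 2) * G) (A := osf N) f (Finset.Icc 1 ⌊N⌋₊)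
    (fun n hn => Finset.mem_Icc.mpr ⟨(hf n hn).2.1, Nat.le_floor (hle n hn)⟩) (fun u hu => (Finset.mem_Icc.mp hu).1) (h3 N hN) ?_
  · refine hres.mono le_rfl subset_rfl (le_of_eq ?_)
    have e2 : N ^ ε = N ^ (ε / 2) * N ^ (ε / 2) := by rw [← Real.rpow_add hN0]; congr 1; ring
    rw [e2]; ring
  · intro u hu
    obtain ⟨hu1, huN⟩ := Finset.mem_Icc.mp hu
    have huN' : (u : ℝ) ≤ N := (Nat.le_floor_iff hN0.le).mp huN
    have hu1' : (1 : ℝ) ≤ u := by exact_mod_cast hu1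
    have hu0 : (0 : ℝ) < u := by linarith
    have hNu : 1 ≤ N / u := by rw [le_div_iff₀ hu0]; linarith
    have hNu' : N / u ≤ N := div_le_self hN0.le hu1'
    have hmem : ∀ n ∈ (osf N).filter (fun n => f n = u), n ∈ osf N ∧ f n = u := fun n hn => Finset.mem_filter.mp hn
    have hEp : ∀ X : ℝ, 1 ≤ X → X ≤ N ^ (3 : ℝ) → X ^ (ε / 12) ≤ N ^ (ε / 4) := by
      intro X hX hX3
      calc X ^ (ε / 12) ≤ (N ^ (3 : ℝ)) ^ (ε / 12) := Real.rpow_le_rpow (by linarith) hX3 (by positivity)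
        _ = _ := by rw [← Real.rpow_mul hN0.le]; congr 1; ring
    have hMN3 : M * (N / u) ≤ N ^ (3 : ℝ) := by
      calc M * (N / u) ≤ M * N := by gcongr
        _ = N ^ (1 + η + 1) := by rw [Real.rpow_add_one hN0.ne']
        _ ≤ _ := Real.rpow_le_rpow_of_exponent_le hN (by linarith)
    have hMN1 : 1 ≤ M * (N / u) := by nlinarith
    have hW1 : 1 ≤ N ^ (ε / 4) := Real.one_le_rpow hN (by positivity)
    have hWW : N ^ (ε / 2) = N ^ (ε / 4) * N ^ (ε / 4) := by rw [← Real.rpow_add hN0]; congr 1; ring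
    set W := N ^ (ε / 4) with hW
    set Au := (osf N).filter (fun n => f n = u) with hAu
    have himg : (Au.image fun n => n / u) ⊆ osf (N / u) := by
      intro q hq
      obtain ⟨n, hn, rfl⟩ := Finset.mem_image.mp hq
      obtain ⟨hn1, hn2⟩ := hmem n hn
      have hd : u ∣ n := hn2 ▸ (hf n hn1).1
      obtain ⟨a1, a2, a3⟩ := mem_osf.mp hn1
      refine mem_osf.mpr ⟨?_, ?_, ?_⟩
      · rw [Nat.cast_div hd hu0.ne']; gcongr
      · exact Odd.of_dvd_nat a2 (Nat.div_dvd_of_dvd hd)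
      · exact a3.squarefree_of_dvd (Nat.div_dvd_of_dvd hd)
    refine SB_div hu1 (fun n hn => ?_) (fun n hn => (mem_osf.mp (hmem n hn).1).2.2.ne_zero) ?_
    · obtain ⟨hn1, hn2⟩ := hmem n hn
      exact hn2 ▸ (hf n hn1).1
    by_cases hcase : (u : ℝ) ≤ U
    · have hsm : ∀ q ∈ (Au.image fun n => n / u), ∀ e : ℕ, 1 ≤ e → e.primeFactors ⊆ q.primeFactors → (e : ℝ) ≤ z → (e : ℝ) ≤ 1 := by
        intro q hq e he1 hep hez
        obtain ⟨n, hn, rfl⟩ := Finset.mem_image.mp hq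
        obtain ⟨hn1, hn2⟩ := hmem n hn
        have hrough : ∀ p : ℕ, p.Prime → p ∣ n / u → z < p := by
          rcases (hf n hn1).2.2 with hh | hh
          · rw [hn2] at hh; exact hh.2
          · rw [hn2] at hh; exact absurd hcase (not_le.mpr hh.1)
        by_contra hc
        have he1' : e ≠ 1 := by rintro rfl; simp at hc
        obtain ⟨p, hp, hpe⟩ := Nat.exists_prime_and_dvd he1'
        have hpm : p ∈ (n / u).primeFactors := hep (Nat.mem_primeFactors.mpr ⟨hp, hpe, by omega⟩)
        have h5 := hrough p hp (Nat.dvd_of_mem_primeFactors hpm)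
        have h6 : (p : ℝ) ≤ e := by exact_mod_cast Nat.le_of_dvd (by omega) hpe
        linarith
      have hMz : max 1 (M / z) = N ^ (1 - η) := by
        rw [hM, hz, ← Real.rpow_sub hN0, show 1 + η - 2 * η = 1 - η by ring]
        exact max_eq_right (Real.one_le_rpow hN (by linarith))
      have hX1 : 1 ≤ N ^ (1 - η) := Real.one_le_rpow hN (by linarith)
      have hwb := h4 (N ^ (1 - η)) (N / u) hX1 hNu
      rw [← hMz] at hwb
      have hr := h2 M (N / u) 1 z _ (Au.image fun n => n / u) hM1 hNu le_rfl hz1 (by positivity) himg hsm hwb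
      refine hr.mono le_rfl subset_rfl ?_
      rw [hMz, mul_one, Real.one_rpow, mul_one]
      have b1 := hEp _ hMN1 hMN3
      have b2 : (N ^ (1 - η) * (N / u)) ^ (ε / 12) ≤ W := by
        refine hEp _ (by nlinarith) (le_trans ?_ hMN3)
        gcongr
        rw [hM]
        exact Real.rpow_le_rpow_of_exponent_le hN (by linarith)
      have c1 : M * u ≤ G := by rw [mul_comm]; exact (mul_le_mul_of_nonneg_right hcase (by positivity)).trans k1'
      have c2 : N / u * u ≤ G := by rw [div_mul_cancel₀ _ hu0.ne']; exact k3
      have c3 : (N / u + (N ^ (1 - η)) ^ α) * u ≤ 2 * G := by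
        rw [add_mul]
        have : (N ^ (1 - η)) ^ α * u ≤ G := by
          rw [mul_comm]; exact (mul_le_mul_of_nonneg_right hcase (by positivity)).trans k4
        linarith
      have c4 : (N / u) ^ (2 * α - 1) * M ^ (1 - α) * u ≤ G := by
        refine le_trans ?_ k5
        have : (N / u) ^ (2 * α - 1) * u ≤ N ^ (2 * α - 1) := by
          rw [Real.div_rpow hN0.le hu0.le, div_mul_eq_mul_div, div_le_iff₀ (by positivity)]
          gcongr
          calc (u : ℝ) = (u : ℝ) ^ (1 : ℝ) := (Real.rpow_one _).symm
            _ ≤ _ := Real.rpow_le_rpow_of_exponent_le hu1' (by linarith)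
        calc _ = (N / u) ^ (2 * α - 1) * u * M ^ (1 - α) := by ring
          _ ≤ _ := by gcongr
      rw [le_div_iff₀ hu0, hWW]
      calc C2 * (M * (N / u)) ^ (ε / 12) * (M + N / u + C4 * (N ^ (1 - η) * (N / u)) ^ (ε / 12) * (N / u + (N ^ (1 - η)) ^ α) + (N / u) ^ (2 * α - 1) * M ^ (1 - α)) * u
          ≤ C2 * W * (M + N / u + C4 * W * (N / u + (N ^ (1 - η)) ^ α) + (N / u) ^ (2 * α - 1) * M ^ (1 - α)) * u := by gcongr
        _ = C2 * W * (M * u + N / u * u + C4 * W * ((N / u + (N ^ (1 - η)) ^ α) * u) + (N / u) ^ (2 * α - 1) * M ^ (1 - α) * u) := by ring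
        _ ≤ C2 * W * (G + G + C4 * W * (2 * G) + G) := by gcongr
        _ = C2 * W * (3 * 1 + 2 * C4 * W) * G := by ring
        _ ≤ C2 * W * (3 * W + 2 * C4 * W) * G := by gcongr
        _ = C2 * (3 + 2 * C4) * (W * W) * G := by ring
        _ ≤ _ := by
          gcongr
          linarith
    · rcases Finset.eq_empty_or_nonempty Au with he | ⟨n, hn⟩
      · rw [he]
        intro x
        simp [Sx]
      obtain ⟨hn1, hn2⟩ := hmem n hn
      have hU2 : U < u ∧ (u : ℝ) ≤ U * z := by
        rcases (hf n hn1).2.2 with hh | hh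
        · rw [hn2] at hh; exact absurd hh.1 hcase
        · rwa [hn2] at hh
      refine (h1 M (N / u) hM1 hNu).mono le_rfl himg ?_
      have b1 := hEp _ hMN1 hMN3
      rw [le_div_iff₀ hu0, hWW]
      have c1 : M * u ≤ G := by rw [mul_comm]; exact (mul_le_mul_of_nonneg_right hU2.2 (by positivity)).trans k1
      have c2 : (N / u) ^ α * u ≤ G := by
        refine le_trans ?_ k2
        have : (N / u) ^ α * u = N ^ α * (u : ℝ) ^ (1 - α) := by
          rw [Real.div_rpow hN0.le hu0.le, Real.rpow_sub hu0, Real.rpow_one]; field_simp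
        rw [this]
        exact mul_le_mul_of_nonneg_left (Real.rpow_le_rpow_of_nonpos (zero_lt_one.trans_le hU1) hU2.1.le (by linarith)) (by positivity)
      calc C1 * (M * (N / u)) ^ (ε / 12) * (M + (N / u) ^ α) * u ≤ C1 * W * (M + (N / u) ^ α) * u := by gcongr
        _ = C1 * (W * 1) * (M * u + (N / u) ^ α * u) := by ring
        _ ≤ C1 * (W * W) * (G + G) := by gcongr
        _ = 2 * C1 * (W * W) * G := by ring
        _ ≤ _ := by
          gcongr
          have : 0 < C2 * (3 + 2 * C4) := by positivity
          linarith

/-- restricted range bound -/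
def QB (α' β : ℝ) : Prop := ∀ ε : ℝ, 0 < ε → ∃ C : ℝ, 0 < C ∧ ∀ M N : ℝ, 1 ≤ M → 1 ≤ N → M ≤ N ^ β →
  SB M (osf N) (C * N ^ ε * (M + N ^ α'))

set_option maxHeartbeats 1000000 in
lemma QB_step {α β κ : ℝ} (h : PB α) (hα1 : 1 < α) (hα : α ≤ 9) (hκ : κ = (α - 1) ^ 2 / 4032) (hβ : 1 + (α - 1) / 16 ≤ β)
    (hQ : QB (α - κ) β) : QB (α - κ) (β + κ) := by
  intro ε hε
  have hκ0 : 0 < κ := by rw [hκ]; have : 0 < α - 1 := by linarith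
                         positivity
  have hκ1 : κ ≤ 1 / 60 := by rw [hκ]; nlinarith
  have hκδ : 1 ≤ α - κ := by rw [hκ]; nlinarith
  have hβ0 : 0 < β + 3 := by linarith
  have hβ1 : 1 ≤ β := by linarith
  set ε1 := ε / (2 * (β + 3)) with hε1
  have hε10 : 0 < ε1 := by positivity
  set ε2 := min 1 ε1 with hε2
  have hε20 : 0 < ε2 := lt_min one_pos hε10
  obtain ⟨C1, hC1, h1⟩ := hQ (ε / 2) (by positivity)
  obtain ⟨C2, hC2, h2⟩ := h ε2 hε20
  obtain ⟨C3, hC3, h3⟩ := h.main hα1.le hα hε10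
  refine ⟨C1 + C3 * (3 + 2 ^ 13 * (C1 + C2)), by positivity, fun M N hM hN hMN => ?_⟩
  have hN0 : 0 < N := by linarith
  have hM0 : 0 < M := by linarith
  set F := N ^ (α - κ) with hF
  have hF0 : 0 < F := by positivity
  have hW1 : 1 ≤ N ^ (ε / 2) := Real.one_le_rpow hN (by positivity)
  have hWW : N ^ ε = N ^ (ε / 2) * N ^ (ε / 2) := by rw [← Real.rpow_add hN0]; congr 1; ring
  set W := N ^ (ε / 2) with hW
  have hNF : N ≤ F := by
    have := Real.rpow_le_rpow_of_exponent_le hN hκδ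
    rwa [Real.rpow_one] at this
  have hEp : ∀ X : ℝ, 1 ≤ X → X ≤ N ^ (β + 3) → X ^ ε1 ≤ W := by
    intro X hX hX3
    calc X ^ ε1 ≤ (N ^ (β + 3)) ^ ε1 := Real.rpow_le_rpow (by linarith) hX3 (by positivity)
      _ = _ := by rw [← Real.rpow_mul hN0.le, hε1]; congr 1; field_simp
  rcases le_or_gt M (N ^ β) with hc | hc
  · refine (h1 M N hM hN hc).mono le_rfl subset_rfl ?_
    rw [hWW]
    have : 0 < C3 * (3 + 2 ^ 13 * (C1 + C2)) := by positivity
    calc C1 * W * (M + F) = C1 * (W * 1) * (M + F) := by ring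
      _ ≤ (C1 + C3 * (3 + 2 ^ 13 * (C1 + C2))) * (W * W) * (M + F) := by gcongr; linarith
  set E := N ^ (2 * κ) with hE
  have hE1 : 1 ≤ E := Real.one_le_rpow hN (by positivity)
  set X := max 1 (M / E) with hX
  have hX1 : 1 ≤ X := le_max_left _ _
  have hXM : X ≤ M := max_le hM (div_le_self hM0.le hE1)
  have hXN : X ≤ N ^ (β - κ) := by
    apply max_le
    · exact Real.one_le_rpow hN (by linarith)
    · rw [div_le_iff₀ (by positivity), hE, ← Real.rpow_add hN0]
      rwa [show β - κ + 2 * κ = β + κ by ring]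
  have hwb : WB X (osf N) (2 ^ 13 * ((C1 + C2) * W * (M + F))) := by
    refine WB_of hX1 (by positivity) fun i => ?_
    have h2i : (1 : ℝ) ≤ 2 ^ i := one_le_pow₀ (by norm_num)
    have h2i' : (2 : ℝ) ^ i * 2 ^ i ≤ 2 ^ (11 * i) := by
      rw [← pow_add]; exact pow_le_pow_right₀ (by norm_num) (by omega)
    rcases le_or_gt (2 ^ i * X) (N ^ β) with hd | hd
    · refine (h1 (2 ^ i * X) N (by nlinarith) hN hd).mono le_rfl subset_rfl ?_
      calc C1 * W * (2 ^ i * X + F) ≤ C1 * W * (2 ^ i * M + 2 ^ i * F) := by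
            gcongr
            exact le_mul_of_one_le_left hF0.le h2i
        _ = C1 * W * (M + F) * (2 ^ i * 1) := by ring
        _ ≤ C1 * W * (M + F) * (2 ^ i * 2 ^ i) := by gcongr
        _ ≤ (C1 + C2) * W * (M + F) * 2 ^ (11 * i) := by gcongr; linarith
    · have h2k : N ^ κ ≤ 2 ^ i := by
        by_contra hcc
        rw [not_le] at hcc
        have : 2 ^ i * X ≤ N ^ κ * N ^ (β - κ) := by gcongr
        rw [← Real.rpow_add hN0, show κ + (β - κ) = β by ring] at this
        linarith
      have hNa : N ^ α ≤ 2 ^ i * F := by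
        calc N ^ α = N ^ κ * F := by rw [hF, ← Real.rpow_add hN0]; congr 1; ring
          _ ≤ _ := by gcongr
      refine (h2 (2 ^ i * X) N (by nlinarith) hN).mono le_rfl subset_rfl ?_
      have hXN1 : 1 ≤ X * N := by nlinarith
      have e1 : (2 ^ i * X * N) ^ ε2 ≤ 2 ^ i * W := by
        rw [mul_assoc, Real.mul_rpow (by positivity) (by positivity)]
        gcongr
        · calc ((2 : ℝ) ^ i) ^ ε2 ≤ ((2 : ℝ) ^ i) ^ (1 : ℝ) := Real.rpow_le_rpow_of_exponent_le h2i (min_le_left _ _)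
            _ = _ := Real.rpow_one _
        · calc (X * N) ^ ε2 ≤ (X * N) ^ ε1 := Real.rpow_le_rpow_of_exponent_le hXN1 (min_le_right _ _)
            _ ≤ _ := by
              apply hEp _ hXN1
              calc X * N ≤ N ^ (β - κ) * N := by gcongr
                _ = N ^ (β - κ + 1) := by rw [Real.rpow_add_one hN0.ne']
                _ ≤ _ := Real.rpow_le_rpow_of_exponent_le hN (by linarith)
      calc C2 * (2 ^ i * X * N) ^ ε2 * (2 ^ i * X + N ^ α) ≤ C2 * (2 ^ i * W) * (2 ^ i * M + 2 ^ i * F) := by gcongr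
        _ = C2 * W * (M + F) * (2 ^ i * 2 ^ i) := by ring
        _ ≤ (C1 + C2) * W * (M + F) * 2 ^ (11 * i) := by gcongr; linarith
  have hr := h3 M N E E _ (osf N) hM hN hE1 hE1 (by positivity) subset_rfl (fun _ _ _ _ _ h => h) hwb
  refine hr.mono le_rfl subset_rfl ?_
  have b1 : (M * N * E) ^ ε1 ≤ W := by
    have : 1 ≤ M * N := by nlinarith
    apply hEp _ (by nlinarith)
    calc M * N * E ≤ N ^ (β + κ) * N * N ^ (2 * κ) := by gcongr
      _ = N ^ (β + κ + 1 + 2 * κ) := by rw [Real.rpow_add hN0 (β + κ + 1), Real.rpow_add_one hN0.ne']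
      _ ≤ _ := Real.rpow_le_rpow_of_exponent_le hN (by linarith)
  have b2 : N ^ (2 * α - 1) * E ^ (7 * α) * M ^ (1 - α) ≤ F := by
    have c1 : M ^ (1 - α) ≤ (N ^ β) ^ (1 - α) := Real.rpow_le_rpow_of_nonpos (by positivity) hc.le (by linarith)
    calc _ ≤ N ^ (2 * α - 1) * E ^ (7 * α) * (N ^ β) ^ (1 - α) := by gcongr
      _ = N ^ (2 * α - 1 + 2 * κ * (7 * α) + β * (1 - α)) := by
        rw [hE, ← Real.rpow_mul hN0.le, ← Real.rpow_mul hN0.le, ← Real.rpow_add hN0, ← Real.rpow_add hN0]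
      _ ≤ _ := by
        apply Real.rpow_le_rpow_of_exponent_le hN
        have d1 : β * (1 - α) ≤ (1 + (α - 1) / 16) * (1 - α) := by nlinarith
        have d2 : 2 * κ * (7 * α) ≤ 126 * κ := by nlinarith
        have d3 : 127 * κ ≤ (α - 1) ^ 2 / 16 := by rw [hκ]; nlinarith [sq_nonneg (α - 1)]
        nlinarith
  rw [hWW]
  calc C3 * (M * N * E) ^ ε1 * (M + N + 2 ^ 13 * ((C1 + C2) * W * (M + F)) + N ^ (2 * α - 1) * E ^ (7 * α) * M ^ (1 - α))
      ≤ C3 * W * (M + F + 2 ^ 13 * ((C1 + C2) * W * (M + F)) + F) := by gcongr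
    _ ≤ C3 * W * (3 * 1 * (M + F) + 2 ^ 13 * ((C1 + C2) * W * (M + F))) :=
        mul_le_mul_of_nonneg_left (by linarith) (by positivity)
    _ ≤ C3 * W * (3 * W * (M + F) + 2 ^ 13 * ((C1 + C2) * W * (M + F))) := by gcongr
    _ = C3 * (3 + 2 ^ 13 * (C1 + C2)) * (W * W) * (M + F) := by ring
    _ ≤ _ := by gcongr; linarith

lemma PB_improve {α : ℝ} (h : PB α) (hα1 : 1 < α) (hα : α ≤ 9) : PB (α - (α - 1) ^ 2 / 4032) := by
  set κ := (α - 1) ^ 2 / 4032 with hκ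
  have hκ0 : 0 < κ := by rw [hκ]; have : 0 < α - 1 := by linarith
                         positivity
  have hQ : ∀ j : ℕ, QB (α - κ) (1 + (α - 1) / 16 + j * κ) := by
    intro j
    induction j with
    | zero =>
      intro ε hε
      obtain ⟨C, hC, h0⟩ := step_one h hα1 hα hε
      refine ⟨C, hC, fun M N hM hN hMN => ?_⟩
      refine (h0 N hN).mono (by simpa using hMN) subset_rfl ?_
      gcongr
      have : N ^ (α - (α - 1) ^ 2 / 32) ≤ N ^ (α - κ) := by
        apply Real.rpow_le_rpow_of_exponent_le hN
        rw [hκ]; nlinarith [sq_nonneg (α - 1)]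
      linarith
    | succ j ih =>
      have := QB_step h hα1 hα hκ (by have : 0 ≤ j * κ := by positivity
                                      linarith) ih
      convert this using 1
      push_cast; ring
  obtain ⟨j, hj⟩ := exists_nat_ge (α / κ)
  rw [div_le_iff₀ hκ0] at hj
  intro ε hε
  obtain ⟨C1, hC1, h1⟩ := hQ j ε hε
  obtain ⟨C2, hC2, h2⟩ := h ε hε
  refine ⟨C1 + 2 * C2, by positivity, fun M N hM hN => ?_⟩
  have hN0 : 0 < N := by linarith
  have hM0 : 0 < M := by linarith
  rcases le_total M (N ^ α) with hc | hc
  · refine (h1 M N hM hN (hc.trans (Real.rpow_le_rpow_of_exponent_le hN (by linarith)))).mono le_rfl subset_rfl ?_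
    gcongr
    · linarith
    · nlinarith
  · refine (h2 M N hM hN).mono le_rfl subset_rfl ?_
    have : 0 < N ^ (α - κ) := by positivity
    calc C2 * (M * N) ^ ε * (M + N ^ α) ≤ C2 * (M * N) ^ ε * (2 * (M + N ^ (α - κ))) := by gcongr; linarith
      _ = 2 * C2 * (M * N) ^ ε * (M + N ^ (α - κ)) := by ring
      _ ≤ _ := by gcongr; linarith

lemma PB_of_gt {α : ℝ} (h : ∀ δ : ℝ, 0 < δ → ∃ a : ℝ, a ≤ α + δ ∧ PB a) : PB α := by
  intro ε hε
  obtain ⟨a, ha, h⟩ := h (ε / 2) (by positivity)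
  obtain ⟨C, hC, h⟩ := h (ε / 2) (by positivity)
  refine ⟨C, hC, fun M N hM hN => ?_⟩
  have hN0 : 0 < N := by linarith
  have hM0 : 0 < M := by linarith
  refine (h M N hM hN).mono le_rfl subset_rfl ?_
  have hMN : 1 ≤ M * N := by nlinarith
  have e1 : N ^ a ≤ (M * N) ^ (ε / 2) * N ^ α := by
    calc N ^ a ≤ N ^ (α + ε / 2) := Real.rpow_le_rpow_of_exponent_le hN ha
      _ = N ^ (ε / 2) * N ^ α := by rw [add_comm, Real.rpow_add hN0]
      _ ≤ _ := by gcongr; nlinarith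
  have e2 : M ≤ (M * N) ^ (ε / 2) * M := le_mul_of_one_le_left hM0.le (Real.one_le_rpow hMN (by positivity))
  calc C * (M * N) ^ (ε / 2) * (M + N ^ a) ≤ C * (M * N) ^ (ε / 2) * ((M * N) ^ (ε / 2) * M + (M * N) ^ (ε / 2) * N ^ α) := by gcongr
    _ = C * ((M * N) ^ (ε / 2) * (M * N) ^ (ε / 2)) * (M + N ^ α) := by ring
    _ = _ := by rw [← Real.rpow_add (by positivity), add_halves]

lemma PB_one : PB 1 := by
  set S : Set ℝ := {a | 1 ≤ a ∧ a ≤ 9 ∧ PB a} with hS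
  have hne : S.Nonempty := ⟨9, by norm_num, le_rfl, PB_nine⟩
  have hbd : BddBelow S := ⟨1, fun a ha => ha.1⟩
  set s := sInf S with hs
  have hs1 : 1 ≤ s := le_csInf hne fun a ha => ha.1
  have hs9 : s ≤ 9 := csInf_le hbd ⟨by norm_num, le_rfl, PB_nine⟩
  have hP : PB s := by
    apply PB_of_gt
    intro δ hδ
    obtain ⟨a, ha, hlt⟩ := exists_lt_of_csInf_lt hne (show sInf S < s + δ by linarith)
    exact ⟨a, hlt.le, ha.2.2⟩
  rcases eq_or_lt_of_le hs1 with h1 | h1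
  · rwa [h1]
  · exfalso
    have h2 := PB_improve hP h1 hs9
    have h3 : s ≤ s - (s - 1) ^ 2 / 4032 := csInf_le hbd ⟨by nlinarith, by nlinarith [sq_nonneg (s - 1)], h2⟩
    have : 0 < (s - 1) ^ 2 := by have : 0 < s - 1 := by linarith
                                 positivity
    linarith

lemma tau_le (r n : ℕ) (hn : n ≠ 0) : tau r n ≤ n.divisors.card ^ r := by
  unfold tau
  have e : n.divisors.card ^ r = Nat.card (Fin r → n.divisors) := by
    rw [Nat.card_eq_fintype_card, Fintype.card_fun, Fintype.card_fin, Fintype.card_coe]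
  rw [e]
  refine Nat.card_le_card_of_injective (fun f => fun i => ⟨f.1 i, Nat.mem_divisors.mpr ⟨?_, hn⟩⟩) ?_
  · have := Finset.dvd_prod_of_mem f.1 (Finset.mem_univ i)
    rwa [f.2.2] at this
  · intro f g hfg
    apply Subtype.ext
    funext i
    have := congrFun hfg i
    simpa using this

lemma tau_pow_le (r : ℕ) (hr : 1 ≤ r) {C ε : ℝ} (hC : 0 < C) (hε : 0 < ε) : ∃ K : ℝ, 0 < K ∧ ∀ n : ℕ, n ≠ 0 → (tau r n : ℝ) ^ C ≤ K * (n : ℝ) ^ ε := by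
  have hr0 : (0 : ℝ) < r := by exact_mod_cast hr
  obtain ⟨K, hK, h⟩ := div_card_le (ε := ε / (r * C)) (by positivity)
  refine ⟨K ^ (r * C), by positivity, fun n hn => ?_⟩
  have h1 : (tau r n : ℝ) ≤ (n.divisors.card : ℝ) ^ (r : ℝ) := by
    rw [Real.rpow_natCast]; exact_mod_cast tau_le r n hn
  calc (tau r n : ℝ) ^ C ≤ ((n.divisors.card : ℝ) ^ (r : ℝ)) ^ C := by gcongr
    _ = (n.divisors.card : ℝ) ^ (r * C) := by rw [← Real.rpow_mul (by positivity)]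
    _ ≤ (K * (n : ℝ) ^ (ε / (r * C))) ^ (r * C) := by gcongr; exact h n hn
    _ = _ := by
      rw [Real.mul_rpow (by positivity) (by positivity), ← Real.rpow_mul (by positivity)]
      congr 2; field_simp

lemma kron_eq (m n l c : ℕ) (hl : l ^ 2 ∣ m) (hc : c ^ 2 ∣ n / 2 ^ (n.factorization 2)) (hn : n ≠ 0) :
    ∃ w : ℂ, ‖w‖ ≤ 1 ∧ w = ((if (m : ℤ) % 2 = 0 then 0 else if (m : ℤ) % 8 = 1 ∨ (m : ℤ) % 8 = 7 then 1 else -1 : ℤ) : ℂ) ^ (n.factorization 2) * (jacobiSym m c : ℂ) ^ 2 ∧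
     (kroneckerSym (m : ℤ) n : ℂ) = w * ((jacobiSym l (n / (2 ^ (n.factorization 2) * c ^ 2)) : ℂ) ^ 2 * (jacobiSym (m / l ^ 2 : ℕ) (n / (2 ^ (n.factorization 2) * c ^ 2)) : ℂ)) := by
  refine ⟨_, ?_, rfl, ?_⟩
  · rw [norm_mul, norm_pow, norm_pow]
    refine mul_le_one₀ (pow_le_one₀ (norm_nonneg _) ?_) (by positivity) (pow_le_one₀ (norm_nonneg _) (norm_jac_le _ _))
    split_ifs <;> simp
  · unfold kroneckerSym
    rw [← Nat.div_div_eq_div_mul]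
    set j := n.factorization 2
    set n' := n / 2 ^ j with hn'
    have hn'0 : n' ≠ 0 := (Nat.ordCompl_pos 2 hn).ne'
    obtain ⟨q, hq⟩ := hc
    obtain ⟨k, hk⟩ := hl
    have hq0 : q ≠ 0 := by rintro rfl; simp at hq; exact hn'0 hq
    have hc0 : c ≠ 0 := by rintro rfl; simp at hq; exact hn'0 hq
    have : NeZero q := ⟨hq0⟩
    have : NeZero c := ⟨hc0⟩
    have e1 : n' / c ^ 2 = q := by rw [hq]; exact Nat.mul_div_cancel_left _ (by positivity)
    have e2 : jacobiSym (m : ℤ) n' = jacobiSym m c ^ 2 * (jacobiSym l q ^ 2 * jacobiSym (m / l ^ 2 : ℕ) q) := by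
      rw [hq, jacobiSym.mul_right, jacobiSym.pow_right]
      congr 1
      rcases Nat.eq_zero_or_pos l with h0 | h0
      · subst h0
        simp at hk
        subst hk
        by_cases hq1 : q = 1
        · subst hq1; simp
        · simp [jacobiSym.zero_left (show 1 < q by omega)]
      · have : m / l ^ 2 = k := by rw [hk]; exact Nat.mul_div_cancel_left _ (by positivity)
        rw [this, hk]
        push_cast
        rw [jacobiSym.mul_left, jacobiSym.pow_left]
    rw [e1, e2]
    push_cast
    ring

lemma cell_bound {ε : ℝ} (hε : 0 < ε) : ∃ C : ℝ, 0 < C ∧ ∀ (M Z b : ℝ) (l d : ℕ) (F G : Finset ℕ) (y : ℕ → ℂ), 1 ≤ M → 1 ≤ Z → 0 ≤ b → 1 ≤ l → 1 ≤ d →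
    (∀ m ∈ F, (m : ℝ) ≤ M ∧ l ^ 2 ∣ m ∧ Squarefree (m / l ^ 2)) →
    (∀ n ∈ G, (n : ℝ) ≤ Z ∧ d ∣ n ∧ Odd (n / d) ∧ Squarefree (n / d) ∧ ‖y n‖ ≤ b) →
    ∑ m ∈ F, ‖∑ n ∈ G, y n * (jacobiSym (m / l ^ 2 : ℕ) (n / d) : ℂ)‖ ≤
      C * (M * Z) ^ ε * ((1 / l) * (M * √(Z / d) + √M * (Z / d)) * b) := by
  obtain ⟨C, hC, h⟩ := PB_one ε hε
  refine ⟨C + 1, by positivity, ?_⟩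
  intro M Z b l d F G y hM hZ hb hl hd hF hG
  have hl1 : (1 : ℝ) ≤ l := by exact_mod_cast hl
  have hd1 : (1 : ℝ) ≤ d := by exact_mod_cast hd
  have hM0 : 0 < M := by linarith
  have hZ0 : 0 < Z := by linarith
  rcases F.eq_empty_or_nonempty with rfl | ⟨m0, hm0⟩
  · simp only [Finset.sum_empty]; positivity
  rcases G.eq_empty_or_nonempty with rfl | ⟨n0, hn0⟩
  · simp only [Finset.sum_empty, norm_zero, Finset.sum_const_zero]; positivity
  have hl2 : 0 < l ^ 2 := by positivity
  have hFi : Set.InjOn (fun m => m / l ^ 2) (F : Set ℕ) := by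
    intro a ha b hb hab
    have h1 := Nat.mul_div_cancel' (hF a ha).2.1
    have h2 := Nat.mul_div_cancel' (hF b hb).2.1
    simp only at hab
    rw [← h1, ← h2, hab]
  have hGi : Set.InjOn (fun n => n / d) (G : Set ℕ) := by
    intro a ha b hb hab
    have h1 := Nat.mul_div_cancel' (hG a ha).2.1
    have h2 := Nat.mul_div_cancel' (hG b hb).2.1
    simp only at hab
    rw [← h1, ← h2, hab]
  set X := M / (l : ℝ) ^ 2 with hX
  set Y := Z / d with hY
  have hFs : (F.image fun m => m / l ^ 2) ⊆ sqf X := by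
    intro k hk
    obtain ⟨m, hm, rfl⟩ := Finset.mem_image.mp hk
    obtain ⟨a1, a2, a3⟩ := hF m hm
    refine mem_sqf.mpr ⟨?_, a3⟩
    rw [Nat.cast_div a2 (by positivity), hX]
    push_cast
    gcongr
  have hGs : (G.image fun n => n / d) ⊆ osf Y := by
    intro k hk
    obtain ⟨n, hn, rfl⟩ := Finset.mem_image.mp hk
    obtain ⟨a1, a2, a3, a4, _⟩ := hG n hn
    refine mem_osf.mpr ⟨?_, a3, a4⟩
    rw [Nat.cast_div a2 (by positivity), hY]
    gcongr
  have hX1 : 1 ≤ X := by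
    have h1 := mem_sqf.mp (hFs (Finset.mem_image_of_mem _ hm0))
    have h2 : (1 : ℝ) ≤ (m0 / l ^ 2 : ℕ) := by exact_mod_cast Nat.pos_of_ne_zero h1.2.ne_zero
    exact h2.trans h1.1
  have hY1 : 1 ≤ Y := by
    have h1 := mem_osf.mp (hGs (Finset.mem_image_of_mem _ hn0))
    have h2 : (1 : ℝ) ≤ (n0 / d : ℕ) := by exact_mod_cast Nat.pos_of_ne_zero h1.2.2.ne_zero
    exact h2.trans h1.1
  have hXM : X ≤ M := div_le_self hM0.le (one_le_pow₀ hl1)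
  have hYZ : Y ≤ Z := div_le_self hZ0.le hd1
  have hsb := (h X Y hX1 hY1).mono le_rfl hGs le_rfl (fun n => y (d * n))
  have hcardF : (F.card : ℝ) ≤ X := by
    have := Finset.card_le_card hFs
    rw [Finset.card_image_of_injOn hFi] at this
    exact le_trans (by exact_mod_cast this) (card_sqf_le (by linarith))
  have hcardG : (G.card : ℝ) ≤ Y := by
    have h1 := cauchy_card (N := Y) (G.image fun n => n / d) (by linarith) hGs (fun _ => 1)
    simp at h1
    rw [Finset.card_image_of_injOn hGi] at h1
    have h2 : (0 : ℝ) < G.card := by exact_mod_cast Finset.card_pos.mpr ⟨n0, hn0⟩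
    nlinarith
  have hyb : ∑ n ∈ G.image (fun n => n / d), ‖y (d * n)‖ ^ 2 ≤ Y * b ^ 2 := by
    rw [Finset.sum_image hGi]
    calc _ ≤ ∑ n ∈ G, b ^ 2 := by
          refine Finset.sum_le_sum fun n hn => ?_
          rw [Nat.mul_div_cancel' (hG n hn).2.1]
          exact pow_le_pow_left₀ (norm_nonneg _) (hG n hn).2.2.2.2 2
      _ ≤ _ := by rw [Finset.sum_const, nsmul_eq_mul]; gcongr
  have hSx : ∀ k : ℕ, Sx (G.image fun n => n / d) (fun n => y (d * n)) k = ∑ n ∈ G, y n * (jacobiSym k (n / d) : ℂ) := by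
    intro k
    unfold Sx
    rw [Finset.sum_image hGi]
    exact Finset.sum_congr rfl fun n hn => by simp only [Nat.mul_div_cancel' (hG n hn).2.1]
  have hsq : (∑ m ∈ F, ‖∑ n ∈ G, y n * (jacobiSym (m / l ^ 2 : ℕ) (n / d) : ℂ)‖) ^ 2 ≤ X * (C * (X * Y) ^ ε * (X + Y ^ (1 : ℝ)) * (Y * b ^ 2)) := by
    calc _ ≤ F.card * ∑ m ∈ F, ‖∑ n ∈ G, y n * (jacobiSym (m / l ^ 2 : ℕ) (n / d) : ℂ)‖ ^ 2 := sq_sum_le_card_mul_sum_sq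
      _ ≤ X * ∑ k ∈ sqf X, ‖Sx (G.image fun n => n / d) (fun n => y (d * n)) k‖ ^ 2 := by
        gcongr
        calc _ = ∑ k ∈ F.image (fun m => m / l ^ 2), ‖Sx (G.image fun n => n / d) (fun n => y (d * n)) k‖ ^ 2 := by
              rw [Finset.sum_image hFi]
              exact Finset.sum_congr rfl fun m _ => by rw [hSx]
          _ ≤ _ := Finset.sum_le_sum_of_subset_of_nonneg hFs (fun _ _ _ => by positivity)
      _ ≤ X * (C * (X * Y) ^ ε * (X + Y ^ (1 : ℝ)) * ∑ n ∈ G.image (fun n => n / d), ‖y (d * n)‖ ^ 2) := by gcongr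
      _ ≤ _ := by gcongr
  rw [Real.rpow_one] at hsq
  have hMZ : 1 ≤ M * Z := by nlinarith
  set W := (M * Z) ^ ε with hW
  have hW1 : 1 ≤ W := Real.one_le_rpow hMZ hε.le
  have hXY : (X * Y) ^ ε ≤ W := Real.rpow_le_rpow (by positivity) (by gcongr) hε.le
  refine le_of_sq_le_sq ?_ (by positivity)
  refine hsq.trans ?_
  have s1 : √Y ^ 2 = Y := Real.sq_sqrt (by linarith)
  have s2 : √M ^ 2 = M := Real.sq_sqrt (by linarith)
  calc X * (C * (X * Y) ^ ε * (X + Y) * (Y * b ^ 2)) ≤ X * (C * W * (M + Y) * (Y * b ^ 2)) := by gcongr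
    _ = C * W * ((1 / l) ^ 2 * (M ^ 2 * Y + M * Y ^ 2) * b ^ 2) := by rw [hX]; field_simp
    _ ≤ (C + 1) ^ 2 * W ^ 2 * ((1 / l) ^ 2 * (M * √Y + √M * Y) ^ 2 * b ^ 2) := by
        gcongr ?_ * ?_ * (_ * ?_ * _)
        · nlinarith
        · nlinarith
        · have : (M * √Y + √M * Y) ^ 2 = M ^ 2 * Y + M * Y ^ 2 + 2 * (M * √Y * (√M * Y)) := by
            rw [add_sq, mul_pow, mul_pow, s1, s2]; ring
          rw [this]
          have : 0 ≤ 2 * (M * √Y * (√M * Y)) := by positivity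
          linarith
    _ = _ := by ring

lemma exists_sq_part (m : ℕ) (hm : m ≠ 0) : ∃ l : ℕ, 1 ≤ l ∧ l ^ 2 ∣ m ∧ Squarefree (m / l ^ 2) := by
  obtain ⟨a, b, h1, h2⟩ := Nat.sq_mul_squarefree m
  have hb : 0 < b := by
    rcases Nat.eq_zero_or_pos b with h | h
    · subst h; simp at h1; exact absurd h1.symm hm
    · exact h
  refine ⟨b, hb, ⟨a, h1.symm⟩, ?_⟩
  rw [← h1, Nat.mul_div_cancel_left _ (by positivity)]
  exact h2

lemma cell_two (A C1 V b M Z H : ℝ) (j l c : ℕ) (S T : Finset ℕ) (α β : ℕ → ℂ) (hA : 0 ≤ A) (hb : 0 ≤ b) (hC1 : 0 ≤ C1) (hV : 0 ≤ V) (hl : 1 ≤ l)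
    (hc : 1 ≤ c) (hM : 1 ≤ M) (hZ : 1 ≤ Z) (hH : H = M * √Z + √M * Z)
    (hα : ∀ m ∈ S, ‖α m‖ ≤ A) (hβ : ∀ n ∈ T, ‖β n‖ ≤ b)
    (hS : ∀ m ∈ S, l ^ 2 ∣ m) (hT : ∀ n ∈ T, n ≠ 0 ∧ n.factorization 2 = j ∧ c ^ 2 ∣ n / 2 ^ j)
    (hcell : ∀ y : ℕ → ℂ, (∀ n ∈ T, ‖y n‖ ≤ b) → ∑ m ∈ S, ‖∑ n ∈ T, y n * (jacobiSym (m / l ^ 2 : ℕ) (n / (2 ^ j * c ^ 2)) : ℂ)‖ ≤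
      C1 * V * ((1 / l) * (M * √(Z / (2 ^ j * c ^ 2 : ℕ)) + √M * (Z / (2 ^ j * c ^ 2 : ℕ))) * b)) :
    ‖∑ m ∈ S, ∑ n ∈ T, α m * β n * (kroneckerSym (m : ℤ) n : ℂ)‖ ≤ A * C1 * V * b * H * (1 / l * (1 / c)) := by
  set y : ℕ → ℂ := fun n => β n * (jacobiSym l (n / (2 ^ j * c ^ 2)) : ℂ) ^ 2 with hy
  have hyb : ∀ n ∈ T, ‖y n‖ ≤ b := by
    intro n hn
    rw [hy]
    simp only [norm_mul, norm_pow]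
    exact (mul_le_of_le_one_right (norm_nonneg _) (pow_le_one₀ (norm_nonneg _) (norm_jac_le _ _))).trans (hβ n hn)
  have h1 := hcell y hyb
  have h2 : ∀ m ∈ S, ‖∑ n ∈ T, α m * β n * (kroneckerSym (m : ℤ) n : ℂ)‖ ≤ A * ‖∑ n ∈ T, y n * (jacobiSym (m / l ^ 2 : ℕ) (n / (2 ^ j * c ^ 2)) : ℂ)‖ := by
    intro m hm
    set w : ℂ := ((if (m : ℤ) % 2 = 0 then 0 else if (m : ℤ) % 8 = 1 ∨ (m : ℤ) % 8 = 7 then 1 else -1 : ℤ) : ℂ) ^ j * (jacobiSym m c : ℂ) ^ 2 with hw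
    have hw1 : ‖w‖ ≤ 1 := by
      rw [hw, norm_mul, norm_pow, norm_pow]
      refine mul_le_one₀ (pow_le_one₀ (norm_nonneg _) ?_) (by positivity) (pow_le_one₀ (norm_nonneg _) (norm_jac_le _ _))
      split_ifs <;> simp
    have h3 : ∑ n ∈ T, α m * β n * (kroneckerSym (m : ℤ) n : ℂ) = α m * w * ∑ n ∈ T, y n * (jacobiSym (m / l ^ 2 : ℕ) (n / (2 ^ j * c ^ 2)) : ℂ) := by
      rw [Finset.mul_sum]
      refine Finset.sum_congr rfl fun n hn => ?_
      obtain ⟨t1, t2, t3⟩ := hT n hn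
      obtain ⟨w', _, q2, q3⟩ := kron_eq m n l c (hS m hm) (by rw [t2]; exact t3) t1
      rw [t2] at q2 q3
      rw [q3, q2, ← hw, hy]
      ring
    rw [h3, norm_mul, norm_mul]
    gcongr
    calc ‖α m‖ * ‖w‖ ≤ ‖α m‖ := mul_le_of_le_one_right (norm_nonneg _) hw1
      _ ≤ A := hα m hm
  have hc1 : (1 : ℝ) ≤ c := by exact_mod_cast hc
  have hl1 : (1 : ℝ) ≤ l := by exact_mod_cast hl
  have hd : (c : ℝ) ^ 2 ≤ ((2 ^ j * c ^ 2 : ℕ) : ℝ) := by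
    push_cast
    exact le_mul_of_one_le_left (by positivity) (one_le_pow₀ (by norm_num))
  have hZc : Z / ((2 ^ j * c ^ 2 : ℕ) : ℝ) ≤ Z / (c : ℝ) ^ 2 := by gcongr
  have e1 : √(Z / ((2 ^ j * c ^ 2 : ℕ) : ℝ)) ≤ √Z / c := by
    calc _ ≤ √(Z / (c : ℝ) ^ 2) := Real.sqrt_le_sqrt hZc
      _ = _ := by rw [Real.sqrt_div (by linarith), Real.sqrt_sq (by linarith)]
  have e2 : Z / ((2 ^ j * c ^ 2 : ℕ) : ℝ) ≤ Z / c := by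
    refine hZc.trans ?_
    gcongr
    nlinarith
  have hM0 : 0 ≤ M := by linarith
  calc _ ≤ ∑ m ∈ S, A * ‖∑ n ∈ T, y n * (jacobiSym (m / l ^ 2 : ℕ) (n / (2 ^ j * c ^ 2)) : ℂ)‖ := (norm_sum_le _ _).trans (Finset.sum_le_sum h2)
    _ ≤ A * (C1 * V * ((1 / l) * (M * √(Z / (2 ^ j * c ^ 2 : ℕ)) + √M * (Z / (2 ^ j * c ^ 2 : ℕ))) * b)) := by
        rw [← Finset.mul_sum]; gcongr
    _ ≤ A * (C1 * V * ((1 / l) * (M * (√Z / c) + √M * (Z / c)) * b)) := by gcongr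
    _ = _ := by rw [hH]; ring

theorem statement_5 (r : ℕ) (hr : 1 ≤ r) (C A : ℝ) (hC : 0 < C) (hA : 0 < A)
    (ε : ℝ) (hε : 0 < ε) :
    ∃ K : ℝ, 0 < K ∧
      ∀ M N : ℝ, 1 ≤ M → 1 ≤ N → N ≤ M ^ 2 →
        ∀ α β : ℕ → ℂ,
          (∀ m : ℕ, 1 ≤ m → ‖α m‖ ≤ A) →
          (∀ n : ℕ, 1 ≤ n → ‖β n‖ ≤ A * (tau r n : ℝ) ^ C / n) →
          ‖∑ m ∈ Finset.Icc 1 ⌊M⌋₊, ∑ n ∈ Finset.Ico ⌈N⌉₊ ⌈2 * N⌉₊,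
              α m * β n * (kroneckerSym (m : ℤ) n : ℂ)‖
            ≤ K * (M ^ ((1 : ℝ) + ε) * N ^ (-(1 : ℝ) / 2) + M ^ ((1 : ℝ) / 2 + ε)) := by
  set e := ε / 15 with he
  have he0 : 0 < e := by positivity
  obtain ⟨Ct, hCt, ht⟩ := tau_pow_le r hr hC he0
  obtain ⟨C1, hC1, h1⟩ := cell_bound he0
  obtain ⟨Ch, hCh, hh⟩ := harm_le he0
  obtain ⟨Cl, hCl, hlog⟩ := log_card_le he0
  refine ⟨A * C1 * (A * Ct) * Ch * Cl * Ch * 2 ^ (ε / 3) * 2, by positivity, ?_⟩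
  intro M N hM hN hNM α β hα hβ
  have hM0 : 0 < M := by linarith
  have hN0 : 0 < N := by linarith
  set Z := 2 * N with hZ
  have hZ1 : 1 ≤ Z := by linarith
  have hZ0 : 0 < Z := by linarith
  set V := (M * Z) ^ e with hV
  have hV0 : 0 < V := by positivity
  set b := A * Ct * V / N with hb
  have hb0 : 0 < b := by positivity
  have hMV : M ^ e ≤ V := Real.rpow_le_rpow hM0.le (by nlinarith) he0.le
  have hZV : Z ^ e ≤ V := Real.rpow_le_rpow hZ0.le (by nlinarith) he0.le
  set S := Finset.Icc 1 ⌊M⌋₊ with hS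
  set T := Finset.Ico ⌈N⌉₊ ⌈Z⌉₊ with hT
  have hSm : ∀ m ∈ S, 1 ≤ m ∧ (m : ℝ) ≤ M := fun m hm =>
    ⟨(Finset.mem_Icc.mp hm).1, (Nat.le_floor_iff hM0.le).mp (Finset.mem_Icc.mp hm).2⟩
  have hTn : ∀ n ∈ T, 1 ≤ n ∧ N ≤ n ∧ (n : ℝ) ≤ Z := by
    intro n hn
    obtain ⟨a1, a2⟩ := Finset.mem_Ico.mp hn
    have a3 : N ≤ n := Nat.ceil_le.mp a1
    have a4 : (n : ℝ) < Z := Nat.lt_ceil.mp a2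
    exact ⟨by exact_mod_cast hN.trans a3, a3, a4.le⟩
  have hβb : ∀ n ∈ T, ‖β n‖ ≤ b := by
    intro n hn
    obtain ⟨a1, a2, a3⟩ := hTn n hn
    have hn0 : (0 : ℝ) < n := by linarith
    calc ‖β n‖ ≤ A * (tau r n : ℝ) ^ C / n := hβ n a1
      _ ≤ A * (Ct * V) / N := by
        gcongr
        refine (ht n (by omega)).trans ?_
        gcongr
        exact (Real.rpow_le_rpow hn0.le a3 he0.le).trans hZV
      _ = b := by rw [hb]; ring
  choose! L hL using exists_sq_part
  set g : ℕ → ℕ × ℕ := fun n => (n.factorization 2, L (n / 2 ^ n.factorization 2)) with hg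
  set J := Finset.range (Nat.log 2 ⌊Z⌋₊ + 1) ×ˢ Finset.Icc 1 ⌊Z⌋₊ with hJ
  have hLS : ∀ m ∈ S, L m ∈ S := by
    intro m hm
    obtain ⟨a1, a2⟩ := Finset.mem_Icc.mp hm
    obtain ⟨b1, b2, _⟩ := hL m (by omega)
    have b3 : L m ∣ m := (dvd_pow_self _ two_ne_zero).trans b2
    exact Finset.mem_Icc.mpr ⟨b1, (Nat.le_of_dvd (by omega) b3).trans a2⟩
  have hgT : ∀ n ∈ T, g n ∈ J := by
    intro n hn
    obtain ⟨a1, _, a3⟩ := hTn n hn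
    have a4 : n ≤ ⌊Z⌋₊ := Nat.le_floor a3
    have a5 : 2 ^ n.factorization 2 ≤ ⌊Z⌋₊ := (Nat.ordProj_le 2 (by omega)).trans a4
    have a6 := Nat.ordCompl_pos 2 (n := n) (by omega)
    obtain ⟨b1, b2, _⟩ := hL _ a6.ne'
    have b3 : L (n / 2 ^ n.factorization 2) ∣ n / 2 ^ n.factorization 2 := (dvd_pow_self _ two_ne_zero).trans b2
    refine Finset.mem_product.mpr ⟨Finset.mem_range.mpr ?_, Finset.mem_Icc.mpr ⟨b1, ?_⟩⟩
    · exact Nat.lt_succ_of_le (Nat.le_log_of_pow_le (by norm_num) a5)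
    · exact (Nat.le_of_dvd a6 b3).trans ((Nat.div_le_self _ _).trans a4)
  set H := M * √Z + √M * Z with hH
  have hH0 : 0 ≤ H := by positivity
  have hsplit : ∑ m ∈ S, ∑ n ∈ T, α m * β n * (kroneckerSym (m : ℤ) n : ℂ) =
      ∑ l ∈ S, ∑ jc ∈ J, ∑ m ∈ S.filter (fun m => L m = l), ∑ n ∈ T.filter (fun n => g n = jc), α m * β n * (kroneckerSym (m : ℤ) n : ℂ) := by
    rw [← Finset.sum_fiberwise_of_maps_to hLS]
    refine Finset.sum_congr rfl fun l _ => ?_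
    rw [Finset.sum_comm (s := J)]
    refine Finset.sum_congr rfl fun m _ => ?_
    exact (Finset.sum_fiberwise_of_maps_to hgT _).symm
  have hcell : ∀ l ∈ S, ∀ jc ∈ J, ‖∑ m ∈ S.filter (fun m => L m = l), ∑ n ∈ T.filter (fun n => g n = jc), α m * β n * (kroneckerSym (m : ℤ) n : ℂ)‖
      ≤ A * C1 * V * b * H * (1 / l * (1 / jc.2)) := by
    intro l hl jc hjc
    obtain ⟨j, c⟩ := jc
    have hc1 : 1 ≤ c := (Finset.mem_Icc.mp (Finset.mem_product.mp hjc).2).1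
    have hl1 : 1 ≤ l := (Finset.mem_Icc.mp hl).1
    have hTT : ∀ n ∈ T.filter (fun n => g n = (j, c)), n ∈ T ∧ n ≠ 0 ∧ n.factorization 2 = j ∧ c ^ 2 ∣ n / 2 ^ j ∧ Squarefree (n / 2 ^ j / c ^ 2) := by
      intro n hn
      obtain ⟨a1, a2⟩ := Finset.mem_filter.mp hn
      have a3 : n ≠ 0 := by have := (hTn n a1).1; omega
      rw [hg] at a2
      obtain ⟨a4, a5⟩ := Prod.mk.inj a2
      have a6 := Nat.ordCompl_pos 2 a3
      obtain ⟨b1, b2, b3⟩ := hL _ a6.ne'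
      rw [a5, a4] at b2 b3
      exact ⟨a1, a3, a4, b2, b3⟩
    refine cell_two A C1 V b M Z H j l c _ _ α β hA.le hb0.le hC1.le hV0.le hl1 hc1 hM hZ1 hH ?_ ?_ ?_ ?_ ?_
    · intro m hm
      exact hα m (hSm m (Finset.mem_filter.mp hm).1).1
    · intro n hn
      exact hβb n (hTT n hn).1
    · intro m hm
      obtain ⟨a1, a2⟩ := Finset.mem_filter.mp hm
      have := (hL m (by have := (hSm m a1).1; omega)).2.1
      rwa [a2] at this
    · intro n hn
      exact ⟨(hTT n hn).2.1, (hTT n hn).2.2.1, (hTT n hn).2.2.2.1⟩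
    · intro y hy
      have hd1 : 1 ≤ 2 ^ j * c ^ 2 := Nat.mul_pos (by positivity) (by positivity)
      refine h1 M Z b l (2 ^ j * c ^ 2) _ _ y hM hZ1 hb0.le hl1 hd1 ?_ ?_
      · intro m hm
        obtain ⟨a1, a2⟩ := Finset.mem_filter.mp hm
        have := hL m (by have := (hSm m a1).1; omega)
        rw [a2] at this
        exact ⟨(hSm m a1).2, this.2⟩
      · intro n hn
        obtain ⟨a1, a2, a3, a4, a5⟩ := hTT n hn
        have a6 : 2 ^ j ∣ n := a3 ▸ Nat.ordProj_dvd n 2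
        refine ⟨(hTn n a1).2.2, Nat.mul_dvd_of_dvd_div a6 a4, ?_, ?_, hy n hn⟩
        · rw [← Nat.div_div_eq_div_mul]
          refine Odd.of_dvd_nat ?_ (Nat.div_dvd_of_dvd a4)
          rw [← Nat.not_even_iff_odd, even_iff_two_dvd]
          have := Nat.not_dvd_ordCompl Nat.prime_two a2
          rwa [a3] at this
        · rw [← Nat.div_div_eq_div_mul]; exact a5
  have hsumJ : ∑ jc ∈ J, (1 / (jc.2 : ℝ)) ≤ (Cl * V) * (Ch * V) := by
    rw [hJ, Finset.sum_product]
    simp only [Finset.sum_const, Finset.card_range, nsmul_eq_mul]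
    have q1 := hlog Z hZ1
    have q2 := hh Z hZ1
    push_cast
    gcongr
    · exact q1.trans (by gcongr)
    · exact q2.trans (by gcongr)
  have hsumS : ∑ l ∈ S, (1 / (l : ℝ)) ≤ Ch * V := (hh M hM).trans (by gcongr)
  have hV5 : V * V * V * V * V ≤ 2 ^ (ε / 3) * M ^ ε := by
    calc V * V * V * V * V = V ^ (5 : ℕ) := by ring
      _ = (M * Z) ^ (ε / 3) := by
        rw [hV, ← Real.rpow_natCast, ← Real.rpow_mul (by positivity), he]
        congr 1; push_cast; ring
      _ ≤ (2 * M ^ (3 : ℕ)) ^ (ε / 3) := by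
        apply Real.rpow_le_rpow (by positivity) _ (by positivity)
        rw [hZ]; nlinarith
      _ = _ := by
        rw [Real.mul_rpow (by norm_num) (by positivity), ← Real.rpow_natCast M 3, ← Real.rpow_mul hM0.le]
        congr 2; push_cast; ring
  have hHN : H / N ≤ 2 * (M * N ^ (-(1 : ℝ) / 2) + M ^ ((1 : ℝ) / 2)) := by
    have s0 : N ^ (-(1 : ℝ) / 2) = √N / N := by
      rw [show -(1 : ℝ) / 2 = 1 / 2 - 1 by norm_num, Real.rpow_sub_one hN0.ne', ← Real.sqrt_eq_rpow]
    have s1 : √Z ≤ 2 * √N := by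
      rw [hZ, Real.sqrt_mul (by norm_num)]
      gcongr
      rw [Real.sqrt_le_left (by norm_num)]; norm_num
    rw [s0, ← Real.sqrt_eq_rpow, hH, div_le_iff₀ hN0]
    calc M * √Z + √M * Z ≤ M * (2 * √N) + √M * Z := by gcongr
      _ = _ := by rw [hZ]; field_simp
  have hfin : M ^ ((1 : ℝ) + ε) * N ^ (-(1 : ℝ) / 2) + M ^ ((1 : ℝ) / 2 + ε) = M ^ ε * (M * N ^ (-(1 : ℝ) / 2) + M ^ ((1 : ℝ) / 2)) := by
    rw [Real.rpow_add hM0, Real.rpow_add hM0, Real.rpow_one]; ring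
  rw [hfin, hsplit]
  calc _ ≤ ∑ l ∈ S, ∑ jc ∈ J, A * C1 * V * b * H * (1 / l * (1 / jc.2)) := by
        refine (norm_sum_le _ _).trans (Finset.sum_le_sum fun l hl => ?_)
        exact (norm_sum_le _ _).trans (Finset.sum_le_sum fun jc hjc => hcell l hl jc hjc)
    _ = A * C1 * V * b * H * ((∑ l ∈ S, (1 / (l : ℝ))) * ∑ jc ∈ J, (1 / (jc.2 : ℝ))) := by
        rw [Finset.sum_mul_sum, Finset.mul_sum]
        refine Finset.sum_congr rfl fun l _ => ?_
        rw [Finset.mul_sum]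
    _ ≤ A * C1 * V * b * H * ((Ch * V) * ((Cl * V) * (Ch * V))) := by
        have : 0 ≤ ∑ jc ∈ J, (1 / (jc.2 : ℝ)) := Finset.sum_nonneg fun _ _ => by positivity
        gcongr
    _ = A * C1 * (A * Ct) * Ch * Cl * Ch * (V * V * V * V * V) * (H / N) := by rw [hb]; ring
    _ ≤ A * C1 * (A * Ct) * Ch * Cl * Ch * (2 ^ (ε / 3) * M ^ ε) * (2 * (M * N ^ (-(1 : ℝ) / 2) + M ^ ((1 : ℝ) / 2))) := by gcongr
    _ = _ := by ring
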